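/- Let ω be a radial weight in the class D̂, let 0<p<1 and 1<q<∞ with q'=q/(q−1). Then (A^{p,q}_ω)* ≃ B(q',ω) under the pairing ⟨f,g⟩_{ω,p} = lim_{r→1⁻} ∑_{n≥0} f̂(n)·conj(ĝ(n))·ω_{2n+1}·(ν_{1/p−2})_{2n+1}·rⁿ, with equivalence of norms: there exist constants C₁,C₂>0 (depending only on p,q,ω) such that (a) for every g∈B(q',ω) and every f∈A^{p,q}_ω the limit defining ⟨f,g⟩_{ω,p} exists and L_g(f)=⟨f,g⟩_{ω,p} defines a bounded linear functional on A^{p,q}_ω with ‖L_g‖ ≤ C₂‖g‖_{B(q',ω)}, and (b) every bounded linear functional L on A^{p,q}_ω equals L_g for some g∈B(q',ω) with ‖g‖_{B(q',ω)} ≤ C₁‖L‖. -/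

import Mathlib

open MeasureTheory Filter Set
open scoped ENNReal

noncomputable section

/-- `ω̂(r) = ∫_r^1 ω(s) ds`. -/
def omegaHat (ω : ℝ → ℝ) (r : ℝ) : ℝ := ∫ s in r..1, ω s

/-- A radial weight: nonnegative and Lebesgue integrable on `[0,1)`. -/
def IsRadialWeight (ω : ℝ → ℝ) : Prop :=
  (∀ r ∈ Set.Ico (0:ℝ) 1, 0 ≤ ω r) ∧ MeasureTheory.IntegrableOn ω (Set.Ico 0 1)

/-- The class `D̂` of upper doubling radial weights. -/
def InDhat (ω : ℝ → ℝ) : Prop :=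
  ∃ C > (0:ℝ), ∀ r ∈ Set.Ico (0:ℝ) 1, omegaHat ω r ≤ C * omegaHat ω ((1 + r) / 2)

/-- The class `Ď`. -/
def InDcheck (ω : ℝ → ℝ) : Prop :=
  ∃ K > (1:ℝ), ∃ C > (1:ℝ), ∀ r ∈ Set.Ico (0:ℝ) 1,
    C * omegaHat ω (1 - (1 - r) / K) ≤ omegaHat ω r

/-- Moments `μ_x = ∫_0^1 r^x μ(r) dr`. -/
def momentW (μ : ℝ → ℝ) (x : ℝ) : ℝ := ∫ r in (0:ℝ)..1, r ^ x * μ r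

/-- The coefficients `μ_{2k+1}` of the `A²_μ` pairing. -/
def momentCoeff (μ : ℝ → ℝ) : ℕ → ℝ := fun k => momentW μ (2 * (k:ℝ) + 1)

/-- The point `r e^{iθ}` of the circle of radius `r`. -/
def circlePt (r θ : ℝ) : ℂ := (r:ℂ) * Complex.exp ((θ:ℂ) * Complex.I)

/-- Integral means `M_p(r,f)` (with values in `[0,∞]`). -/
def MpE (p r : ℝ) (f : ℂ → ℂ) : ℝ≥0∞ :=
  (ENNReal.ofReal (1 / (2 * Real.pi)) *
    ∫⁻ θ in Set.Ioo (0:ℝ) (2 * Real.pi), ENNReal.ofReal (‖f (circlePt r θ)‖ ^ p)) ^ (1 / p)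

/-- Integral means of a `[0,∞]`-valued function. -/
def MpEE (p r : ℝ) (F : ℂ → ℝ≥0∞) : ℝ≥0∞ :=
  (ENNReal.ofReal (1 / (2 * Real.pi)) *
    ∫⁻ θ in Set.Ioo (0:ℝ) (2 * Real.pi), (F (circlePt r θ)) ^ p) ^ (1 / p)

/-- The norm of the mixed norm space `L^{p,q}_ω`. -/
def LpqNormE (ω : ℝ → ℝ) (p q : ℝ) (f : ℂ → ℂ) : ℝ≥0∞ :=
  (∫⁻ r in Set.Ioo (0:ℝ) 1, (MpE p r f) ^ q * ENNReal.ofReal (r * ω r)) ^ (1 / q)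

/-- The `L^{p,q}_ω` norm of a `[0,∞]`-valued function. -/
def LpqNormEE (ω : ℝ → ℝ) (p q : ℝ) (F : ℂ → ℝ≥0∞) : ℝ≥0∞ :=
  (∫⁻ r in Set.Ioo (0:ℝ) 1, (MpEE p r F) ^ q * ENNReal.ofReal (r * ω r)) ^ (1 / q)

/-- The norm of `A^{p,∞}_ω` : `sup_{0 ≤ r < 1} M_p(r,f) ω̂(r)`. -/
def ApInfNormE (ω : ℝ → ℝ) (p : ℝ) (f : ℂ → ℂ) : ℝ≥0∞ :=
  ⨆ r ∈ Set.Ico (0:ℝ) 1, MpE p r f * ENNReal.ofReal (omegaHat ω r)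

/-- Membership in the mixed norm space `A^{p,q}_ω`. -/
def InApq (ω : ℝ → ℝ) (p q : ℝ) (f : ℂ → ℂ) : Prop :=
  DifferentiableOn ℂ f (Metric.ball 0 1) ∧ LpqNormE ω p q f < ⊤

/-- Membership in `A^{p,∞}_ω`. -/
def InApInf (ω : ℝ → ℝ) (p : ℝ) (f : ℂ → ℂ) : Prop :=
  DifferentiableOn ℂ f (Metric.ball 0 1) ∧ ApInfNormE ω p f < ⊤

/-- Taylor coefficient of `f` at `0`. -/
def taylorCoeff (f : ℂ → ℂ) (n : ℕ) : ℂ := iteratedDeriv n f 0 / (n.factorial : ℂ)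

/-- The pairing `⟨f,g⟩ = lim_{r→1⁻} ∑_k f̂(k) conj(ĝ(k)) c(k) r^k` exists and equals `l`. -/
def HasPairingC (c : ℕ → ℝ) (f g : ℂ → ℂ) (l : ℂ) : Prop :=
  (∀ r ∈ Set.Ico (0:ℝ) 1, Summable (fun k : ℕ =>
    taylorCoeff f k * (starRingEnd ℂ) (taylorCoeff g k) * ((c k : ℝ) : ℂ) * ((r:ℂ)) ^ k)) ∧
  Filter.Tendsto (fun r : ℝ => ∑' k : ℕ,
    taylorCoeff f k * (starRingEnd ℂ) (taylorCoeff g k) * ((c k : ℝ) : ℂ) * ((r:ℂ)) ^ k)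
    (nhdsWithin 1 (Set.Iio 1)) (nhds l)

/-- `L` is linear on the functions satisfying `P`. -/
def IsLinearOn (P : (ℂ → ℂ) → Prop) (L : (ℂ → ℂ) → ℂ) : Prop :=
  (∀ f g : ℂ → ℂ, P f → P g → L (f + g) = L f + L g) ∧
  (∀ (c : ℂ) (f : ℂ → ℂ), P f → L (c • f) = c * L f)

/-- Dilation `f_r(z) = f(rz)`. -/
def dilateF (f : ℂ → ℂ) (r : ℝ) : ℂ → ℂ := fun z => f ((r:ℂ) * z)

/-- The BMOA norm `|f(0)| + sup_{a∈D} sup_{0<r<1} M₂(r, f∘φ_a - f(a))`. -/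
def BMOANormE (f : ℂ → ℂ) : ℝ≥0∞ :=
  ENNReal.ofReal ‖f 0‖ +
    ⨆ a ∈ Metric.ball (0:ℂ) 1, ⨆ r ∈ Set.Ioo (0:ℝ) 1,
      MpE 2 r (fun z => f ((a - z) / (1 - (starRingEnd ℂ) a * z)) - f a)

/-- The Bloch norm `|f(0)| + sup_{z∈D} (1-|z|²)|f'(z)|`. -/
def BlochNormE (f : ℂ → ℂ) : ℝ≥0∞ :=
  ENNReal.ofReal ‖f 0‖ +
    ⨆ z ∈ Metric.ball (0:ℂ) 1, ENNReal.ofReal ((1 - ‖z‖ ^ 2) * ‖deriv f z‖)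

/-- The norm of `X(q,ω)`: `(∫_0^1 ‖f_r‖_X^q ω(r) dr)^{1/q}`. -/
def XqNormE (Xnorm : (ℂ → ℂ) → ℝ≥0∞) (ω : ℝ → ℝ) (q : ℝ) (f : ℂ → ℂ) : ℝ≥0∞ :=
  (∫⁻ r in Set.Ioo (0:ℝ) 1, (Xnorm (dilateF f r)) ^ q * ENNReal.ofReal (ω r)) ^ (1 / q)

/-- The norm of `X(∞,ω)`: `sup_{0<r<1} ‖f_r‖_X ω̂(r)`. -/
def XInfNormE (Xnorm : (ℂ → ℂ) → ℝ≥0∞) (ω : ℝ → ℝ) (f : ℂ → ℂ) : ℝ≥0∞ :=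
  ⨆ r ∈ Set.Ioo (0:ℝ) 1, Xnorm (dilateF f r) * ENNReal.ofReal (omegaHat ω r)

/-- The standard radial weight `ν_β(r) = (β+1)(1-r²)^β`. -/
def nuWeight (β : ℝ) : ℝ → ℝ := fun r => (β + 1) * (1 - r ^ 2) ^ β

/-- The Bergman reproducing kernel `B^ω_a(z) = ∑ (z conj a)^n / (2 ω_{2n+1})`. -/
def bergmanKernel (ω : ℝ → ℝ) (a z : ℂ) : ℂ :=
  ∑' n : ℕ, (z * (starRingEnd ℂ) a) ^ n / (2 * ((momentW ω (2 * (n:ℝ) + 1) : ℝ) : ℂ))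

/-- The Bergman projection (`dA` is normalized area measure). -/
def PomegaProj (ω : ℝ → ℝ) (f : ℂ → ℂ) (z : ℂ) : ℂ :=
  (Real.pi)⁻¹ • ∫ ζ in Metric.ball (0:ℂ) 1,
    f ζ * (starRingEnd ℂ) (bergmanKernel ω z ζ) * ((ω ‖ζ‖ : ℝ) : ℂ)

/-- The maximal Bergman projection applied to `|f|`, with values in `[0,∞]`. -/
def PomegaPlusL (ω : ℝ → ℝ) (f : ℂ → ℂ) (z : ℂ) : ℝ≥0∞ :=
  ∫⁻ ζ in Metric.ball (0:ℂ) 1,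
    ENNReal.ofReal (‖f ζ‖ * ‖bergmanKernel ω z ζ‖ * ω ‖ζ‖ / Real.pi)

/-- The Hardy `H¹` norm. -/
def H1NormE (f : ℂ → ℂ) : ℝ≥0∞ := ⨆ r ∈ Set.Ioo (0:ℝ) 1, MpE 1 r f

/-- `r_n = inf{ r ∈ [0,1) : ω̂(r) = ω̂(0) K^{-n} }`. -/
def rSeq (ω : ℝ → ℝ) (K : ℝ) (n : ℕ) : ℝ :=
  sInf {r | r ∈ Set.Ico (0:ℝ) 1 ∧ omegaHat ω r = omegaHat ω 0 * K ^ (-(n:ℝ))}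

/-- `M_n = ⌊1/(1-r_n)⌋`. -/
def MSeq (ω : ℝ → ℝ) (K : ℝ) (n : ℕ) : ℕ := ⌊1 / (1 - rSeq ω K n)⌋₊

/-- Weighted Hadamard product of a polynomial with an analytic function:
`z ↦ ∑_j c(j) P̂(j) ĝ(j) z^j`. -/
def hadamardPolyC (c : ℕ → ℂ) (P : Polynomial ℂ) (g : ℂ → ℂ) : ℂ → ℂ :=
  fun z => ∑ j ∈ Finset.range (P.natDegree + 1), c j * P.coeff j * taylorCoeff g j * z ^ j

/-- An admissible Banach space of analytic functions on the unit disc, given by a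
carrier set and a norm function. -/
structure AdmissibleSpace where
  carrier : Set (ℂ → ℂ)
  nrm : (ℂ → ℂ) → ℝ
  mem_analytic : ∀ f ∈ carrier, DifferentiableOn ℂ f (Metric.ball 0 1)
  zero_mem : (0 : ℂ → ℂ) ∈ carrier
  add_mem : ∀ f g : ℂ → ℂ, f ∈ carrier → g ∈ carrier → f + g ∈ carrier
  smul_mem : ∀ (c : ℂ) (f : ℂ → ℂ), f ∈ carrier → c • f ∈ carrier
  nrm_nonneg : ∀ f ∈ carrier, 0 ≤ nrm f
  nrm_eq_zero : ∀ f ∈ carrier, nrm f = 0 → ∀ z ∈ Metric.ball (0:ℂ) 1, f z = 0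
  nrm_add : ∀ f g : ℂ → ℂ, f ∈ carrier → g ∈ carrier → nrm (f + g) ≤ nrm f + nrm g
  nrm_smul : ∀ (c : ℂ) (f : ℂ → ℂ), f ∈ carrier → nrm (c • f) = ‖c‖ * nrm f
  complete : ∀ u : ℕ → (ℂ → ℂ), (∀ n, u n ∈ carrier) →
    (∀ ε : ℝ, 0 < ε → ∃ N : ℕ, ∀ m ≥ N, ∀ n ≥ N, nrm (u m - u n) < ε) →
    ∃ f ∈ carrier, Filter.Tendsto (fun n => nrm (u n - f)) Filter.atTop (nhds 0)
  norm_conv_implies_ucc : ∀ (u : ℕ → (ℂ → ℂ)) (f : ℂ → ℂ),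
    (∀ n, u n ∈ carrier) → f ∈ carrier →
    Filter.Tendsto (fun n => nrm (u n - f)) Filter.atTop (nhds 0) →
    ∀ Kc : Set ℂ, Kc ⊆ Metric.ball 0 1 → IsCompact Kc →
      TendstoUniformlyOn (fun n => u n) f Filter.atTop Kc
  ucc_implies_norm_conv : ∀ R : ℝ, 1 < R → ∀ (u : ℕ → (ℂ → ℂ)) (f : ℂ → ℂ),
    (∀ n, u n ∈ carrier ∧ DifferentiableOn ℂ (u n) (Metric.ball 0 R)) →
    DifferentiableOn ℂ f (Metric.ball 0 R) →
    (∀ Kc : Set ℂ, Kc ⊆ Metric.ball (0:ℂ) R → IsCompact Kc →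
      TendstoUniformlyOn (fun n => u n) f Filter.atTop Kc) →
    f ∈ carrier ∧ Filter.Tendsto (fun n => nrm (u n - f)) Filter.atTop (nhds 0)
  dilation_bound : ∃ C > (0:ℝ), ∀ f ∈ carrier, ∀ ζ : ℂ, ‖ζ‖ ≤ 1 →
    (fun z => f (ζ * z)) ∈ carrier ∧ nrm (fun z => f (ζ * z)) ≤ C * nrm f

/-- The operator `T_p = I^{ν_{1/p-2}}`. -/
def TpOp (p : ℝ) (g : ℂ → ℂ) : ℂ → ℂ :=
  fun z => ∑' k : ℕ,
    taylorCoeff g k * ((momentW (nuWeight (1 / p - 2)) (2 * (k:ℝ) + 1) : ℝ) : ℂ) * z ^ k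

/-- Membership in the Bloch space. -/
def InBloch (g : ℂ → ℂ) : Prop :=
  DifferentiableOn ℂ g (Metric.ball 0 1) ∧ BlochNormE g < ⊤

open Classical in
/-- The norm of the space `X_p = T_p(B)`, normed so that `T_p` is an isometry. -/
def XpNormE (p : ℝ) (h : ℂ → ℂ) : ℝ≥0∞ :=
  if H : ∃ g : ℂ → ℂ, InBloch g ∧ Set.EqOn h (TpOp p g) (Metric.ball 0 1)
  then BlochNormE H.choose else ⊤

/-- The polynomial `V_n ∗ g` where `V_n(z) = ∑_{j=2^{n-1}}^{2^{n+1}-1} ψ(j/2^{n-1}) z^j`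
and `ψ(t) = Ψ(t/2) - Ψ(t)`. -/
def VnStar (Ψ : ℝ → ℝ) (n : ℕ) (g : ℂ → ℂ) : ℂ → ℂ :=
  fun z => ∑ j ∈ Finset.Icc (2 ^ (n - 1) : ℕ) (2 ^ (n + 1) - 1 : ℕ),
    (((Ψ ((j:ℝ) / 2 ^ n) - Ψ ((j:ℝ) / 2 ^ (n - 1))) : ℝ) : ℂ) * taylorCoeff g j * z ^ j

/-- `D^ω(V_n ∗ g)`, where `D^ω h(z) = ∑ ĥ(k) z^k/(2ω_{2k+1})`. -/
def DVnStar (Ψ : ℝ → ℝ) (ω : ℝ → ℝ) (n : ℕ) (g : ℂ → ℂ) : ℂ → ℂ :=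
  fun z => ∑ j ∈ Finset.Icc (2 ^ (n - 1) : ℕ) (2 ^ (n + 1) - 1 : ℕ),
    (((Ψ ((j:ℝ) / 2 ^ n) - Ψ ((j:ℝ) / 2 ^ (n - 1))) : ℝ) : ℂ) * taylorCoeff g j * z ^ j /
      (2 * ((momentW ω (2 * (j:ℝ) + 1) : ℝ) : ℂ))

/-- `J_ω(t) = ∫_0^t ds/(ω̂(s)(1-s))`. -/
def Jomega (ω : ℝ → ℝ) (t : ℝ) : ℝ := ∫ s in (0:ℝ)..t, 1 / (omegaHat ω s * (1 - s))

/-- Normalized arc length on the circle, parametrized by the angle. -/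
def circMeas : Measure ℝ :=
  ENNReal.ofReal (1 / (2 * Real.pi)) • volume.restrict (Set.Ioo (0:ℝ) (2 * Real.pi))

instance : IsProbabilityMeasure circMeas := by
  constructor
  rw [circMeas, Measure.smul_apply, Measure.restrict_apply MeasurableSet.univ, univ_inter,
    Real.volume_Ioo, sub_zero, smul_eq_mul, ← ENNReal.ofReal_mul (by positivity),
    one_div_mul_cancel (by positivity), ENNReal.ofReal_one]

lemma circlePt_eq_circleMap (r θ : ℝ) : circlePt r θ = circleMap 0 r θ := by
  simp [circlePt, circleMap]

lemma circlePt_eq_mul (r θ : ℝ) : circlePt r θ = (r : ℂ) * circlePt 1 θ := by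
  simp [circlePt]

lemma circlePt_mul (r s θ : ℝ) : circlePt (r * s) θ = (r : ℂ) * circlePt s θ := by
  simp [circlePt, mul_assoc]

@[fun_prop]
lemma continuous_circlePt (r : ℝ) : Continuous (circlePt r) := by
  unfold circlePt; fun_prop

lemma norm_circlePt (r θ : ℝ) : ‖circlePt r θ‖ = |r| := by
  simp [circlePt_eq_circleMap]

lemma norm_circlePt_one (θ : ℝ) : ‖circlePt 1 θ‖ = 1 := by simp [norm_circlePt]

lemma circleAverage_eq_integral {E : Type*} [NormedAddCommGroup E] [NormedSpace ℝ E]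
    (f : ℂ → E) (r : ℝ) :
    Real.circleAverage f 0 r = ∫ θ, f (circlePt r θ) ∂circMeas := by
  rw [Real.circleAverage, circMeas, integral_smul_measure, ENNReal.toReal_ofReal (by positivity),
    intervalIntegral.integral_of_le (by positivity), integral_Ioc_eq_integral_Ioo, one_div]
  simp only [circlePt_eq_circleMap]

lemma lintegral_circMeas (F : ℝ → ℝ≥0∞) :
    ∫⁻ θ, F θ ∂circMeas = ENNReal.ofReal (1 / (2 * Real.pi)) *
      ∫⁻ θ in Set.Ioo (0:ℝ) (2 * Real.pi), F θ := by
  rw [circMeas, lintegral_smul_measure, smul_eq_mul]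

lemma MpE_eq (p r : ℝ) (f : ℂ → ℂ) :
    MpE p r f = (∫⁻ θ, ENNReal.ofReal (‖f (circlePt r θ)‖ ^ p) ∂circMeas) ^ (1 / p) := by
  rw [MpE, lintegral_circMeas]

lemma integrable_circMeas_of_continuous {E : Type*} [NormedAddCommGroup E]
    {h : ℝ → E} (hh : Continuous h) : Integrable h circMeas := by
  refine Integrable.smul_measure ?_ ENNReal.ofReal_ne_top
  exact (hh.integrableOn_Icc (a := 0) (b := 2 * Real.pi)).mono_set Ioo_subset_Icc_self

lemma exists_polynomial_re_approx {u : ℂ → ℝ} (hu : ContinuousOn u (Metric.sphere 0 1))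
    {ε : ℝ} (hε : 0 < ε) :
    ∃ Q : Polynomial ℂ, ∀ z ∈ Metric.sphere (0:ℂ) 1, |(Q.eval z).re - u z| < ε := by
  have : Fact (0 < 2 * Real.pi) := ⟨by positivity⟩
  have hmem : ∀ x : AddCircle (2 * Real.pi), ((AddCircle.toCircle x : Circle) : ℂ) ∈
      Metric.sphere (0:ℂ) 1 := fun x => by simp [Circle.norm_coe]
  let U : C(AddCircle (2 * Real.pi), ℂ) :=
    ⟨fun x => ((u (AddCircle.toCircle x : ℂ) : ℝ) : ℂ), by
      refine Complex.continuous_ofReal.comp ?_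
      refine hu.comp_continuous ?_ hmem
      exact continuous_subtype_val.comp AddCircle.continuous_toCircle⟩
  have hU : U ∈ (Submodule.span ℂ (range (fourier (T := 2 * Real.pi)))).topologicalClosure := by
    rw [span_fourier_closure_eq_top]; trivial
  rw [← SetLike.mem_coe, Submodule.topologicalClosure_coe, Metric.mem_closure_iff] at hU
  obtain ⟨F, hF, hFU⟩ := hU ε hε
  have key : ∀ c : ℂ, ∃ Q : Polynomial ℂ, ∀ x : AddCircle (2 * Real.pi),
      (c * F x).re = (Q.eval ((AddCircle.toCircle x : Circle) : ℂ)).re := by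
    refine Submodule.span_induction (p := fun F _ => ∀ c : ℂ, ∃ Q : Polynomial ℂ,
      ∀ x : AddCircle (2 * Real.pi),
      (c * F x).re = (Q.eval ((AddCircle.toCircle x : Circle) : ℂ)).re) ?_ ?_ ?_ ?_ hF
    · rintro _ ⟨n, rfl⟩ c
      obtain ⟨m, rfl | rfl⟩ := n.eq_nat_or_neg
      · refine ⟨Polynomial.C c * Polynomial.X ^ m, fun x => ?_⟩
        simp [fourier_apply, AddCircle.toCircle_nsmul]
      · refine ⟨Polynomial.C ((starRingEnd ℂ) c) * Polynomial.X ^ m, fun x => ?_⟩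
        rw [fourier_neg, ← Complex.conj_re]
        simp [fourier_apply, AddCircle.toCircle_nsmul]
    · intro c; exact ⟨0, fun x => by simp⟩
    · intro F G _ _ hF hG c
      obtain ⟨Q, hQ⟩ := hF c
      obtain ⟨R, hR⟩ := hG c
      exact ⟨Q + R, fun x => by simp [mul_add, ← hQ, ← hR]⟩
    · intro a F _ hF c
      obtain ⟨Q, hQ⟩ := hF (c * a)
      exact ⟨Q, fun x => by rw [← hQ]; simp [mul_assoc]⟩
  obtain ⟨Q, hQ⟩ := key 1
  refine ⟨Q, fun z hz => ?_⟩
  obtain ⟨t, ht⟩ := (AddCircle.homeomorphCircle (T := 2 * Real.pi) (by positivity)).surjective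
    ⟨z, mem_sphere_zero_iff_norm.2 (mem_sphere_zero_iff_norm.1 hz)⟩
  rw [AddCircle.homeomorphCircle_apply] at ht
  have hz' : ((AddCircle.toCircle t : Circle) : ℂ) = z := by rw [ht]
  have h1 := hQ t
  rw [hz', one_mul] at h1
  have h2 : dist (U t) (F t) < ε := lt_of_le_of_lt (ContinuousMap.dist_apply_le_dist t) hFU
  have h3 : U t = ((u z : ℝ) : ℂ) := by simp only [U, ContinuousMap.coe_mk, hz']
  rw [← h1]
  calc |(F t).re - u z| = |(F t - U t).re| := by rw [h3]; simp
    _ ≤ ‖F t - U t‖ := Complex.abs_re_le_norm _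
    _ = dist (U t) (F t) := by rw [dist_comm, dist_eq_norm]
    _ < ε := h2

lemma poissonKernel_zero_apply (w z : ℂ) :
    poissonKernel 0 w z = (‖z‖ ^ 2 - ‖w‖ ^ 2) / ‖z - w‖ ^ 2 := by
  simp [poissonKernel_def]

lemma poissonKernel_nonneg {w z : ℂ} (hw : ‖w‖ ≤ ‖z‖) : 0 ≤ poissonKernel 0 w z := by
  rw [poissonKernel_zero_apply]
  have : ‖w‖ ^ 2 ≤ ‖z‖ ^ 2 := by gcongr
  exact div_nonneg (by linarith) (by positivity)

lemma poissonKernel_circlePt_nonneg {w : ℂ} (hw : ‖w‖ < 1) (θ : ℝ) :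
    0 ≤ poissonKernel 0 w (circlePt 1 θ) :=
  poissonKernel_nonneg (by rw [norm_circlePt_one]; exact hw.le)

lemma continuous_poissonKernel_circlePt {w : ℂ} (hw : ‖w‖ < 1) :
    Continuous fun θ => poissonKernel 0 w (circlePt 1 θ) := by
  simp only [poissonKernel_zero_apply]
  refine Continuous.div (by fun_prop) (by fun_prop) fun θ => ?_
  have : circlePt 1 θ ≠ w := by
    rintro rfl
    rw [norm_circlePt_one] at hw
    exact lt_irrefl _ hw
  have := norm_pos_iff.2 (sub_ne_zero.2 this)
  positivity

/-- Poisson's formula on the unit disc. -/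
lemma integral_poissonKernel_smul {f : ℂ → ℂ} {w : ℂ} (hf : DiffContOnCl ℂ f (Metric.ball 0 1))
    (hw : ‖w‖ < 1) :
    ∫ θ, poissonKernel 0 w (circlePt 1 θ) • f (circlePt 1 θ) ∂circMeas = f w := by
  have := hf.circleAverage_poissonKernel_smul (w := w) (by simpa using hw)
  rw [circleAverage_eq_integral] at this
  simpa using this

lemma integral_poissonKernel {w : ℂ} (hw : ‖w‖ < 1) :
    ∫ θ, poissonKernel 0 w (circlePt 1 θ) ∂circMeas = 1 := by
  have := integral_poissonKernel_smul (f := fun _ => 1) (w := w) diffContOnCl_const hw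
  rw [← Complex.ofReal_inj, ← integral_complex_ofReal]
  simpa using this

/-- The Poisson kernel dominates the subharmonic function `‖f‖ ^ s`. -/
lemma norm_rpow_le_integral_poissonKernel {f : ℂ → ℂ} {w : ℂ} {s : ℝ} (hs : 0 < s)
    (hf : DiffContOnCl ℂ f (Metric.ball 0 1)) (hw : ‖w‖ < 1) :
    ‖f w‖ ^ s ≤
      ∫ θ, poissonKernel 0 w (circlePt 1 θ) * ‖f (circlePt 1 θ)‖ ^ s ∂circMeas := by
  have hcont : ContinuousOn f (Metric.closedBall 0 1) := by
    simpa [closure_ball] using hf.continuousOn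
  have hcirc : Continuous fun θ => f (circlePt 1 θ) :=
    hcont.comp_continuous (by fun_prop) fun θ => by simp [norm_circlePt_one]
  set P : ℝ → ℝ := fun θ => poissonKernel 0 w (circlePt 1 θ) with hP
  have hPc : Continuous P := continuous_poissonKernel_circlePt hw
  have hP0 : ∀ θ, 0 ≤ P θ := poissonKernel_circlePt_nonneg hw
  have hP1 : ∫ θ, P θ ∂circMeas = 1 := integral_poissonKernel hw
  have main : ∀ ε : ℝ, 0 < ε → ‖f w‖ ^ s ≤
      Real.exp (2 * s * ε) * ∫ θ, P θ * (‖f (circlePt 1 θ)‖ + ε) ^ s ∂circMeas := by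
    intro ε hε
    have hu : ContinuousOn (fun z => Real.log (‖f z‖ + ε) + ε) (Metric.sphere 0 1) := by
      refine ContinuousOn.add (ContinuousOn.log ?_ ?_) continuousOn_const
      · exact ((hcont.mono Metric.sphere_subset_closedBall).norm).add continuousOn_const
      · intro z _; positivity
    obtain ⟨Q, hQ⟩ := exists_polynomial_re_approx hu hε
    have hQ1 : ∀ z ∈ Metric.sphere (0:ℂ) 1, ‖f z‖ ≤ Real.exp (Q.eval z).re ∧
        Real.exp (Q.eval z).re ≤ (‖f z‖ + ε) * Real.exp (2 * ε) := by
      intro z hz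
      have h := abs_lt.1 (hQ z hz)
      have hpos : 0 < ‖f z‖ + ε := by positivity
      constructor
      · calc ‖f z‖ ≤ ‖f z‖ + ε := by linarith
          _ = Real.exp (Real.log (‖f z‖ + ε)) := (Real.exp_log hpos).symm
          _ ≤ _ := Real.exp_le_exp.2 (by linarith)
      · calc Real.exp (Q.eval z).re ≤ Real.exp (Real.log (‖f z‖ + ε) + 2 * ε) :=
            Real.exp_le_exp.2 (by linarith)
          _ = _ := by rw [Real.exp_add, Real.exp_log hpos]
    have hQd : Differentiable ℂ fun z => Complex.exp (-(Q.eval z)) :=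
      (Q.differentiable.neg).cexp
    have hmax : ‖f w * Complex.exp (-(Q.eval w))‖ ≤ 1 := by
      refine Complex.norm_le_of_forall_mem_frontier_norm_le (U := Metric.ball 0 1)
        (f := fun z => f z * Complex.exp (-(Q.eval z))) Metric.isBounded_ball ?_ ?_ ?_
      · exact hf.smul hQd.diffContOnCl
      · intro z hz
        rw [frontier_ball _ one_ne_zero] at hz
        rw [norm_mul, Complex.norm_exp, Complex.neg_re, Real.exp_neg, ← div_eq_mul_inv]
        exact (div_le_one (Real.exp_pos _)).2 (hQ1 z hz).1
      · exact subset_closure (by simpa using hw)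
    rw [norm_mul, Complex.norm_exp, Complex.neg_re, Real.exp_neg, ← div_eq_mul_inv,
      div_le_one (Real.exp_pos _)] at hmax
    have hre : (Q.eval w).re = ∫ θ, P θ * (Q.eval (circlePt 1 θ)).re ∂circMeas := by
      rw [← integral_poissonKernel_smul (f := fun z => Q.eval z) Q.differentiable.diffContOnCl hw]
      have hi : Integrable (fun θ => P θ • Q.eval (circlePt 1 θ)) circMeas :=
        integrable_circMeas_of_continuous (hPc.smul (Q.continuous.comp (continuous_circlePt 1)))
      have := integral_re hi
      simp only [RCLike.re_to_complex] at this
      rw [← this]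
      simp
    set v : ℝ → ℝ := fun θ => (Q.eval (circlePt 1 θ)).re with hv
    have hvc : Continuous v :=
      Complex.continuous_re.comp (Q.continuous.comp (continuous_circlePt 1))
    set m := (Q.eval w).re with hm
    have hjensen : Real.exp (s * m) ≤ ∫ θ, P θ * Real.exp (s * v θ) ∂circMeas := by
      have h1 : ∫ θ, (Real.exp (s * m) * (1 - s * m) * P θ +
          Real.exp (s * m) * s * (P θ * v θ)) ∂circMeas = Real.exp (s * m) := by
        rw [integral_add, integral_const_mul, integral_const_mul, hP1, ← hre]
        · ring
        · exact integrable_circMeas_of_continuous (by fun_prop)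
        · exact integrable_circMeas_of_continuous (by fun_prop)
      rw [← h1]
      refine integral_mono (integrable_circMeas_of_continuous (by fun_prop))
        (integrable_circMeas_of_continuous (by fun_prop)) fun θ => ?_
      have h2 : Real.exp (s * m) * (1 + s * v θ - s * m) ≤ Real.exp (s * v θ) := by
        have := Real.add_one_le_exp (s * v θ - s * m)
        calc _ ≤ Real.exp (s * m) * Real.exp (s * v θ - s * m) := by gcongr; linarith
          _ = _ := by rw [← Real.exp_add]; ring_nf
      have := mul_le_mul_of_nonneg_left h2 (hP0 θ)
      simp only
      linarith
    have hfs : Continuous fun θ => (‖f (circlePt 1 θ)‖ + ε) ^ s :=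
      Continuous.rpow_const (hcirc.norm.add continuous_const) fun _ => Or.inr hs.le
    calc ‖f w‖ ^ s ≤ (Real.exp m) ^ s := by gcongr
      _ = Real.exp (s * m) := by rw [← Real.exp_mul, mul_comm]
      _ ≤ _ := hjensen
      _ ≤ ∫ θ, Real.exp (2 * s * ε) * (P θ * (‖f (circlePt 1 θ)‖ + ε) ^ s) ∂circMeas := by
        refine integral_mono (integrable_circMeas_of_continuous (by fun_prop))
          (integrable_circMeas_of_continuous (by fun_prop)) fun θ => ?_
        have h3 := (hQ1 (circlePt 1 θ) (by simp [norm_circlePt_one])).2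
        have h4 : Real.exp (s * v θ) ≤ (‖f (circlePt 1 θ)‖ + ε) ^ s * Real.exp (2 * s * ε) := by
          calc Real.exp (s * v θ) = (Real.exp (v θ)) ^ s := by rw [← Real.exp_mul, mul_comm]
            _ ≤ ((‖f (circlePt 1 θ)‖ + ε) * Real.exp (2 * ε)) ^ s := by gcongr
            _ = _ := by
              rw [Real.mul_rpow (by positivity) (by positivity), ← Real.exp_mul]; ring_nf
        have := mul_le_mul_of_nonneg_left h4 (hP0 θ)
        simp only
        linarith
      _ = _ := integral_const_mul _ _
  have hlim : Tendsto (fun ε : ℝ => Real.exp (2 * s * ε) *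
      ∫ θ, P θ * (‖f (circlePt 1 θ)‖ + ε) ^ s ∂circMeas) (nhdsWithin 0 (Ioi 0))
      (nhds (1 * ∫ θ, P θ * ‖f (circlePt 1 θ)‖ ^ s ∂circMeas)) := by
    refine Tendsto.mul ?_ ?_
    · have : Continuous fun ε : ℝ => Real.exp (2 * s * ε) := by fun_prop
      simpa using (this.tendsto 0).mono_left nhdsWithin_le_nhds
    · refine tendsto_integral_filter_of_dominated_convergence
        (fun θ => P θ * (‖f (circlePt 1 θ)‖ + 1) ^ s) ?_ ?_ ?_ ?_
      · refine Eventually.of_forall fun ε => Continuous.aestronglyMeasurable ?_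
        exact hPc.mul (Continuous.rpow_const (hcirc.norm.add continuous_const)
          fun _ => Or.inr hs.le)
      · filter_upwards [Ioc_mem_nhdsGT (zero_lt_one' ℝ)] with ε hε
        refine Eventually.of_forall fun θ => ?_
        have h5 : 0 ≤ ‖f (circlePt 1 θ)‖ + ε := add_nonneg (norm_nonneg _) hε.1.le
        rw [Real.norm_of_nonneg (mul_nonneg (hP0 θ) (Real.rpow_nonneg h5 _))]
        refine mul_le_mul_of_nonneg_left ?_ (hP0 θ)
        exact Real.rpow_le_rpow h5 (by linarith [hε.2]) hs.le
      · exact integrable_circMeas_of_continuous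
          (hPc.mul (Continuous.rpow_const (hcirc.norm.add continuous_const)
          fun _ => Or.inr hs.le))
      · refine Eventually.of_forall fun θ => ?_
        have h6 : Continuous fun ε : ℝ => P θ * (‖f (circlePt 1 θ)‖ + ε) ^ s :=
          continuous_const.mul (Continuous.rpow_const (by fun_prop) fun _ => Or.inr hs.le)
        simpa using (h6.tendsto 0).mono_left nhdsWithin_le_nhds
  rw [one_mul] at hlim
  refine ge_of_tendsto hlim ?_
  filter_upwards [self_mem_nhdsWithin] with ε hε using main ε hε

/-- The Poisson kernel of the circle of radius `1` at the point `ρ e^{iθ}`, with values in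
`[0,∞]`. -/
def poissonE (ρ θ φ : ℝ) : ℝ≥0∞ :=
  ENNReal.ofReal (poissonKernel 0 (circlePt ρ θ) (circlePt 1 φ))

lemma norm_circlePt_lt_one {ρ : ℝ} (h0 : 0 ≤ ρ) (h1 : ρ < 1) (θ : ℝ) : ‖circlePt ρ θ‖ < 1 := by
  rwa [norm_circlePt, abs_of_nonneg h0]

lemma poissonKernel_circlePt_comm (ρ θ φ : ℝ) :
    poissonKernel 0 (circlePt ρ θ) (circlePt 1 φ) =
      poissonKernel 0 (circlePt ρ φ) (circlePt 1 θ) := by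
  have h : ∀ a b : ℝ, ‖circlePt 1 a - circlePt ρ b‖ ^ 2 =
      1 + ρ ^ 2 - 2 * ρ * Real.cos (a - b) := by
    intro a b
    rw [← Complex.normSq_eq_norm_sq, Complex.normSq_apply, Real.cos_sub]
    simp only [circlePt, Complex.sub_re, Complex.sub_im, Complex.mul_re, Complex.mul_im,
      Complex.exp_ofReal_mul_I_re, Complex.exp_ofReal_mul_I_im, Complex.ofReal_re,
      Complex.ofReal_im]
    linear_combination Real.sin_sq_add_cos_sq a + ρ ^ 2 * Real.sin_sq_add_cos_sq b
  rw [poissonKernel_zero_apply, poissonKernel_zero_apply, h, h]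
  simp only [norm_circlePt]
  rw [← Real.cos_neg (φ - θ), neg_sub]

lemma poissonE_comm (ρ θ φ : ℝ) : poissonE ρ θ φ = poissonE ρ φ θ := by
  rw [poissonE, poissonKernel_circlePt_comm, poissonE]

lemma measurable_poissonE (ρ : ℝ) : Measurable fun x : ℝ × ℝ => poissonE ρ x.1 x.2 := by
  unfold poissonE
  simp only [poissonKernel_zero_apply]
  refine ENNReal.measurable_ofReal.comp (Measurable.div ?_ ?_)
  · exact Continuous.measurable (by fun_prop)
  · exact Continuous.measurable (by fun_prop)

lemma lintegral_poissonE {ρ : ℝ} (h0 : 0 ≤ ρ) (h1 : ρ < 1) (θ : ℝ) :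
    ∫⁻ φ, poissonE ρ θ φ ∂circMeas = 1 := by
  have hw := norm_circlePt_lt_one h0 h1 θ
  unfold poissonE
  rw [← ofReal_integral_eq_lintegral_ofReal, integral_poissonKernel hw, ENNReal.ofReal_one]
  · exact integrable_circMeas_of_continuous (continuous_poissonKernel_circlePt hw)
  · exact Eventually.of_forall (poissonKernel_circlePt_nonneg hw)

lemma lintegral_poissonE' {ρ : ℝ} (h0 : 0 ≤ ρ) (h1 : ρ < 1) (φ : ℝ) :
    ∫⁻ θ, poissonE ρ θ φ ∂circMeas = 1 := by
  simp_rw [fun θ => poissonE_comm ρ θ φ]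
  exact lintegral_poissonE h0 h1 φ

lemma poissonE_le {ρ : ℝ} (h0 : 0 ≤ ρ) (h1 : ρ < 1) (θ φ : ℝ) :
    poissonE ρ θ φ ≤ ENNReal.ofReal (2 / (1 - ρ)) := by
  refine ENNReal.ofReal_le_ofReal ?_
  rw [poissonKernel_zero_apply, norm_circlePt_one, norm_circlePt, abs_of_nonneg h0]
  have h2 : 1 - ρ ≤ ‖circlePt 1 φ - circlePt ρ θ‖ := by
    have := norm_sub_norm_le (circlePt 1 φ) (circlePt ρ θ)
    rwa [norm_circlePt_one, norm_circlePt, abs_of_nonneg h0] at this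
  have h3 : 0 < 1 - ρ := by linarith
  calc (1 ^ 2 - ρ ^ 2) / ‖circlePt 1 φ - circlePt ρ θ‖ ^ 2 ≤ (1 ^ 2 - ρ ^ 2) / (1 - ρ) ^ 2 := by
        gcongr; nlinarith
    _ ≤ 2 / (1 - ρ) := by
        rw [div_le_div_iff₀ (by positivity) h3]
        nlinarith [sq_nonneg (1 - ρ), mul_pos h3 h3]

lemma ofReal_norm_rpow_le_lintegral {f : ℂ → ℂ} {s ρ : ℝ} (hs : 0 < s)
    (hf : DiffContOnCl ℂ f (Metric.ball 0 1)) (h0 : 0 ≤ ρ) (h1 : ρ < 1) (θ : ℝ) :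
    ENNReal.ofReal (‖f (circlePt ρ θ)‖ ^ s) ≤
      ∫⁻ φ, poissonE ρ θ φ * ENNReal.ofReal (‖f (circlePt 1 φ)‖ ^ s) ∂circMeas := by
  have hw := norm_circlePt_lt_one h0 h1 θ
  have hcont : ContinuousOn f (Metric.closedBall 0 1) := by
    simpa [closure_ball] using hf.continuousOn
  have hcirc : Continuous fun θ => f (circlePt 1 θ) :=
    hcont.comp_continuous (by fun_prop) fun θ => by simp [norm_circlePt_one]
  refine (ENNReal.ofReal_le_ofReal (norm_rpow_le_integral_poissonKernel hs hf hw)).trans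
    (le_of_eq ?_)
  rw [ofReal_integral_eq_lintegral_ofReal]
  · refine lintegral_congr fun φ => ?_
    rw [ENNReal.ofReal_mul (poissonKernel_circlePt_nonneg hw φ), poissonE]
  · exact integrable_circMeas_of_continuous ((continuous_poissonKernel_circlePt hw).mul
      (hcirc.norm.rpow_const fun _ => Or.inr hs.le))
  · exact Eventually.of_forall fun φ => mul_nonneg (poissonKernel_circlePt_nonneg hw φ)
      (by positivity)

lemma lintegral_lintegral_poissonE {ρ : ℝ} (h0 : 0 ≤ ρ) (h1 : ρ < 1) {u : ℝ → ℝ≥0∞}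
    (hu : Measurable u) :
    ∫⁻ θ, ∫⁻ φ, poissonE ρ θ φ * u φ ∂circMeas ∂circMeas = ∫⁻ φ, u φ ∂circMeas := by
  rw [lintegral_lintegral_swap]
  · refine lintegral_congr fun φ => ?_
    have hm : Measurable fun x => poissonE ρ x φ :=
      Measurable.comp (g := fun x : ℝ × ℝ => poissonE ρ x.1 x.2) (f := fun x => (x, φ))
        (measurable_poissonE ρ) (by fun_prop)
    rw [lintegral_mul_const _ hm, lintegral_poissonE' h0 h1, one_mul]
  · exact ((measurable_poissonE ρ).mul (hu.comp measurable_snd)).aemeasurable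

lemma diffContOnCl_dilate {f : ℂ → ℂ} (hf : DifferentiableOn ℂ f (Metric.ball 0 1)) {s : ℝ}
    (h0 : 0 ≤ s) (h1 : s < 1) : DiffContOnCl ℂ (dilateF f s) (Metric.ball 0 1) := by
  refine DifferentiableOn.diffContOnCl ?_
  rw [closure_ball _ one_ne_zero]
  refine hf.comp (by fun_prop) fun z hz => ?_
  have : ‖z‖ ≤ 1 := by simpa using hz
  rw [mem_ball_zero_iff, norm_mul, Complex.norm_real, Real.norm_of_nonneg h0]
  nlinarith [norm_nonneg z]

lemma continuous_circle_dilate {f : ℂ → ℂ} (hf : DifferentiableOn ℂ f (Metric.ball 0 1)) {s : ℝ}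
    (h0 : 0 ≤ s) (h1 : s < 1) : Continuous fun θ => f (circlePt s θ) :=
  hf.continuousOn.comp_continuous (by fun_prop) fun θ => by
    rw [mem_ball_zero_iff]; exact norm_circlePt_lt_one h0 h1 θ

lemma lintegral_circle_mono {f : ℂ → ℂ} (hf : DifferentiableOn ℂ f (Metric.ball 0 1)) {p r s : ℝ}
    (hp : 0 < p) (hr : 0 ≤ r) (hrs : r ≤ s) (hs : s < 1) :
    ∫⁻ θ, ENNReal.ofReal (‖f (circlePt r θ)‖ ^ p) ∂circMeas ≤
      ∫⁻ θ, ENNReal.ofReal (‖f (circlePt s θ)‖ ^ p) ∂circMeas := by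
  rcases hrs.eq_or_lt with rfl | hlt
  · exact le_rfl
  have hs0 : 0 < s := hr.trans_lt hlt
  have hρ0 : 0 ≤ r / s := by positivity
  have hρ1 : r / s < 1 := (div_lt_one hs0).2 hlt
  have hF := diffContOnCl_dilate hf hs0.le hs
  have h1 : ∀ θ, f (circlePt r θ) = dilateF f s (circlePt (r / s) θ) := fun θ => by
    rw [dilateF, ← circlePt_mul, mul_div_cancel₀ _ hs0.ne']
  have h2 : ∀ θ, f (circlePt s θ) = dilateF f s (circlePt 1 θ) := fun θ => by
    rw [dilateF, ← circlePt_mul, mul_one]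
  have hm : Measurable fun θ => ENNReal.ofReal (‖f (circlePt s θ)‖ ^ p) :=
    ENNReal.measurable_ofReal.comp ((continuous_circle_dilate hf hs0.le hs).norm.rpow_const
      fun _ => Or.inr hp.le).measurable
  rw [← lintegral_lintegral_poissonE hρ0 hρ1 hm]
  refine lintegral_mono fun θ => ?_
  simp only [h1, h2]
  exact ofReal_norm_rpow_le_lintegral hp hF hρ0 hρ1 θ

lemma MpE_mono {f : ℂ → ℂ} (hf : DifferentiableOn ℂ f (Metric.ball 0 1)) {p r s : ℝ}
    (hp : 0 < p) (hr : 0 ≤ r) (hrs : r ≤ s) (hs : s < 1) : MpE p r f ≤ MpE p s f := by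
  rw [MpE_eq, MpE_eq]
  exact ENNReal.rpow_le_rpow (lintegral_circle_mono hf hp hr hrs hs) (by positivity)

lemma norm_zero_le_MpE {f : ℂ → ℂ} (hf : DifferentiableOn ℂ f (Metric.ball 0 1)) {p s : ℝ}
    (hp : 0 < p) (h0 : 0 ≤ s) (hs : s < 1) : ENNReal.ofReal ‖f 0‖ ≤ MpE p s f := by
  refine le_trans (le_of_eq ?_) (MpE_mono hf hp le_rfl h0 hs)
  rw [MpE_eq]
  simp only [circlePt, Complex.ofReal_zero, zero_mul, lintegral_const, measure_univ, mul_one]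
  rw [ENNReal.ofReal_rpow_of_nonneg (by positivity) (by positivity),
    ← Real.rpow_mul (norm_nonneg _),
    mul_one_div_cancel hp.ne', Real.rpow_one]

/-- Any function monotone on `(0,1)` is measurable there. -/
lemma aemeasurable_of_monotoneOn_Ioo {u : ℝ → ℝ≥0∞} (hu : MonotoneOn u (Ioo 0 1)) {μ : Measure ℝ} :
    AEMeasurable u (μ.restrict (Ioo 0 1)) :=
  aemeasurable_restrict_of_monotoneOn measurableSet_Ioo hu

lemma lintegral_Ioi_ofReal_rpow {a c : ℝ} (ha : a < -1) (hc : 0 < c) :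
    ∫⁻ t in Ioi c, ENNReal.ofReal (t ^ a) = ENNReal.ofReal (-c ^ (a + 1) / (a + 1)) := by
  rw [← integral_Ioi_rpow_of_lt ha hc, ofReal_integral_eq_lintegral_ofReal]
  · exact integrableOn_Ioi_rpow_of_lt ha hc
  · filter_upwards [ae_restrict_mem measurableSet_Ioi] with t ht
    exact Real.rpow_nonneg (hc.trans ht).le _

lemma lintegral_Ioc_ofReal_rpow {a c : ℝ} (ha : -1 < a) (hc : 0 ≤ c) :
    ∫⁻ t in Ioc 0 c, ENNReal.ofReal (t ^ a) = ENNReal.ofReal (c ^ (a + 1) / (a + 1)) := by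
  have h := integral_rpow (a := 0) (b := c) (r := a) (Or.inl ha)
  rw [Real.zero_rpow (by linarith), sub_zero, intervalIntegral.integral_of_le hc] at h
  rw [← h, ofReal_integral_eq_lintegral_ofReal]
  · rw [← IntegrableOn, ← intervalIntegrable_iff_integrableOn_Ioc_of_le hc]
    exact intervalIntegral.intervalIntegrable_rpow' ha
  · filter_upwards [ae_restrict_mem measurableSet_Ioc] with t ht
    exact Real.rpow_nonneg ht.1.le _

lemma lintegral_large_part_le {x : ℝ} (hx : 0 ≤ x) :
    ∫⁻ t in Ioo (0:ℝ) 1, ENNReal.ofReal (t ^ (-(3/2) : ℝ)) *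
      (if 1 < x ^ 2 * t then ENNReal.ofReal x else 0) ≤ ENNReal.ofReal (2 * x ^ 2) := by
  rcases hx.eq_or_lt with rfl | hx0
  · simp
  have h1 : ∀ t : ℝ, ENNReal.ofReal (t ^ (-(3/2) : ℝ)) *
      (if 1 < x ^ 2 * t then ENNReal.ofReal x else 0) =
      (Ioi (x ^ 2)⁻¹).indicator
        (fun t => ENNReal.ofReal (t ^ (-(3/2) : ℝ)) * ENNReal.ofReal x) t := by
    intro t
    have : 1 < x ^ 2 * t ↔ t ∈ Ioi (x ^ 2)⁻¹ := by
      rw [mem_Ioi, inv_lt_iff_one_lt_mul₀ (by positivity), mul_comm]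
    by_cases h : 1 < x ^ 2 * t
    · rw [if_pos h, indicator_of_mem (this.1 h)]
    · rw [if_neg h, indicator_of_notMem (fun h' => h (this.2 h')), mul_zero]
  simp_rw [h1]
  refine (setLIntegral_le_lintegral _ _).trans ?_
  rw [lintegral_indicator measurableSet_Ioi, lintegral_mul_const' _ _ ENNReal.ofReal_ne_top,
    lintegral_Ioi_ofReal_rpow (by norm_num) (by positivity), ← ENNReal.ofReal_mul' hx]
  refine ENNReal.ofReal_le_ofReal (le_of_eq ?_)
  rw [← Real.rpow_natCast, ← Real.rpow_neg hx, ← Real.rpow_mul hx]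
  norm_num
  ring

lemma lintegral_small_part_le {x s : ℝ} (hx : 0 ≤ x) (hs : 2 < s) :
    ∫⁻ t in Ioo (0:ℝ) 1, ENNReal.ofReal (t ^ (s / 2 - 2)) *
      (if 1 < x ^ 2 * t then 0 else ENNReal.ofReal x) ^ s ≤
      ENNReal.ofReal (x ^ 2 / (s / 2 - 1)) := by
  have hs0 : 0 < s := by linarith
  rcases hx.eq_or_lt with rfl | hx0
  · simp [hs0]
  have h1 : ∀ t ∈ Ioo (0:ℝ) 1, ENNReal.ofReal (t ^ (s / 2 - 2)) *
      (if 1 < x ^ 2 * t then 0 else ENNReal.ofReal x) ^ s =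
      (Ioc 0 (x ^ 2)⁻¹).indicator
        (fun t => ENNReal.ofReal (t ^ (s / 2 - 2)) * ENNReal.ofReal (x ^ s)) t := by
    intro t ht
    have : 1 < x ^ 2 * t ↔ ¬ t ∈ Ioc 0 (x ^ 2)⁻¹ := by
      rw [mem_Ioc, not_and, not_le, inv_lt_iff_one_lt_mul₀ (by positivity), mul_comm]
      exact ⟨fun h _ => h, fun h => h ht.1⟩
    by_cases h : 1 < x ^ 2 * t
    · rw [if_pos h, indicator_of_notMem (this.1 h), ENNReal.zero_rpow_of_pos hs0, mul_zero]
    · rw [if_neg h, indicator_of_mem (not_not.1 fun h' => h (this.2 h')),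
        ENNReal.ofReal_rpow_of_nonneg hx hs0.le]
  rw [setLIntegral_congr_fun measurableSet_Ioo h1]
  refine (setLIntegral_le_lintegral _ _).trans ?_
  rw [lintegral_indicator measurableSet_Ioc, lintegral_mul_const' _ _ ENNReal.ofReal_ne_top,
    lintegral_Ioc_ofReal_rpow (by linarith) (by positivity), ← ENNReal.ofReal_mul' (by positivity)]
  refine ENNReal.ofReal_le_ofReal (le_of_eq ?_)
  have e : s / 2 - 2 + 1 = s / 2 - 1 := by ring
  rw [e, div_mul_eq_mul_div]
  congr 1
  rw [← Real.rpow_natCast, ← Real.rpow_neg hx, ← Real.rpow_mul hx, ← Real.rpow_add hx0]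
  congr 1
  push_cast
  ring

/-- Jensen's inequality for the Poisson kernel. -/
lemma poissonE_rpow_le {ρ s : ℝ} (h0 : 0 ≤ ρ) (h1 : ρ < 1) (hs : 1 < s) {u : ℝ → ℝ≥0∞}
    (hu : Measurable u) (θ : ℝ) :
    (∫⁻ φ, poissonE ρ θ φ * u φ ∂circMeas) ^ s ≤ ∫⁻ φ, poissonE ρ θ φ * u φ ^ s ∂circMeas := by
  have hm : Measurable fun φ => poissonE ρ θ φ :=
    Measurable.comp (g := fun x : ℝ × ℝ => poissonE ρ x.1 x.2) (f := fun x => (θ, x))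
      (measurable_poissonE ρ) (by fun_prop)
  have hs0 : 0 < s := by linarith
  have hc : s.HolderConjugate (s.conjExponent) := Real.HolderConjugate.conjExponent hs
  have hc0 := hc.symm.pos
  have key := ENNReal.lintegral_mul_le_Lp_mul_Lq circMeas hc
    (f := fun φ => poissonE ρ θ φ ^ (1 / s) * u φ)
    (g := fun φ => poissonE ρ θ φ ^ (1 / s.conjExponent))
    ((hm.pow_const _).mul hu).aemeasurable (hm.pow_const _).aemeasurable
  have e1 : ∀ φ, ((fun φ => poissonE ρ θ φ ^ (1 / s) * u φ) *
      fun φ => poissonE ρ θ φ ^ (1 / s.conjExponent)) φ = poissonE ρ θ φ * u φ := by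
    intro φ
    have : poissonE ρ θ φ ^ (1 / s) * poissonE ρ θ φ ^ (1 / s.conjExponent) = poissonE ρ θ φ := by
      rw [← ENNReal.rpow_add_of_nonneg _ _ (by positivity) (by positivity), one_div, one_div,
        hc.inv_add_inv_eq_one, ENNReal.rpow_one]
    calc _ = (poissonE ρ θ φ ^ (1 / s) * poissonE ρ θ φ ^ (1 / s.conjExponent)) * u φ := by
          simp only [Pi.mul_apply]; ring
      _ = _ := by rw [this]
  have e2 : ∀ φ, (poissonE ρ θ φ ^ (1 / s) * u φ) ^ s = poissonE ρ θ φ * u φ ^ s := by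
    intro φ
    rw [ENNReal.mul_rpow_of_nonneg _ _ hs0.le, ← ENNReal.rpow_mul, one_div_mul_cancel hs0.ne',
      ENNReal.rpow_one]
  have e3 : ∀ φ, (poissonE ρ θ φ ^ (1 / s.conjExponent)) ^ s.conjExponent = poissonE ρ θ φ := by
    intro φ
    rw [← ENNReal.rpow_mul, one_div_mul_cancel hc0.ne', ENNReal.rpow_one]
  rw [lintegral_congr e1] at key
  simp only [e2, e3, lintegral_poissonE h0 h1, ENNReal.one_rpow, mul_one] at key
  calc _ ≤ ((∫⁻ φ, poissonE ρ θ φ * u φ ^ s ∂circMeas) ^ (1 / s)) ^ s :=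
        ENNReal.rpow_le_rpow key hs0.le
    _ = _ := by rw [← ENNReal.rpow_mul, one_div_mul_cancel hs0.ne', ENNReal.rpow_one]

lemma measurable_poissonE_right (ρ θ : ℝ) : Measurable fun φ => poissonE ρ θ φ :=
  Measurable.comp (g := fun x : ℝ × ℝ => poissonE ρ x.1 x.2) (f := fun x => (θ, x))
    (measurable_poissonE ρ) (by fun_prop)

/-- Poisson extensions at a fixed radius, with the data cut at height `t ^ (-1/2)`. -/
lemma lintegral_poissonE_rpow_le_split {v : ℝ → ℝ} {s t : ℝ} (hv : Measurable v)
    (hv0 : ∀ θ, 0 ≤ v θ) (hs : 2 < s) (ht0 : 0 < t) (ht1 : t < 1)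
    (hv2 : ∫⁻ θ, ENNReal.ofReal (v θ ^ 2) ∂circMeas ≤ 1) :
    (∫⁻ θ, (∫⁻ φ, poissonE (1 - t) θ φ * ENNReal.ofReal (v φ) ∂circMeas) ^ s ∂circMeas) *
        ENNReal.ofReal (t ^ (s / 2 - 2)) ≤
      2 ^ (s - 1) * (ENNReal.ofReal (2 ^ (s - 1)) *
        (∫⁻ φ, ENNReal.ofReal (t ^ (-(3/2) : ℝ)) *
          (if 1 < v φ ^ 2 * t then ENNReal.ofReal (v φ) else 0) ∂circMeas) +
        ∫⁻ φ, ENNReal.ofReal (t ^ (s / 2 - 2)) *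
          (if 1 < v φ ^ 2 * t then 0 else ENNReal.ofReal (v φ)) ^ s ∂circMeas) := by
  have hs0 : 0 < s := by linarith
  have hρ0 : 0 ≤ 1 - t := by linarith
  have hρ1 : 1 - t < 1 := by linarith
  set u₁ : ℝ → ℝ≥0∞ := fun φ => if 1 < v φ ^ 2 * t then ENNReal.ofReal (v φ) else 0 with hu₁
  set u₂ : ℝ → ℝ≥0∞ := fun φ => if 1 < v φ ^ 2 * t then 0 else ENNReal.ofReal (v φ) with hu₂
  have hset : MeasurableSet {φ | 1 < v φ ^ 2 * t} :=
    measurableSet_lt measurable_const ((hv.pow_const 2).mul_const t)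
  have hm₁ : Measurable u₁ := Measurable.ite hset (by fun_prop) measurable_const
  have hm₂ : Measurable u₂ := Measurable.ite hset measurable_const (by fun_prop)
  have hsum : ∀ φ, ENNReal.ofReal (v φ) = u₁ φ + u₂ φ := by
    intro φ
    simp only [hu₁, hu₂]
    split_ifs <;> simp
  set K₁ : ℝ → ℝ≥0∞ := fun θ => ∫⁻ φ, poissonE (1 - t) θ φ * u₁ φ ∂circMeas with hK₁
  set K₂ : ℝ → ℝ≥0∞ := fun θ => ∫⁻ φ, poissonE (1 - t) θ φ * u₂ φ ∂circMeas with hK₂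
  have hmK₁ : Measurable K₁ :=
    Measurable.lintegral_prod_right' (f := fun x : ℝ × ℝ => poissonE (1 - t) x.1 x.2 * u₁ x.2)
      ((measurable_poissonE _).mul (hm₁.comp measurable_snd))
  have hI₁ : ∫⁻ φ, u₁ φ ∂circMeas ≤ ENNReal.ofReal (t ^ (1/2 : ℝ)) := by
    calc ∫⁻ φ, u₁ φ ∂circMeas ≤
          ∫⁻ φ, ENNReal.ofReal (t ^ (1/2 : ℝ)) * ENNReal.ofReal (v φ ^ 2) ∂circMeas := by
          refine lintegral_mono fun φ => ?_
          simp only [hu₁]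
          split_ifs with h
          · rw [← ENNReal.ofReal_mul (by positivity)]
            refine ENNReal.ofReal_le_ofReal ?_
            have h1 : 1 ≤ v φ * t ^ (1/2 : ℝ) := by
              rw [← Real.sqrt_eq_rpow]
              have : 1 ≤ Real.sqrt (v φ ^ 2 * t) := by
                rw [Real.one_le_sqrt]; exact h.le
              rwa [Real.sqrt_mul (by positivity), Real.sqrt_sq (hv0 φ)] at this
            nlinarith [hv0 φ]
          · exact zero_le
      _ ≤ _ := by
          rw [lintegral_const_mul' _ _ ENNReal.ofReal_ne_top]
          exact mul_le_of_le_one_right' hv2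
  have hKb : ∀ θ, K₁ θ ≤ ENNReal.ofReal (2 * t ^ (-(1/2) : ℝ)) := by
    intro θ
    calc K₁ θ ≤ ∫⁻ φ, ENNReal.ofReal (2 / t) * u₁ φ ∂circMeas := by
          refine lintegral_mono fun φ => ?_
          have := poissonE_le hρ0 hρ1 θ φ
          rw [sub_sub_cancel] at this
          gcongr
      _ = ENNReal.ofReal (2 / t) * ∫⁻ φ, u₁ φ ∂circMeas :=
          lintegral_const_mul' _ _ ENNReal.ofReal_ne_top
      _ ≤ ENNReal.ofReal (2 / t) * ENNReal.ofReal (t ^ (1/2 : ℝ)) := by gcongr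
      _ = _ := by
          rw [← ENNReal.ofReal_mul (by positivity)]
          congr 1
          rw [div_mul_eq_mul_div, mul_div_assoc]
          congr 1
          rw [← Real.rpow_sub_one ht0.ne']
          norm_num
  have hpart₁ : (∫⁻ θ, K₁ θ ^ s ∂circMeas) * ENNReal.ofReal (t ^ (s / 2 - 2)) ≤
      ENNReal.ofReal (2 ^ (s - 1)) *
        ∫⁻ φ, ENNReal.ofReal (t ^ (-(3/2) : ℝ)) * u₁ φ ∂circMeas := by
    have h1 : ∫⁻ θ, K₁ θ ^ s ∂circMeas ≤
        ENNReal.ofReal ((2 * t ^ (-(1/2) : ℝ)) ^ (s - 1)) * ∫⁻ φ, u₁ φ ∂circMeas := by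
      rw [← lintegral_lintegral_poissonE hρ0 hρ1 hm₁,
        ← lintegral_const_mul' _ _ ENNReal.ofReal_ne_top]
      refine lintegral_mono fun θ => ?_
      have : K₁ θ ^ s = K₁ θ ^ (s - 1) * K₁ θ := by
        conv_lhs => rw [show s = (s - 1) + 1 by ring,
          ENNReal.rpow_add_of_nonneg _ _ (by linarith) zero_le_one, ENNReal.rpow_one]
      rw [this, ← ENNReal.ofReal_rpow_of_nonneg (by positivity) (by linarith)]
      gcongr
      · linarith
      · exact hKb θ
    calc _ ≤ ENNReal.ofReal ((2 * t ^ (-(1/2) : ℝ)) ^ (s - 1)) * (∫⁻ φ, u₁ φ ∂circMeas) *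
          ENNReal.ofReal (t ^ (s / 2 - 2)) := by gcongr
      _ = ENNReal.ofReal ((2 * t ^ (-(1/2) : ℝ)) ^ (s - 1) * t ^ (s / 2 - 2)) *
          ∫⁻ φ, u₁ φ ∂circMeas := by
          rw [ENNReal.ofReal_mul (by positivity)]; ring
      _ = ENNReal.ofReal (2 ^ (s - 1) * t ^ (-(3/2) : ℝ)) * ∫⁻ φ, u₁ φ ∂circMeas := by
          congr 2
          rw [Real.mul_rpow (by positivity) (by positivity), ← Real.rpow_mul ht0.le, mul_assoc,
            ← Real.rpow_add ht0]
          congr 2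
          ring
      _ = _ := by
          rw [ENNReal.ofReal_mul (by positivity), lintegral_const_mul' _ _ ENNReal.ofReal_ne_top,
            mul_assoc]
  have hpart₂ : (∫⁻ θ, K₂ θ ^ s ∂circMeas) * ENNReal.ofReal (t ^ (s / 2 - 2)) ≤
      ∫⁻ φ, ENNReal.ofReal (t ^ (s / 2 - 2)) * u₂ φ ^ s ∂circMeas := by
    rw [lintegral_const_mul' _ _ ENNReal.ofReal_ne_top, mul_comm,
      ← lintegral_lintegral_poissonE hρ0 hρ1 (hm₂.pow_const s)]
    gcongr with θ
    exact poissonE_rpow_le hρ0 hρ1 (by linarith) hm₂ θ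
  have hK : ∀ θ, (∫⁻ φ, poissonE (1 - t) θ φ * ENNReal.ofReal (v φ) ∂circMeas) ^ s ≤
      2 ^ (s - 1) * (K₁ θ ^ s + K₂ θ ^ s) := by
    intro θ
    have : ∫⁻ φ, poissonE (1 - t) θ φ * ENNReal.ofReal (v φ) ∂circMeas = K₁ θ + K₂ θ := by
      simp only [hsum, mul_add]
      rw [lintegral_add_left]
      exact (measurable_poissonE_right _ θ).mul hm₁
    rw [this]
    exact ENNReal.rpow_add_le_mul_rpow_add_rpow _ _ (by linarith)
  calc _ ≤ (∫⁻ θ, 2 ^ (s - 1) * (K₁ θ ^ s + K₂ θ ^ s) ∂circMeas) *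
        ENNReal.ofReal (t ^ (s / 2 - 2)) := by
        gcongr with θ
        exact hK θ
    _ = 2 ^ (s - 1) * ((∫⁻ θ, K₁ θ ^ s ∂circMeas) * ENNReal.ofReal (t ^ (s / 2 - 2)) +
        (∫⁻ θ, K₂ θ ^ s ∂circMeas) * ENNReal.ofReal (t ^ (s / 2 - 2))) := by
        rw [lintegral_const_mul' _ _ (ENNReal.rpow_ne_top_of_nonneg (by linarith) (by simp)),
          lintegral_add_left (hmK₁.pow_const s)]
        ring
    _ ≤ _ := by gcongr

/-- The Hardy–Littlewood inequality for Poisson extensions, normalized. -/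
lemma lintegral_lintegral_poissonE_rpow_le {v : ℝ → ℝ} {s : ℝ} (hv : Measurable v)
    (hv0 : ∀ θ, 0 ≤ v θ) (hs : 2 < s) (hv2 : ∫⁻ θ, ENNReal.ofReal (v θ ^ 2) ∂circMeas ≤ 1) :
    ∫⁻ t in Ioo (0:ℝ) 1,
      (∫⁻ θ, (∫⁻ φ, poissonE (1 - t) θ φ * ENNReal.ofReal (v φ) ∂circMeas) ^ s ∂circMeas) *
        ENNReal.ofReal (t ^ (s / 2 - 2)) ≤
      2 ^ (s - 1) * (ENNReal.ofReal (2 ^ (s - 1)) * ENNReal.ofReal 2 +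
        ENNReal.ofReal (s / 2 - 1)⁻¹) := by
  have hs0 : 0 < s := by linarith
  have hset : MeasurableSet {x : ℝ × ℝ | 1 < v x.2 ^ 2 * x.1} :=
    measurableSet_lt measurable_const (((hv.comp measurable_snd).pow_const 2).mul measurable_fst)
  have hv' : Measurable fun x : ℝ × ℝ => ENNReal.ofReal (v x.2) :=
    ENNReal.measurable_ofReal.comp (hv.comp measurable_snd)
  have hm₁ : Measurable fun x : ℝ × ℝ => ENNReal.ofReal (x.1 ^ (-(3/2) : ℝ)) *
      (if 1 < v x.2 ^ 2 * x.1 then ENNReal.ofReal (v x.2) else 0) :=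
    (ENNReal.measurable_ofReal.comp (measurable_fst.pow_const _)).mul
      (Measurable.ite hset hv' measurable_const)
  have hm₂ : Measurable fun x : ℝ × ℝ => ENNReal.ofReal (x.1 ^ (s / 2 - 2)) *
      (if 1 < v x.2 ^ 2 * x.1 then 0 else ENNReal.ofReal (v x.2)) ^ s :=
    (ENNReal.measurable_ofReal.comp (measurable_fst.pow_const _)).mul
      ((Measurable.ite hset measurable_const hv').pow_const s)
  refine (setLIntegral_mono' measurableSet_Ioo fun t ht =>
    lintegral_poissonE_rpow_le_split hv hv0 hs ht.1 ht.2 hv2).trans ?_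
  rw [lintegral_const_mul' _ _ (ENNReal.rpow_ne_top_of_nonneg (by linarith) (by simp)),
    lintegral_add_left, lintegral_const_mul' _ _ ENNReal.ofReal_ne_top]
  · gcongr
    · rw [lintegral_lintegral_swap hm₁.aemeasurable]
      calc _ ≤ ∫⁻ φ, ENNReal.ofReal 2 * ENNReal.ofReal (v φ ^ 2) ∂circMeas := by
            refine lintegral_mono fun φ => ?_
            rw [← ENNReal.ofReal_mul zero_le_two]
            exact lintegral_large_part_le (hv0 φ)
        _ ≤ _ := by
            rw [lintegral_const_mul' _ _ ENNReal.ofReal_ne_top]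
            exact mul_le_of_le_one_right' hv2
    · rw [lintegral_lintegral_swap hm₂.aemeasurable]
      calc _ ≤ ∫⁻ φ, ENNReal.ofReal (s / 2 - 1)⁻¹ * ENNReal.ofReal (v φ ^ 2) ∂circMeas := by
            refine lintegral_mono fun φ => ?_
            rw [← ENNReal.ofReal_mul (inv_nonneg.2 (by linarith)), mul_comm, ← div_eq_mul_inv]
            exact lintegral_small_part_le (hv0 φ) hs
        _ ≤ _ := by
            rw [lintegral_const_mul' _ _ ENNReal.ofReal_ne_top]
            exact mul_le_of_le_one_right' hv2
  · exact (Measurable.lintegral_prod_right' hm₁).const_mul _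

lemma lintegral_Ioo_comp_one_sub (h : ℝ → ℝ≥0∞) :
    ∫⁻ t in Ioo (0:ℝ) 1, h (1 - t) = ∫⁻ t in Ioo (0:ℝ) 1, h t := by
  have hmp := (volume : Measure ℝ).measurePreserving_sub_left 1
  have := hmp.setLIntegral_comp_preimage_emb (MeasurableEquiv.subLeft (1:ℝ)).measurableEmbedding h
    (Ioo (0:ℝ) 1)
  rw [← this]
  congr 2
  ext t
  simp

lemma lintegral_hardyLittlewood_of_le_one {p : ℝ} (hp0 : 0 < p) (hp1 : p < 1) {F : ℂ → ℂ}
    (hF : DiffContOnCl ℂ F (Metric.ball 0 1))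
    (hF1 : ∫⁻ θ, ENNReal.ofReal (‖F (circlePt 1 θ)‖ ^ p) ∂circMeas ≤ 1) :
    ∫⁻ ρ in Ioo (0:ℝ) 1, (∫⁻ θ, ENNReal.ofReal ‖F (circlePt ρ θ)‖ ∂circMeas) *
        ENNReal.ofReal ((1 - ρ) ^ (1 / p - 2)) ≤
      2 ^ (2 / p - 1) * (ENNReal.ofReal (2 ^ (2 / p - 1)) * ENNReal.ofReal 2 +
        ENNReal.ofReal (2 / p / 2 - 1)⁻¹) := by
  have hcont : ContinuousOn F (Metric.closedBall 0 1) := by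
    simpa [closure_ball] using hF.continuousOn
  have hcirc : Continuous fun θ => F (circlePt 1 θ) :=
    hcont.comp_continuous (by fun_prop) fun θ => by simp [norm_circlePt_one]
  have hs : 2 < 2 / p := by rw [lt_div_iff₀ hp0]; linarith
  have hs' : 0 < 2 / p := by positivity
  have hv : Measurable fun θ => ‖F (circlePt 1 θ)‖ ^ (p / 2) :=
    (hcirc.norm.rpow_const fun _ => Or.inr (by positivity)).measurable
  have key := lintegral_lintegral_poissonE_rpow_le hv (fun θ => by positivity) hs (by
    refine le_trans (le_of_eq (lintegral_congr fun θ => ?_)) hF1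
    rw [← Real.rpow_natCast, ← Real.rpow_mul (norm_nonneg _)]
    congr 2
    push_cast
    ring)
  refine le_trans ?_ key
  rw [← lintegral_Ioo_comp_one_sub]
  refine setLIntegral_mono' measurableSet_Ioo fun t ht => ?_
  have e : (1 - (1 - t)) ^ (1 / p - 2) = t ^ (2 / p / 2 - 2) := by
    rw [sub_sub_cancel, div_right_comm]; norm_num
  rw [e]
  gcongr with θ
  have h := ofReal_norm_rpow_le_lintegral (s := p / 2) (by positivity) hF
    (ρ := 1 - t) (by linarith [ht.2]) (by linarith [ht.1]) θ
  refine le_trans (le_of_eq ?_) (ENNReal.rpow_le_rpow h hs'.le)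
  rw [ENNReal.ofReal_rpow_of_nonneg (by positivity) hs'.le, ← Real.rpow_mul (norm_nonneg _)]
  congr 1
  rw [show p / 2 * (2 / p) = 1 by field_simp, Real.rpow_one]

lemma lintegral_ofReal_ne_top_of_continuous {u : ℝ → ℝ} (hu : Continuous u) :
    ∫⁻ θ, ENNReal.ofReal (u θ) ∂circMeas ≠ ⊤ :=
  (integrable_circMeas_of_continuous hu).lintegral_lt_top.ne

/-- The Hardy–Littlewood inequality. -/
lemma exists_hardyLittlewood {p : ℝ} (hp0 : 0 < p) (hp1 : p < 1) :
    ∃ C : ℝ, 0 < C ∧ ∀ F : ℂ → ℂ, DiffContOnCl ℂ F (Metric.ball 0 1) →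
      ∫⁻ ρ in Ioo (0:ℝ) 1, (∫⁻ θ, ENNReal.ofReal ‖F (circlePt ρ θ)‖ ∂circMeas) *
        ENNReal.ofReal ((1 - ρ) ^ (1 / p - 2)) ≤ ENNReal.ofReal C * MpE p 1 F := by
  set K : ℝ≥0∞ := 2 ^ (2 / p - 1) * (ENNReal.ofReal (2 ^ (2 / p - 1)) * ENNReal.ofReal 2 +
        ENNReal.ofReal (2 / p / 2 - 1)⁻¹) with hK
  have hKt : K ≠ ⊤ := by
    have : 0 ≤ 2 / p - 1 := by
      rw [sub_nonneg, le_div_iff₀ hp0]; linarith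
    exact ENNReal.mul_ne_top (ENNReal.rpow_ne_top_of_nonneg this (by simp))
      (ENNReal.add_ne_top.2 ⟨ENNReal.mul_ne_top ENNReal.ofReal_ne_top ENNReal.ofReal_ne_top,
        ENNReal.ofReal_ne_top⟩)
  refine ⟨K.toReal + 1, by positivity, fun F hF => ?_⟩
  have hcont : ContinuousOn F (Metric.closedBall 0 1) := by
    simpa [closure_ball] using hF.continuousOn
  have hcirc : Continuous fun θ => F (circlePt 1 θ) :=
    hcont.comp_continuous (by fun_prop) fun θ => by simp [norm_circlePt_one]
  set I : ℝ≥0∞ := ∫⁻ ρ in Ioo (0:ℝ) 1, (∫⁻ θ, ENNReal.ofReal ‖F (circlePt ρ θ)‖ ∂circMeas) *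
        ENNReal.ofReal ((1 - ρ) ^ (1 / p - 2)) with hI
  have hNt : MpE p 1 F ≠ ⊤ := by
    rw [MpE_eq]
    exact ENNReal.rpow_ne_top_of_nonneg (by positivity) (lintegral_ofReal_ne_top_of_continuous
      (hcirc.norm.rpow_const fun _ => Or.inr hp0.le))
  have main : ∀ c : ℝ, (MpE p 1 F).toReal < c → I ≤ K * ENNReal.ofReal c := by
    intro c hc
    have hc0 : 0 < c := ENNReal.toReal_nonneg.trans_lt hc
    have hNc : MpE p 1 F ≤ ENNReal.ofReal c :=
      (ENNReal.le_ofReal_iff_toReal_le hNt hc0.le).2 hc.le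
    have hG : DiffContOnCl ℂ (fun z => (c⁻¹ : ℝ) • F z) (Metric.ball 0 1) := hF.const_smul (c⁻¹ : ℝ)
    have hG1 : ∫⁻ θ, ENNReal.ofReal (‖(c⁻¹ : ℝ) • F (circlePt 1 θ)‖ ^ p) ∂circMeas ≤ 1 := by
      have e : ∀ θ, ENNReal.ofReal (‖(c⁻¹ : ℝ) • F (circlePt 1 θ)‖ ^ p) =
          ENNReal.ofReal ((c ^ p)⁻¹) * ENNReal.ofReal (‖F (circlePt 1 θ)‖ ^ p) := by
        intro θ
        rw [norm_smul, Real.norm_of_nonneg (by positivity), Real.mul_rpow (by positivity)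
          (norm_nonneg _), ENNReal.ofReal_mul (by positivity), Real.inv_rpow hc0.le]
      simp_rw [e]
      rw [lintegral_const_mul' _ _ ENNReal.ofReal_ne_top]
      have h1 : ∫⁻ θ, ENNReal.ofReal (‖F (circlePt 1 θ)‖ ^ p) ∂circMeas ≤
          ENNReal.ofReal (c ^ p) := by
        rw [← ENNReal.ofReal_rpow_of_nonneg hc0.le hp0.le]
        calc _ = (MpE p 1 F) ^ p := by
              rw [MpE_eq, ← ENNReal.rpow_mul, one_div_mul_cancel hp0.ne', ENNReal.rpow_one]
          _ ≤ _ := ENNReal.rpow_le_rpow hNc hp0.le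
      calc _ ≤ ENNReal.ofReal ((c ^ p)⁻¹) * ENNReal.ofReal (c ^ p) := by gcongr
        _ = 1 := by
          rw [← ENNReal.ofReal_mul (by positivity), inv_mul_cancel₀ (by positivity),
            ENNReal.ofReal_one]
    have h := lintegral_hardyLittlewood_of_le_one hp0 hp1 hG hG1
    have e : ∀ ρ : ℝ, (∫⁻ θ, ENNReal.ofReal ‖(c⁻¹ : ℝ) • F (circlePt ρ θ)‖ ∂circMeas) *
        ENNReal.ofReal ((1 - ρ) ^ (1 / p - 2)) = ENNReal.ofReal c⁻¹ *
          ((∫⁻ θ, ENNReal.ofReal ‖F (circlePt ρ θ)‖ ∂circMeas) *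
            ENNReal.ofReal ((1 - ρ) ^ (1 / p - 2))) := by
      intro ρ
      simp_rw [norm_smul, Real.norm_of_nonneg (inv_nonneg.2 hc0.le),
        ENNReal.ofReal_mul (inv_nonneg.2 hc0.le)]
      rw [lintegral_const_mul' _ _ ENNReal.ofReal_ne_top, mul_assoc]
    simp_rw [e] at h
    rw [lintegral_const_mul' _ _ ENNReal.ofReal_ne_top] at h
    calc I = ENNReal.ofReal c * (ENNReal.ofReal c⁻¹ * I) := by
          rw [← mul_assoc, ← ENNReal.ofReal_mul hc0.le, mul_inv_cancel₀ hc0.ne',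
            ENNReal.ofReal_one, one_mul]
      _ ≤ ENNReal.ofReal c * K := by gcongr
      _ = _ := mul_comm _ _
  have hlim : Tendsto (fun c : ℝ => K * ENNReal.ofReal c)
      (nhdsWithin (MpE p 1 F).toReal (Ioi (MpE p 1 F).toReal))
      (nhds (K * ENNReal.ofReal (MpE p 1 F).toReal)) :=
    ENNReal.Tendsto.const_mul ((ENNReal.continuous_ofReal.tendsto _).mono_left nhdsWithin_le_nhds)
      (Or.inr hKt)
  have h2 : I ≤ K * ENNReal.ofReal (MpE p 1 F).toReal :=
    ge_of_tendsto hlim (by filter_upwards [self_mem_nhdsWithin] with c hc using main c hc)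
  rw [ENNReal.ofReal_toReal hNt] at h2
  refine h2.trans ?_
  gcongr
  calc K = ENNReal.ofReal K.toReal := (ENNReal.ofReal_toReal hKt).symm
    _ ≤ _ := ENNReal.ofReal_le_ofReal (by linarith)

lemma hasSum_taylorCoeff {f : ℂ → ℂ} (hf : DifferentiableOn ℂ f (Metric.ball 0 1)) {z : ℂ}
    (hz : ‖z‖ < 1) : HasSum (fun n => taylorCoeff f n * z ^ n) (f z) := by
  have := Complex.hasSum_taylorSeries_on_ball (f := f) (c := 0) (r := 1)
    (by simpa using hf) (z := z) (by simpa using hz)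
  convert! this using 2 with n
  simp only [taylorCoeff, sub_zero, smul_eq_mul]
  ring

lemma summable_norm_taylorCoeff {f : ℂ → ℂ} (hf : DifferentiableOn ℂ f (Metric.ball 0 1)) {ρ : ℝ}
    (h0 : 0 ≤ ρ) (h1 : ρ < 1) : Summable fun n => ‖taylorCoeff f n‖ * ρ ^ n := by
  have h : ‖(ρ : ℂ)‖ < 1 := by rwa [Complex.norm_real, Real.norm_of_nonneg h0]
  have := (hasSum_taylorCoeff hf h).summable.norm
  simpa [abs_of_nonneg h0] using this

lemma taylorCoeff_deriv (f : ℂ → ℂ) (n : ℕ) :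
    taylorCoeff (deriv f) n = (n + 1) * taylorCoeff f (n + 1) := by
  rw [taylorCoeff, taylorCoeff, iteratedDeriv_succ', Nat.factorial_succ]
  have : (n.factorial : ℂ) ≠ 0 := by exact_mod_cast n.factorial_ne_zero
  have h2 : ((n : ℂ) + 1) ≠ 0 := by exact_mod_cast n.succ_ne_zero
  push_cast
  field_simp

lemma differentiableOn_deriv_ball {f : ℂ → ℂ} (hf : DifferentiableOn ℂ f (Metric.ball 0 1)) :
    DifferentiableOn ℂ (deriv f) (Metric.ball 0 1) :=
  hf.deriv Metric.isOpen_ball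

lemma taylorCoeff_zero (f : ℂ → ℂ) : taylorCoeff f 0 = f 0 := by
  simp [taylorCoeff]

/-- A power series with radius of convergence at least one. -/
lemma hasFPowerSeriesOnBall_of_summable {a : ℕ → ℂ} {f : ℂ → ℂ}
    (ha : ∀ ρ : ℝ, 0 ≤ ρ → ρ < 1 → Summable fun n => ‖a n‖ * ρ ^ n)
    (hf : ∀ z : ℂ, ‖z‖ < 1 → HasSum (fun n => a n * z ^ n) (f z)) :
    HasFPowerSeriesOnBall f (FormalMultilinearSeries.ofScalars ℂ a) 0 1 := by
  refine ⟨?_, one_pos, fun {y} hy => ?_⟩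
  · refine ENNReal.le_of_forall_nnreal_lt fun r hr => ?_
    have hr1 : (r : ℝ) < 1 := by exact_mod_cast hr
    refine FormalMultilinearSeries.le_radius_of_summable_norm _ ?_
    refine Summable.of_nonneg_of_le (fun n => by positivity) (fun n => ?_) (ha r r.2 hr1)
    gcongr
    exact (FormalMultilinearSeries.ofScalars_norm ℂ a n).le
  · have hy1 : ‖y‖ < 1 := by simpa [← ofReal_norm] using hy
    have := hf y hy1
    simpa [FormalMultilinearSeries.ofScalars_apply_eq, mul_comm] using this

lemma differentiableOn_of_hasSum {a : ℕ → ℂ} {f : ℂ → ℂ}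
    (ha : ∀ ρ : ℝ, 0 ≤ ρ → ρ < 1 → Summable fun n => ‖a n‖ * ρ ^ n)
    (hf : ∀ z : ℂ, ‖z‖ < 1 → HasSum (fun n => a n * z ^ n) (f z)) :
    DifferentiableOn ℂ f (Metric.ball 0 1) := by
  have := (hasFPowerSeriesOnBall_of_summable ha hf).differentiableOn
  rwa [← ENNReal.ofReal_one, Metric.eball_ofReal] at this

lemma taylorCoeff_of_hasSum {a : ℕ → ℂ} {f : ℂ → ℂ}
    (ha : ∀ ρ : ℝ, 0 ≤ ρ → ρ < 1 → Summable fun n => ‖a n‖ * ρ ^ n)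
    (hf : ∀ z : ℂ, ‖z‖ < 1 → HasSum (fun n => a n * z ^ n) (f z)) (n : ℕ) :
    taylorCoeff f n = a n := by
  have h1 := (hasFPowerSeriesOnBall_of_summable ha hf).hasFPowerSeriesAt
  have h2 := (h1.analyticAt).hasFPowerSeriesAt
  have := congrArg (fun p => FormalMultilinearSeries.coeff p n) (h2.eq_formalMultilinearSeries h1)
  simpa [taylorCoeff, FormalMultilinearSeries.coeff_ofScalars] using this

lemma deriv_dilateF (f : ℂ → ℂ) (r : ℝ) (z : ℂ) :
    deriv (dilateF f r) z = r * deriv f (r * z) := by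
  unfold dilateF
  rw [deriv_comp_mul_left, smul_eq_mul]

lemma integral_circlePt_pow_mul_conj (n m : ℕ) :
    ∫ θ, circlePt 1 θ ^ n * (starRingEnd ℂ) (circlePt 1 θ ^ m) ∂circMeas =
      if n = m then 1 else 0 := by
  have hz : ∀ θ, circlePt 1 θ * (starRingEnd ℂ) (circlePt 1 θ) = 1 := fun θ => by
    rw [Complex.mul_conj, Complex.normSq_eq_norm_sq, norm_circlePt_one]; simp
  have hpow : ∀ k : ℕ, k ≠ 0 → ∫ θ, circlePt 1 θ ^ k ∂circMeas = 0 := by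
    intro k hk
    have := integral_poissonKernel_smul (f := fun z => z ^ k) (w := 0)
      (Differentiable.diffContOnCl (by fun_prop)) (by simp)
    simp only [poissonKernel_zero_apply, norm_circlePt_one] at this
    simpa [hk, norm_circlePt_one] using this
  have key : ∀ k m : ℕ, ∀ θ, circlePt 1 θ ^ (m + k) * (starRingEnd ℂ) (circlePt 1 θ ^ m) =
      circlePt 1 θ ^ k := by
    intro k m θ
    rw [map_pow, pow_add, mul_right_comm, ← mul_pow, hz, one_pow, one_mul]
  rcases lt_trichotomy n m with h | rfl | h
  · obtain ⟨k, rfl⟩ := Nat.exists_eq_add_of_lt h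
    rw [if_neg (by omega)]
    have : ∀ θ, circlePt 1 θ ^ n * (starRingEnd ℂ) (circlePt 1 θ ^ (n + k + 1)) =
        (starRingEnd ℂ) (circlePt 1 θ ^ (k + 1)) := by
      intro θ
      rw [← key (k + 1) n θ, map_mul, Complex.conj_conj, mul_comm, add_assoc]
    simp_rw [this]
    rw [integral_conj, hpow _ (by omega), map_zero]
  · simp only [if_true]
    simp_rw [map_pow, ← mul_pow, hz]
    simp
  · obtain ⟨k, rfl⟩ := Nat.exists_eq_add_of_lt h
    rw [if_neg (by omega)]
    have : ∀ θ, circlePt 1 θ ^ (m + k + 1) * (starRingEnd ℂ) (circlePt 1 θ ^ m) =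
        circlePt 1 θ ^ (k + 1) := fun θ => by rw [← key (k + 1) m θ, add_assoc]
    simp_rw [this]
    exact hpow _ (by omega)

/-- Termwise integration of an absolutely convergent Fourier series against a continuous
function. -/
lemma hasSum_integral_circle_mul {a : ℕ → ℂ} (ha : Summable fun n => ‖a n‖) {h : ℝ → ℂ}
    (hh : Continuous h) (hb : ∃ B, ∀ θ, ‖h θ‖ ≤ B) :
    HasSum (fun n => a n * ∫ θ, circlePt 1 θ ^ n * h θ ∂circMeas)
      (∫ θ, (∑' n, a n * circlePt 1 θ ^ n) * h θ ∂circMeas) := by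
  obtain ⟨B, hB⟩ := hb
  have hc : ∀ n, Continuous fun θ => a n * (circlePt 1 θ ^ n * h θ) := fun n => by fun_prop
  have h1 := hasSum_integral_of_summable_integral_norm
    (F := fun n θ => a n * (circlePt 1 θ ^ n * h θ)) (μ := circMeas)
    (fun n => integrable_circMeas_of_continuous (hc n)) (by
      refine Summable.of_nonneg_of_le (fun n => integral_nonneg fun θ => norm_nonneg _)
        (fun n => ?_) (ha.mul_right B)
      calc ∫ θ, ‖a n * (circlePt 1 θ ^ n * h θ)‖ ∂circMeas ≤ ∫ θ, ‖a n‖ * B ∂circMeas := by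
            refine integral_mono (integrable_circMeas_of_continuous (hc n).norm)
              (integrable_const _) fun θ => ?_
            simp only [norm_mul, norm_pow, norm_circlePt_one, one_pow, one_mul]
            exact mul_le_mul_of_nonneg_left (hB θ) (norm_nonneg _)
        _ = _ := by simp)
  convert! h1 using 1
  · funext n
    rw [integral_const_mul]
  · refine integral_congr_ae (Eventually.of_forall fun θ => ?_)
    simp only
    rw [← tsum_mul_right]
    simp only [mul_assoc]

lemma continuous_tsum_circle {b : ℕ → ℂ} (hb : Summable fun n => ‖b n‖) :
    Continuous fun θ => ∑' n, b n * circlePt 1 θ ^ n := by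
  refine continuous_tsum (fun n => by fun_prop) hb fun n θ => ?_
  rw [norm_mul, norm_pow, norm_circlePt_one, one_pow, mul_one]

lemma norm_tsum_circle_le {b : ℕ → ℂ} (hb : Summable fun n => ‖b n‖) (θ : ℝ) :
    ‖∑' n, b n * circlePt 1 θ ^ n‖ ≤ ∑' n, ‖b n‖ := by
  have h : ∀ n, ‖b n * circlePt 1 θ ^ n‖ = ‖b n‖ := fun n => by
    rw [norm_mul, norm_pow, norm_circlePt_one, one_pow, mul_one]
  refine (norm_tsum_le_tsum_norm (by simpa only [h] using hb)).trans (le_of_eq ?_)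
  simp only [h]

/-- Parseval's identity for absolutely convergent Fourier series. -/
lemma hasSum_parseval {a b : ℕ → ℂ} (ha : Summable fun n => ‖a n‖)
    (hb : Summable fun n => ‖b n‖) :
    HasSum (fun n => a n * (starRingEnd ℂ) (b n))
      (∫ θ, (∑' n, a n * circlePt 1 θ ^ n) *
        (starRingEnd ℂ) (∑' n, b n * circlePt 1 θ ^ n) ∂circMeas) := by
  have h1 := hasSum_integral_circle_mul ha
    (h := fun θ => (starRingEnd ℂ) (∑' n, b n * circlePt 1 θ ^ n))
    (Complex.continuous_conj.comp (continuous_tsum_circle hb))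
    ⟨∑' n, ‖b n‖, fun θ => by rw [RCLike.norm_conj]; exact norm_tsum_circle_le hb θ⟩
  convert! h1 using 2 with n
  congr 1
  have h2 := hasSum_integral_circle_mul hb
    (h := fun θ => (starRingEnd ℂ) (circlePt 1 θ ^ n))
    (by fun_prop) ⟨1, fun θ => by simp [norm_circlePt_one]⟩
  simp only [integral_circlePt_pow_mul_conj] at h2
  have h3 : HasSum (fun m => b m * if m = n then 1 else 0) (b n) := by
    convert! hasSum_ite_eq n (b n) using 2 with m
    split_ifs with h <;> simp [h]
  rw [h3.unique h2, ← integral_conj]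
  simp [mul_comm]

lemma hasDerivAt_one_sub_sq_rpow {α r : ℝ} (hr : r ∈ Ioo (0 : ℝ) 1) :
    HasDerivAt (fun r : ℝ => -(1 / 2) * (1 - r ^ 2) ^ (α + 1))
      ((α + 1) * (r * (1 - r ^ 2) ^ α)) r := by
  have hpos : 0 < 1 - r ^ 2 := by nlinarith [hr.1, hr.2]
  have h1 : HasDerivAt (fun r : ℝ => 1 - r ^ 2) (-(2 * r)) r := by
    simpa using ((hasDerivAt_id r).pow 2).const_sub 1
  have := (h1.rpow_const (p := α + 1) (Or.inl hpos.ne')).const_mul (-(1 / 2))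
  convert! this using 1
  rw [add_sub_cancel_right]
  ring

lemma continuous_one_sub_sq_rpow {γ : ℝ} (hγ : 0 ≤ γ) :
    Continuous fun r : ℝ => (1 - r ^ 2) ^ γ :=
  (by fun_prop : Continuous fun r : ℝ => 1 - r ^ 2).rpow_const fun _ => Or.inr hγ

lemma intervalIntegrable_mul_one_sub_sq_rpow {α : ℝ} (hα : -1 < α) :
    IntervalIntegrable (fun r : ℝ => (α + 1) * (r * (1 - r ^ 2) ^ α)) volume 0 1 := by
  refine intervalIntegral.intervalIntegrable_deriv_of_nonneg
    (g := fun r : ℝ => -(1 / 2) * (1 - r ^ 2) ^ (α + 1))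
    ((continuous_const.mul (continuous_one_sub_sq_rpow (by linarith))).continuousOn)
    (fun r hr => ?_) (fun r hr => ?_)
  · rw [min_eq_left zero_le_one, max_eq_right zero_le_one] at hr
    exact hasDerivAt_one_sub_sq_rpow hr
  · rw [min_eq_left zero_le_one, max_eq_right zero_le_one] at hr
    have hpos : 0 < 1 - r ^ 2 := by nlinarith [hr.1, hr.2]
    have : 0 < α + 1 := by linarith
    have := hr.1
    positivity

lemma momentCoeff_nuWeight_eq (α : ℝ) (n : ℕ) :
    momentCoeff (nuWeight α) n =
      ∫ r in (0 : ℝ)..1, r ^ (2 * n) * ((α + 1) * (r * (1 - r ^ 2) ^ α)) := by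
  unfold momentCoeff momentW nuWeight
  refine intervalIntegral.integral_congr fun r _ => ?_
  rw [show (2 * (n : ℝ) + 1) = ((2 * n + 1 : ℕ) : ℝ) by push_cast; ring, Real.rpow_natCast]
  ring

lemma momentCoeff_nuWeight_zero {α : ℝ} (hα : -1 < α) : momentCoeff (nuWeight α) 0 = 1 / 2 := by
  rw [momentCoeff_nuWeight_eq]
  simp only [mul_zero, pow_zero, one_mul]
  rw [intervalIntegral.integral_eq_sub_of_hasDerivAt_of_le zero_le_one
    ((continuous_const.mul (continuous_one_sub_sq_rpow (by linarith))).continuousOn)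
    (fun r hr => hasDerivAt_one_sub_sq_rpow hr) (intervalIntegrable_mul_one_sub_sq_rpow hα)]
  have : α + 1 ≠ 0 := by linarith
  simp [Real.zero_rpow this]

lemma momentCoeff_nuWeight_succ {α : ℝ} (hα : -1 < α) (n : ℕ) :
    momentCoeff (nuWeight α) (n + 1) =
      (n + 1) * ∫ r in (0 : ℝ)..1, r ^ (2 * n + 1) * (1 - r ^ 2) ^ (α + 1) := by
  rw [momentCoeff_nuWeight_eq]
  have h := intervalIntegral.integral_mul_deriv_eq_deriv_mul_of_hasDerivAt
    (a := 0) (b := 1) (u := fun r : ℝ => r ^ (2 * (n + 1)))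
    (u' := fun r : ℝ => (2 * (n + 1) : ℕ) * r ^ (2 * n + 1))
    (v := fun r : ℝ => -(1 / 2) * (1 - r ^ 2) ^ (α + 1))
    (v' := fun r : ℝ => (α + 1) * (r * (1 - r ^ 2) ^ α))
    (by fun_prop)
    ((continuous_const.mul (continuous_one_sub_sq_rpow (by linarith))).continuousOn)
    (fun r _ => by
      simpa [show 2 * (n + 1) - 1 = 2 * n + 1 by omega] using hasDerivAt_pow (2 * (n + 1)) r)
    (fun r hr => by
      rw [min_eq_left zero_le_one, max_eq_right zero_le_one] at hr
      exact hasDerivAt_one_sub_sq_rpow hr)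
    (Continuous.intervalIntegrable (by fun_prop) _ _) (intervalIntegrable_mul_one_sub_sq_rpow hα)
  rw [h, ← intervalIntegral.integral_const_mul]
  have h0 : α + 1 ≠ 0 := by linarith
  simp only [one_pow, sub_self, Real.zero_rpow h0, mul_zero, ne_eq, mul_eq_zero,
    OfNat.ofNat_ne_zero, Nat.add_eq_zero_iff, one_ne_zero, and_false, or_false, not_false_eq_true,
    zero_pow, zero_mul, zero_sub]
  rw [← intervalIntegral.integral_neg]
  refine intervalIntegral.integral_congr fun r _ => ?_
  push_cast
  ring

lemma momentCoeff_nuWeight_rec {α : ℝ} (hα : -1 < α) (n : ℕ) :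
    (n + (α + 2)) * momentCoeff (nuWeight α) (n + 1) = (n + 1) * momentCoeff (nuWeight α) n := by
  have h1 := momentCoeff_nuWeight_succ hα n
  have hi : ∀ m : ℕ, IntervalIntegrable
      (fun r : ℝ => r ^ (2 * m) * ((α + 1) * (r * (1 - r ^ 2) ^ α))) volume 0 1 := fun m =>
    (intervalIntegrable_mul_one_sub_sq_rpow hα).continuousOn_mul (by fun_prop)
  have h2 : (α + 1) * (∫ r in (0 : ℝ)..1, r ^ (2 * n + 1) * (1 - r ^ 2) ^ (α + 1)) =
      momentCoeff (nuWeight α) n - momentCoeff (nuWeight α) (n + 1) := by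
    rw [momentCoeff_nuWeight_eq, momentCoeff_nuWeight_eq,
      ← intervalIntegral.integral_sub (hi n) (hi (n + 1)), ← intervalIntegral.integral_const_mul]
    refine intervalIntegral.integral_congr_ae (Eventually.of_forall fun r hr => ?_)
    rw [uIoc_of_le zero_le_one] at hr
    rcases eq_or_lt_of_le hr.2 with rfl | h
    · have h0 : α + 1 ≠ 0 := by linarith
      simp [Real.zero_rpow h0]
    · have hpos : 0 < 1 - r ^ 2 := by nlinarith [hr.1]
      rw [Real.rpow_add hpos, Real.rpow_one]
      ring
  linear_combination (α + 1) * h1 + (n + 1) * h2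

lemma momentCoeff_nuWeight_pos {α : ℝ} (hα : -1 < α) (n : ℕ) :
    0 < momentCoeff (nuWeight α) n := by
  induction n with
  | zero => rw [momentCoeff_nuWeight_zero hα]; norm_num
  | succ n ih =>
    have h := momentCoeff_nuWeight_rec hα n
    have h1 : 0 < (n : ℝ) + (α + 2) := by
      have : (0 : ℝ) ≤ n := n.cast_nonneg
      linarith
    have h2 : 0 < (n + 1) * momentCoeff (nuWeight α) n := by positivity
    rw [← h] at h2
    exact pos_of_mul_pos_right h2 h1.le

lemma momentCoeff_nuWeight_le {α : ℝ} (hα : -1 < α) (n : ℕ) :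
    momentCoeff (nuWeight α) n ≤ 1 / 2 := by
  induction n with
  | zero => rw [momentCoeff_nuWeight_zero hα]
  | succ n ih =>
    have h := momentCoeff_nuWeight_rec hα n
    have h0 := momentCoeff_nuWeight_pos hα (n + 1)
    have : (0 : ℝ) ≤ n := n.cast_nonneg
    refine le_trans ?_ ih
    nlinarith

lemma MpE_one_dilateF (p s : ℝ) (f : ℂ → ℂ) : MpE p 1 (dilateF f s) = MpE p s f := by
  simp only [MpE, dilateF, ← circlePt_mul, mul_one]

lemma MpE_dilateF (p r s : ℝ) (f : ℂ → ℂ) : MpE p r (dilateF f s) = MpE p (s * r) f := by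
  simp only [MpE, dilateF, ← circlePt_mul]

lemma enorm_deriv_le_BlochNormE (G : ℂ → ℂ) {z : ℂ} (hz : ‖z‖ < 1) :
    ‖deriv G z‖ₑ ≤ BlochNormE G * ENNReal.ofReal ((1 - ‖z‖ ^ 2)⁻¹) := by
  have h : 0 < 1 - ‖z‖ ^ 2 := by nlinarith [norm_nonneg z]
  have h1 : ENNReal.ofReal ((1 - ‖z‖ ^ 2) * ‖deriv G z‖) ≤ BlochNormE G :=
    (le_iSup₂ (f := fun (z : ℂ) (_ : z ∈ Metric.ball (0 : ℂ) 1) =>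
      ENNReal.ofReal ((1 - ‖z‖ ^ 2) * ‖deriv G z‖)) z (by simpa using hz)).trans le_add_self
  calc ‖deriv G z‖ₑ = ENNReal.ofReal ((1 - ‖z‖ ^ 2) * ‖deriv G z‖ * (1 - ‖z‖ ^ 2)⁻¹) := by
        rw [mul_comm (1 - ‖z‖ ^ 2), mul_assoc, mul_inv_cancel₀ h.ne', mul_one, ofReal_norm]
    _ ≤ _ := by
        rw [ENNReal.ofReal_mul' (by positivity)]
        gcongr

/-- The integral representation behind the pairing of a Hardy function and a Bloch function. -/
lemma tsum_eq_integral_mul_conj_deriv {f g : ℂ → ℂ} (hf : DifferentiableOn ℂ f (Metric.ball 0 1))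
    (hg : DifferentiableOn ℂ g (Metric.ball 0 1)) {s r ρ : ℝ} (hs0 : 0 < s) (hs1 : s < 1)
    (hr0 : 0 ≤ r) (hr1 : r ≤ 1) (hρ0 : 0 < ρ) (hρ1 : ρ < 1) :
    HasSum (fun k : ℕ => taylorCoeff f (k + 1) * (starRingEnd ℂ) (taylorCoeff g (k + 1)) *
        (s : ℂ) ^ (2 * (k + 1)) * (r : ℂ) ^ (k + 1) * (k + 1) * (ρ : ℂ) ^ (2 * k + 1))
      (∫ θ, dilateF f s (circlePt ρ θ) *
        (starRingEnd ℂ) (circlePt 1 θ * (r * deriv (dilateF g s) (circlePt (r * ρ) θ)))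
          ∂circMeas) := by
  have hsρ : s * ρ < 1 := by nlinarith
  set a : ℕ → ℂ := fun k => taylorCoeff f k * ((s * ρ : ℝ) : ℂ) ^ k with ha
  set b : ℕ → ℂ := fun k => k * taylorCoeff g k * ((s : ℂ) * r) ^ k * (ρ : ℂ) ^ (k - 1) with hb
  have hbs : ∀ k, b (k + 1) = taylorCoeff (deriv g) k * ((s * r * ρ : ℝ) : ℂ) ^ k * (s * r) := by
    intro k
    simp only [hb, taylorCoeff_deriv, Nat.add_sub_cancel, pow_succ]
    push_cast
    ring
  have hsum_a : Summable fun k => ‖a k‖ := by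
    refine (summable_norm_taylorCoeff hf (by positivity : 0 ≤ s * ρ) hsρ).congr fun k => ?_
    rw [ha, norm_mul, norm_pow, Complex.norm_real, Real.norm_of_nonneg (by positivity)]
  have hsrρ : s * r * ρ < 1 := by
    calc s * r * ρ = (s * ρ) * r := by ring
      _ ≤ (s * ρ) * 1 := by gcongr
      _ < 1 := by linarith
  have hsum_b : Summable fun k => ‖b k‖ := by
    rw [← summable_nat_add_iff 1]
    refine ((summable_norm_taylorCoeff (differentiableOn_deriv_ball hg)
      (by positivity : 0 ≤ s * r * ρ) hsrρ).mul_right ‖(s * r : ℂ)‖).congr fun k => ?_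
    rw [hbs, norm_mul _ ((s : ℂ) * r), norm_mul _ (_ ^ k), norm_pow, Complex.norm_real,
      Real.norm_of_nonneg (by positivity)]
  have hpa := hasSum_parseval hsum_a hsum_b
  rw [← hasSum_nat_add_iff' 1] at hpa
  have hb0 : b 0 = 0 := by simp [hb]
  simp only [Finset.sum_range_one, hb0, map_zero, mul_zero, sub_zero] at hpa
  convert! hpa using 2 with k
  · simp only [ha, hb, map_mul, map_pow, map_natCast, Complex.conj_ofReal, Nat.add_sub_cancel]
    push_cast
    ring
  · have h1 : (fun θ => dilateF f s (circlePt ρ θ)) = fun θ => ∑' n, a n * circlePt 1 θ ^ n := by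
      funext θ
      have hz : ‖(s : ℂ) * circlePt ρ θ‖ < 1 := by
        rw [← circlePt_mul, norm_circlePt, abs_of_nonneg (by positivity)]; exact hsρ
      rw [dilateF, ← (hasSum_taylorCoeff hf hz).tsum_eq]
      refine tsum_congr fun n => ?_
      rw [circlePt_eq_mul, ha]
      push_cast
      ring
    have h2 : ∀ θ, circlePt 1 θ * (r * deriv (dilateF g s) (circlePt (r * ρ) θ)) =
        ∑' n, b n * circlePt 1 θ ^ n := by
      intro θ
      have hz : ‖(s : ℂ) * circlePt (r * ρ) θ‖ < 1 := by
        rw [← circlePt_mul, norm_circlePt, abs_of_nonneg (by positivity), ← mul_assoc]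
        exact hsrρ
      have hsb : Summable fun n => b n * circlePt 1 θ ^ n := by
        refine Summable.of_norm (hsum_b.congr fun n => ?_)
        rw [norm_mul (b n), norm_pow, norm_circlePt_one, one_pow, mul_one]
      rw [hsb.tsum_eq_zero_add, hb0, zero_mul, zero_add, deriv_dilateF,
        ← (hasSum_taylorCoeff (differentiableOn_deriv_ball hg) hz).tsum_eq, ← tsum_mul_left,
        ← tsum_mul_left, ← tsum_mul_left]
      refine tsum_congr fun n => ?_
      rw [hbs, circlePt_eq_mul (r * ρ)]
      push_cast
      ring
    funext θ
    rw [h2, ← congrFun h1 θ]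

lemma enorm_integral_mul_conj_deriv_le {f g : ℂ → ℂ}
    (hf : DifferentiableOn ℂ f (Metric.ball 0 1)) {s r ρ : ℝ} (hs0 : 0 < s) (hs1 : s < 1)
    (hr0 : 0 ≤ r) (hr1 : r ≤ 1) (hρ0 : 0 < ρ) (hρ1 : ρ < 1) :
    ‖∫ θ, dilateF f s (circlePt ρ θ) *
        (starRingEnd ℂ) (circlePt 1 θ * (r * deriv (dilateF g s) (circlePt (r * ρ) θ)))
          ∂circMeas‖ₑ ≤
      (∫⁻ θ, ENNReal.ofReal ‖dilateF f s (circlePt ρ θ)‖ ∂circMeas) *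
        (BlochNormE (dilateF g s) * ENNReal.ofReal ((1 - ρ ^ 2)⁻¹)) := by
  have hρ2 : 0 < 1 - ρ ^ 2 := by nlinarith
  have hm : Measurable fun θ => ENNReal.ofReal ‖dilateF f s (circlePt ρ θ)‖ := by
    have : Continuous fun θ => dilateF f s (circlePt ρ θ) := by
      simp only [dilateF, ← circlePt_mul]
      exact continuous_circle_dilate hf (by positivity) (by nlinarith)
    exact this.norm.measurable.ennreal_ofReal
  refine (enorm_integral_le_lintegral_enorm _).trans ?_
  rw [← lintegral_mul_const _ hm]
  refine lintegral_mono fun θ => ?_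
  simp only
  rw [enorm_mul, ofReal_norm]
  gcongr
  have hn : ‖circlePt (r * ρ) θ‖ = r * ρ := by
    rw [norm_circlePt, abs_of_nonneg (by positivity)]
  have h1 : r * ρ ≤ ρ := by nlinarith
  calc ‖(starRingEnd ℂ) (circlePt 1 θ * (r * deriv (dilateF g s) (circlePt (r * ρ) θ)))‖ₑ
      ≤ ‖deriv (dilateF g s) (circlePt (r * ρ) θ)‖ₑ := by
        rw [← ofReal_norm, ← ofReal_norm]
        refine ENNReal.ofReal_le_ofReal ?_
        rw [RCLike.norm_conj, norm_mul, norm_mul, norm_circlePt_one, one_mul, Complex.norm_real,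
          Real.norm_of_nonneg hr0]
        exact mul_le_of_le_one_left (norm_nonneg _) hr1
    _ ≤ _ := enorm_deriv_le_BlochNormE _ (by rw [hn]; linarith)
    _ ≤ _ := by
        rw [hn]
        have : (r * ρ) ^ 2 ≤ ρ ^ 2 := by gcongr
        gcongr

lemma one_sub_sq_rpow_le {α ρ : ℝ} (h0 : 0 ≤ ρ) (h1 : ρ < 1) :
    (1 - ρ ^ 2) ^ α ≤ 2 ^ |α| * (1 - ρ) ^ α := by
  have h : 1 - ρ ^ 2 = (1 + ρ) * (1 - ρ) := by ring
  rw [h, Real.mul_rpow (by linarith) (by linarith)]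
  refine mul_le_mul_of_nonneg_right ?_ (Real.rpow_nonneg (by linarith) _)
  calc (1 + ρ) ^ α ≤ (1 + ρ) ^ |α| := Real.rpow_le_rpow_of_exponent_le (by linarith) (le_abs_self _)
    _ ≤ 2 ^ |α| := Real.rpow_le_rpow (by linarith) (by linarith) (abs_nonneg _)

/-- The coefficient pairing of a Hardy space function with a Bloch function. -/
lemma exists_enorm_tsum_le {p : ℝ} (hp0 : 0 < p) (hp1 : p < 1) :
    ∃ C > (0 : ℝ), ∀ f g : ℂ → ℂ, DifferentiableOn ℂ f (Metric.ball 0 1) →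
      DifferentiableOn ℂ g (Metric.ball 0 1) → ∀ s ∈ Ioo (0 : ℝ) 1, ∀ r ∈ Icc (0 : ℝ) 1,
        ‖∑' k : ℕ, taylorCoeff f k * (starRingEnd ℂ) (taylorCoeff g k) * (s : ℂ) ^ (2 * k) *
            (r : ℂ) ^ k * (momentCoeff (nuWeight (1 / p - 2)) k : ℂ)‖ₑ ≤
          ENNReal.ofReal C * (MpE p s f * BlochNormE (dilateF g s)) := by
  obtain ⟨C, hC, hHL⟩ := exists_hardyLittlewood hp0 hp1
  set α : ℝ := 1 / p - 2 with hα
  have hα1 : -1 < α := by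
    have : 1 < 1 / p := by rw [lt_div_iff₀ hp0]; linarith
    linarith
  refine ⟨1 + 2 ^ |α| * C, by positivity, fun f g hf hg s hs r hr => ?_⟩
  obtain ⟨hs0, hs1⟩ := hs
  obtain ⟨hr0, hr1⟩ := hr
  set T : ℕ → ℂ := fun k => taylorCoeff f k * (starRingEnd ℂ) (taylorCoeff g k) *
    (s : ℂ) ^ (2 * k) * (r : ℂ) ^ k * (momentCoeff (nuWeight α) k : ℂ) with hT
  set e : ℕ → ℂ := fun k => taylorCoeff f (k + 1) * (starRingEnd ℂ) (taylorCoeff g (k + 1)) *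
        (s : ℂ) ^ (2 * (k + 1)) * (r : ℂ) ^ (k + 1) * (k + 1) with he
  obtain ⟨A, hA⟩ : ∃ A, ∀ k, ‖taylorCoeff f k‖ * s ^ k ≤ A := by
    obtain ⟨A, hA⟩ := (summable_norm_taylorCoeff hf hs0.le hs1).tendsto_atTop_zero.bddAbove_range
    exact ⟨A, fun k => hA ⟨k, rfl⟩⟩
  have he_sum : Summable fun k => ‖e k‖ := by
    refine Summable.of_nonneg_of_le (fun k => norm_nonneg _) (fun k => ?_)
      ((summable_norm_taylorCoeff (differentiableOn_deriv_ball hg) hs0.le hs1).mul_left A)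
    have h1 : ‖e k‖ = (‖taylorCoeff f (k + 1)‖ * s ^ (k + 1)) *
        (‖taylorCoeff (deriv g) k‖ * s ^ k) * (s * r ^ (k + 1)) := by
      simp only [he, norm_mul, norm_pow, RCLike.norm_conj, Complex.norm_real,
        Real.norm_of_nonneg hs0.le, Real.norm_of_nonneg hr0, taylorCoeff_deriv]
      ring
    have hA0 : 0 ≤ A := (by positivity : 0 ≤ ‖taylorCoeff f 0‖ * s ^ 0).trans (hA 0)
    rw [h1]
    have h2 : s * r ^ (k + 1) ≤ 1 := mul_le_one₀ hs1.le (by positivity) (pow_le_one₀ hr0 hr1)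
    calc _ ≤ (‖taylorCoeff f (k + 1)‖ * s ^ (k + 1)) *
          (‖taylorCoeff (deriv g) k‖ * s ^ k) * 1 := by gcongr
      _ ≤ _ := by rw [mul_one]; gcongr; exact hA _
  have hTe : ∀ k, T (k + 1) =
      ∫ ρ in Ioo (0 : ℝ) 1, e k * ((ρ ^ (2 * k + 1) * (1 - ρ ^ 2) ^ (α + 1) : ℝ) : ℂ) := by
    intro k
    rw [integral_const_mul, integral_complex_ofReal, hT]
    simp only [momentCoeff_nuWeight_succ hα1]
    rw [intervalIntegral.integral_of_le zero_le_one, integral_Ioc_eq_integral_Ioo, he]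
    push_cast
    ring
  have hw0 : ∀ ρ ∈ Ioo (0 : ℝ) 1, 0 ≤ (1 - ρ ^ 2) ^ (α + 1) := fun ρ hρ =>
    Real.rpow_nonneg (by nlinarith [hρ.1, hρ.2]) _
  have hc : ∀ k, Continuous fun ρ : ℝ =>
      e k * ((ρ ^ (2 * k + 1) * (1 - ρ ^ 2) ^ (α + 1) : ℝ) : ℂ) := fun k =>
    continuous_const.mul (Complex.continuous_ofReal.comp
      ((continuous_pow _).mul (continuous_one_sub_sq_rpow (by linarith))))
  have hnorm : ∀ k, ∀ ρ ∈ Ioo (0 : ℝ) 1,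
      ‖e k * ((ρ ^ (2 * k + 1) * (1 - ρ ^ 2) ^ (α + 1) : ℝ) : ℂ)‖ ≤ ‖e k‖ := by
    intro k ρ hρ
    rw [norm_mul, Complex.norm_real, Real.norm_of_nonneg
      (mul_nonneg (pow_nonneg hρ.1.le _) (hw0 ρ hρ))]
    refine mul_le_of_le_one_right (norm_nonneg _) ?_
    refine mul_le_one₀ (pow_le_one₀ hρ.1.le hρ.2.le) (hw0 ρ hρ) ?_
    exact Real.rpow_le_one (by nlinarith [hρ.1, hρ.2]) (by nlinarith [hρ.1]) (by linarith)
  have hintg : ∀ k, IntegrableOn (fun ρ : ℝ =>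
      e k * ((ρ ^ (2 * k + 1) * (1 - ρ ^ 2) ^ (α + 1) : ℝ) : ℂ)) (Ioo 0 1) := fun k =>
    ((hc k).integrableOn_Icc (a := 0) (b := 1)).mono_set Ioo_subset_Icc_self
  have hHS := hasSum_integral_of_summable_integral_norm (μ := volume.restrict (Ioo (0 : ℝ) 1))
    hintg (by
      refine Summable.of_nonneg_of_le (fun k => integral_nonneg fun ρ => norm_nonneg _)
        (fun k => ?_) he_sum
      calc _ ≤ ∫ ρ in Ioo (0 : ℝ) 1, ‖e k‖ :=
            setIntegral_mono_on (hintg k).norm (by simp) measurableSet_Ioo (hnorm k)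
        _ = _ := by simp)
  simp only [← hTe] at hHS
  have hsumT : Summable T := (summable_nat_add_iff 1).1 hHS.summable
  rw [hsumT.tsum_eq_zero_add, hHS.tsum_eq]
  have hE0 : ‖T 0‖ₑ ≤ MpE p s f * BlochNormE (dilateF g s) := by
    have h1 : ‖T 0‖ ≤ ‖f 0‖ * ‖g 0‖ := by
      simp only [hT, pow_zero, mul_zero, mul_one, norm_mul, RCLike.norm_conj, Complex.norm_real,
        momentCoeff_nuWeight_zero hα1, taylorCoeff_zero]
      norm_num
      nlinarith [mul_nonneg (norm_nonneg (f 0)) (norm_nonneg (g 0))]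
    rw [← ofReal_norm]
    refine (ENNReal.ofReal_le_ofReal h1).trans ?_
    rw [ENNReal.ofReal_mul (norm_nonneg _)]
    refine mul_le_mul' (norm_zero_le_MpE hf hp0 hs0.le hs1) ?_
    rw [BlochNormE]
    refine le_trans ?_ le_self_add
    simp [dilateF]
  have hE1 : ‖∫ ρ in Ioo (0 : ℝ) 1, ∑' k, e k *
      ((ρ ^ (2 * k + 1) * (1 - ρ ^ 2) ^ (α + 1) : ℝ) : ℂ)‖ₑ ≤
      ENNReal.ofReal (2 ^ |α| * C) * (MpE p s f * BlochNormE (dilateF g s)) := by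
    refine (enorm_integral_le_lintegral_enorm _).trans ?_
    have hpt : ∀ ρ ∈ Ioo (0 : ℝ) 1, ‖∑' k, e k *
        ((ρ ^ (2 * k + 1) * (1 - ρ ^ 2) ^ (α + 1) : ℝ) : ℂ)‖ₑ ≤
        (ENNReal.ofReal (2 ^ |α|) * BlochNormE (dilateF g s)) *
        ((∫⁻ θ, ENNReal.ofReal ‖dilateF f s (circlePt ρ θ)‖ ∂circMeas) *
          ENNReal.ofReal ((1 - ρ) ^ α)) := by
      intro ρ hρ
      have hρ2 : 0 < 1 - ρ ^ 2 := by nlinarith [hρ.1, hρ.2]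
      have h1 := tsum_eq_integral_mul_conj_deriv hf hg hs0 hs1 hr0 hr1 hρ.1 hρ.2
      have h2 := enorm_integral_mul_conj_deriv_le (g := g) hf hs0 hs1 hr0 hr1 hρ.1 hρ.2
      rw [← h1.tsum_eq] at h2
      have h3 : ∑' k, e k * ((ρ ^ (2 * k + 1) * (1 - ρ ^ 2) ^ (α + 1) : ℝ) : ℂ) =
          (∑' k, e k * (ρ : ℂ) ^ (2 * k + 1)) * (((1 - ρ ^ 2) ^ (α + 1) : ℝ) : ℂ) := by
        rw [← tsum_mul_right]
        refine tsum_congr fun k => ?_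
        push_cast
        ring
      rw [h3, enorm_mul]
      have h4 : ‖(((1 - ρ ^ 2) ^ (α + 1) : ℝ) : ℂ)‖ₑ = ENNReal.ofReal ((1 - ρ ^ 2) ^ (α + 1)) := by
        rw [← ofReal_norm, Complex.norm_real, Real.norm_of_nonneg (hw0 ρ hρ)]
      have h5 : ENNReal.ofReal ((1 - ρ ^ 2)⁻¹) * ENNReal.ofReal ((1 - ρ ^ 2) ^ (α + 1)) ≤
          ENNReal.ofReal (2 ^ |α|) * ENNReal.ofReal ((1 - ρ) ^ α) := by
        rw [← ENNReal.ofReal_mul (by positivity), ← ENNReal.ofReal_mul (by positivity)]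
        refine ENNReal.ofReal_le_ofReal ?_
        rw [Real.rpow_add hρ2, Real.rpow_one, mul_comm, mul_assoc, mul_inv_cancel₀ hρ2.ne', mul_one]
        exact one_sub_sq_rpow_le hρ.1.le hρ.2
      rw [h4]
      calc _ ≤ (∫⁻ θ, ENNReal.ofReal ‖dilateF f s (circlePt ρ θ)‖ ∂circMeas) *
        (BlochNormE (dilateF g s) * ENNReal.ofReal ((1 - ρ ^ 2)⁻¹)) *
          ENNReal.ofReal ((1 - ρ ^ 2) ^ (α + 1)) := by gcongr
        _ = (∫⁻ θ, ENNReal.ofReal ‖dilateF f s (circlePt ρ θ)‖ ∂circMeas) *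
        BlochNormE (dilateF g s) * (ENNReal.ofReal ((1 - ρ ^ 2)⁻¹) *
          ENNReal.ofReal ((1 - ρ ^ 2) ^ (α + 1))) := by ring
        _ ≤ (∫⁻ θ, ENNReal.ofReal ‖dilateF f s (circlePt ρ θ)‖ ∂circMeas) *
        BlochNormE (dilateF g s) * (ENNReal.ofReal (2 ^ |α|) * ENNReal.ofReal ((1 - ρ) ^ α)) := by
            gcongr
        _ = _ := by ring
    refine (setLIntegral_mono' measurableSet_Ioo hpt).trans ?_
    have hD := diffContOnCl_dilate hf hs0.le hs1
    have hmeas : AEMeasurable (fun ρ : ℝ =>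
        (∫⁻ θ, ENNReal.ofReal ‖dilateF f s (circlePt ρ θ)‖ ∂circMeas) *
          ENNReal.ofReal ((1 - ρ) ^ α)) (volume.restrict (Ioo 0 1)) := by
      refine AEMeasurable.mul (aemeasurable_of_monotoneOn_Ioo fun a ha b hb hab => ?_)
        (by fun_prop)
      have := lintegral_circle_mono hD.differentiableOn one_pos ha.1.le hab hb.2
      simpa using this
    rw [lintegral_const_mul'' _ hmeas]
    calc _ ≤ (ENNReal.ofReal (2 ^ |α|) * BlochNormE (dilateF g s)) *
          (ENNReal.ofReal C * MpE p 1 (dilateF f s)) := by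
            gcongr
            exact hHL _ hD
      _ = _ := by
        rw [MpE_one_dilateF, ENNReal.ofReal_mul (by positivity)]
        ring
  calc _ ≤ _ := (enorm_add_le _ _).trans (add_le_add hE0 hE1)
    _ = _ := by
      rw [ENNReal.ofReal_add zero_le_one (by positivity), ENNReal.ofReal_one, add_mul, one_mul]

lemma BlochNormE_dilateF_mono (g : ℂ → ℂ) {s t : ℝ} (hs : 0 < s) (hst : s ≤ t) :
    BlochNormE (dilateF g s) ≤ BlochNormE (dilateF g t) := by
  have ht : 0 < t := hs.trans_le hst
  unfold BlochNormE
  refine add_le_add (by simp [dilateF]) (iSup₂_le fun z hz => ?_)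
  have hz1 : ‖z‖ < 1 := by simpa using hz
  have hd1 : s / t ≤ 1 := (div_le_one ht).2 hst
  have hd0 : 0 ≤ s / t := by positivity
  have hn : ‖((s / t : ℝ) : ℂ) * z‖ = s / t * ‖z‖ := by
    rw [norm_mul, Complex.norm_real, Real.norm_of_nonneg hd0]
  have hle : s / t * ‖z‖ ≤ ‖z‖ := mul_le_of_le_one_left (norm_nonneg _) hd1
  refine le_trans ?_ (le_iSup₂ (f := fun (z : ℂ) (_ : z ∈ Metric.ball (0 : ℂ) 1) =>
      ENNReal.ofReal ((1 - ‖z‖ ^ 2) * ‖deriv (dilateF g t) z‖)) (((s / t : ℝ) : ℂ) * z)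
      (by rw [mem_ball_zero_iff, hn]; linarith))
  refine ENNReal.ofReal_le_ofReal ?_
  rw [deriv_dilateF, deriv_dilateF, hn]
  have e : (t : ℂ) * (((s / t : ℝ) : ℂ) * z) = s * z := by
    have : (t : ℂ) ≠ 0 := by exact_mod_cast ht.ne'
    push_cast
    field_simp
  rw [e, norm_mul, norm_mul, Complex.norm_real, Complex.norm_real, Real.norm_of_nonneg hs.le,
    Real.norm_of_nonneg ht.le]
  have h1 : 0 ≤ 1 - ‖z‖ ^ 2 := by nlinarith [norm_nonneg z]
  have h2 : (s / t * ‖z‖) ^ 2 ≤ ‖z‖ ^ 2 := by gcongr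
  have h3 : 0 ≤ 1 - (s / t * ‖z‖) ^ 2 := by linarith
  gcongr

lemma aemeasurable_weight {ω : ℝ → ℝ} (hω : IsRadialWeight ω) :
    AEMeasurable ω (volume.restrict (Ioo 0 1)) :=
  (hω.2.mono_set Ioo_subset_Ico_self).aemeasurable

lemma momentCoeff_eq (ω : ℝ → ℝ) (k : ℕ) :
    momentCoeff ω k = ∫ s in Ioo (0 : ℝ) 1, s ^ (2 * k + 1) * ω s := by
  unfold momentCoeff momentW
  rw [intervalIntegral.integral_of_le zero_le_one, integral_Ioc_eq_integral_Ioo]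
  refine integral_congr_ae (Eventually.of_forall fun r => ?_)
  simp only
  rw [show (2 * (k : ℝ) + 1) = ((2 * k + 1 : ℕ) : ℝ) by push_cast; ring, Real.rpow_natCast]

lemma integrableOn_pow_mul_weight {ω : ℝ → ℝ} (hω : IsRadialWeight ω) (k : ℕ) :
    IntegrableOn (fun s => s ^ k * ω s) (Ioo 0 1) := by
  have h : IntegrableOn ω (Ioo 0 1) := hω.2.mono_set Ioo_subset_Ico_self
  refine Integrable.bdd_mul (c := 1) h (by fun_prop) ?_
  refine (ae_restrict_iff' measurableSet_Ioo).2 (Eventually.of_forall fun s hs => ?_)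
  rw [Real.norm_of_nonneg (pow_nonneg hs.1.le _)]
  exact pow_le_one₀ hs.1.le hs.2.le

lemma momentCoeff_nonneg {ω : ℝ → ℝ} (hω : IsRadialWeight ω) (k : ℕ) : 0 ≤ momentCoeff ω k := by
  rw [momentCoeff_eq]
  exact setIntegral_nonneg measurableSet_Ioo fun s hs =>
    mul_nonneg (pow_nonneg hs.1.le _) (hω.1 s ⟨hs.1.le, hs.2⟩)

lemma momentCoeff_le_of_le {ω : ℝ → ℝ} (hω : IsRadialWeight ω) {j k : ℕ} (h : j ≤ k) :
    momentCoeff ω k ≤ momentCoeff ω j := by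
  rw [momentCoeff_eq, momentCoeff_eq]
  refine setIntegral_mono_on (integrableOn_pow_mul_weight hω _) (integrableOn_pow_mul_weight hω _)
    measurableSet_Ioo fun s hs => ?_
  have := hω.1 s ⟨hs.1.le, hs.2⟩
  gcongr ?_ * _
  exact pow_le_pow_of_le_one hs.1.le hs.2.le (by omega)

lemma summable_norm_taylorCoeff_mul {f g : ℂ → ℂ} (hf : DifferentiableOn ℂ f (Metric.ball 0 1))
    (hg : DifferentiableOn ℂ g (Metric.ball 0 1)) {s : ℝ} (hs0 : 0 ≤ s) (hs1 : s < 1) :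
    Summable fun k => ‖taylorCoeff f k‖ * ‖taylorCoeff g k‖ * s ^ (2 * k) := by
  obtain ⟨A, hA⟩ : ∃ A, ∀ k, ‖taylorCoeff f k‖ * s ^ k ≤ A := by
    obtain ⟨A, hA⟩ := (summable_norm_taylorCoeff hf hs0 hs1).tendsto_atTop_zero.bddAbove_range
    exact ⟨A, fun k => hA ⟨k, rfl⟩⟩
  refine Summable.of_nonneg_of_le (fun k => by positivity) (fun k => ?_)
    ((summable_norm_taylorCoeff hg hs0 hs1).mul_left A)
  calc _ = (‖taylorCoeff f k‖ * s ^ k) * (‖taylorCoeff g k‖ * s ^ k) := by ring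
    _ ≤ _ := by gcongr; exact hA k

lemma summable_norm_taylorCoeff_mul_pow {f g : ℂ → ℂ}
    (hf : DifferentiableOn ℂ f (Metric.ball 0 1))
    (hg : DifferentiableOn ℂ g (Metric.ball 0 1)) {r : ℝ} (hr0 : 0 ≤ r) (hr1 : r < 1) :
    Summable fun k => ‖taylorCoeff f k‖ * ‖taylorCoeff g k‖ * r ^ k := by
  have h := summable_norm_taylorCoeff_mul hf hg (Real.sqrt_nonneg r)
    ((Real.sqrt_lt' one_pos).2 (by simpa using hr1))
  simpa only [pow_mul, Real.sq_sqrt hr0] using h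

/-- Hölder's inequality for the mixed norms. -/
lemma lintegral_MpE_mul_BlochNormE_le {ω : ℝ → ℝ} (hω : IsRadialWeight ω) {p q q' : ℝ}
    (hp0 : 0 < p) (hqq : q.HolderConjugate q') {f g : ℂ → ℂ}
    (hf : DifferentiableOn ℂ f (Metric.ball 0 1)) :
    ∫⁻ s in Ioo (0 : ℝ) 1, MpE p s f * BlochNormE (dilateF g s) * ENNReal.ofReal (s * ω s) ≤
      LpqNormE ω p q f * XqNormE BlochNormE ω q' g := by
  have hM : AEMeasurable (fun s => MpE p s f) (volume.restrict (Ioo 0 1)) :=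
    aemeasurable_of_monotoneOn_Ioo fun a ha b hb hab => MpE_mono hf hp0 ha.1.le hab hb.2
  have hB : AEMeasurable (fun s => BlochNormE (dilateF g s)) (volume.restrict (Ioo 0 1)) :=
    aemeasurable_of_monotoneOn_Ioo fun a ha b hb hab => BlochNormE_dilateF_mono g ha.1 hab
  have hW : AEMeasurable (fun s => ENNReal.ofReal (s * ω s)) (volume.restrict (Ioo 0 1)) :=
    (aemeasurable_id.mul (aemeasurable_weight hω)).ennreal_ofReal
  have h := ENNReal.lintegral_mul_le_Lp_mul_Lq (volume.restrict (Ioo (0 : ℝ) 1)) hqq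
    (hM.mul (hW.pow_const (1 / q))) (hB.mul (hW.pow_const (1 / q')))
  have hq0 := hqq.pos
  have hq'0 := hqq.symm.pos
  calc _ = ∫⁻ s in Ioo (0 : ℝ) 1, (MpE p s f * ENNReal.ofReal (s * ω s) ^ (1 / q)) *
        (BlochNormE (dilateF g s) * ENNReal.ofReal (s * ω s) ^ (1 / q')) := by
        refine lintegral_congr fun s => ?_
        rw [mul_mul_mul_comm, ← ENNReal.rpow_add_of_nonneg _ _ (by positivity) (by positivity)]
        have : 1 / q + 1 / q' = 1 := by simpa using hqq.inv_add_inv_eq_one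
        rw [this, ENNReal.rpow_one]
    _ ≤ _ := h
    _ ≤ _ := by
      simp only [Pi.mul_apply]
      unfold LpqNormE XqNormE
      gcongr ?_ ^ _ * ?_ ^ _
      · refine lintegral_mono fun s => ?_
        simp only
        rw [ENNReal.mul_rpow_of_nonneg _ _ hq0.le, ← ENNReal.rpow_mul, one_div,
          inv_mul_cancel₀ hq0.ne', ENNReal.rpow_one]
      · refine setLIntegral_mono' measurableSet_Ioo fun s hs => ?_
        rw [ENNReal.mul_rpow_of_nonneg _ _ hq'0.le, ← ENNReal.rpow_mul, one_div,
          inv_mul_cancel₀ hq'0.ne', ENNReal.rpow_one]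
        gcongr
        exact mul_le_of_le_one_left (hω.1 s ⟨hs.1.le, hs.2⟩) hs.2.le

/-- The pairing exists and is bounded. -/
lemma exists_hasPairingC {ω : ℝ → ℝ} (hω : IsRadialWeight ω) {p q q' : ℝ}
    (hp0 : 0 < p) (hp1 : p < 1) (hqq : q.HolderConjugate q') :
    ∃ C > (0 : ℝ), ∀ f g : ℂ → ℂ, DifferentiableOn ℂ g (Metric.ball 0 1) →
      XqNormE BlochNormE ω q' g < ⊤ → InApq ω p q f →
        ∃ l : ℂ, HasPairingC
              (fun k => momentCoeff ω k * momentCoeff (nuWeight (1 / p - 2)) k) f g l ∧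
            ‖l‖ ≤ C * (XqNormE BlochNormE ω q' g).toReal * (LpqNormE ω p q f).toReal := by
  obtain ⟨C, hC, hA⟩ := exists_enorm_tsum_le hp0 hp1
  refine ⟨C, hC, fun f g hg hgn hfq => ?_⟩
  obtain ⟨hf, hfn⟩ := hfq
  set α : ℝ := 1 / p - 2 with hα
  have hα1 : -1 < α := by
    have : 1 < 1 / p := by rw [lt_div_iff₀ hp0]; linarith
    linarith
  set μ : Measure ℝ := volume.restrict (Ioo (0 : ℝ) 1) with hμ
  set t : ℝ → ℝ → ℕ → ℂ := fun s r k =>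
    taylorCoeff f k * (starRingEnd ℂ) (taylorCoeff g k) * (s : ℂ) ^ (2 * k) *
            (r : ℂ) ^ k * (momentCoeff (nuWeight α) k : ℂ) with ht
  set I : ℝ → ℝ → ℂ := fun s r => ∑' k : ℕ, t s r k with hI
  have hν : ∀ k, ‖(momentCoeff (nuWeight α) k : ℂ)‖ ≤ 1 := fun k => by
    rw [Complex.norm_real, Real.norm_of_nonneg (momentCoeff_nuWeight_pos hα1 k).le]
    linarith [momentCoeff_nuWeight_le hα1 k]
  have htn : ∀ s ∈ Ioo (0 : ℝ) 1, ∀ r ∈ Icc (0 : ℝ) 1, ∀ k, ‖t s r k‖ ≤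
      ‖taylorCoeff f k‖ * ‖taylorCoeff g k‖ * s ^ (2 * k) := by
    intro s hs r hr k
    simp only [ht, norm_mul, norm_pow, RCLike.norm_conj, Complex.norm_real,
      Real.norm_of_nonneg hs.1.le, Real.norm_of_nonneg hr.1]
    have h1 : 0 ≤ ‖taylorCoeff f k‖ * ‖taylorCoeff g k‖ * s ^ (2 * k) := by
      have := hs.1; positivity
    rw [mul_assoc _ (r ^ k)]
    refine mul_le_of_le_one_right h1 (mul_le_one₀ (pow_le_one₀ hr.1 hr.2) (norm_nonneg _) ?_)
    simpa only [Complex.norm_real] using hν k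
  have htS : ∀ s ∈ Ioo (0 : ℝ) 1, ∀ r ∈ Icc (0 : ℝ) 1, Summable fun k => t s r k := fun s hs r hr =>
    Summable.of_norm_bounded (summable_norm_taylorCoeff_mul hf hg hs.1.le hs.2) (htn s hs r hr)
  have hImeas : ∀ r ∈ Icc (0 : ℝ) 1,
      AEStronglyMeasurable (fun s => I s r * ((s * ω s : ℝ) : ℂ)) μ := by
    intro r hr
    refine AEStronglyMeasurable.mul ?_ ?_
    · refine aestronglyMeasurable_of_tendsto_ae atTop
        (f := fun (n : ℕ) s => ∑ k ∈ Finset.range n, t s r k) (fun n => ?_) ?_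
      · exact Continuous.aestronglyMeasurable (by simp only [ht]; fun_prop)
      · exact (ae_restrict_iff' measurableSet_Ioo).2 (Eventually.of_forall fun s hs =>
          (htS s hs r hr).hasSum.tendsto_sum_nat)
    · exact (Complex.measurable_ofReal.comp_aemeasurable
        (aemeasurable_id.mul (aemeasurable_weight hω))).aestronglyMeasurable
  set bnd : ℝ → ℝ≥0∞ := fun s =>
    ENNReal.ofReal C * (MpE p s f * BlochNormE (dilateF g s) * ENNReal.ofReal (s * ω s)) with hbnd
  have hbmeas : AEMeasurable bnd μ := by
    refine (AEMeasurable.mul (AEMeasurable.mul (aemeasurable_of_monotoneOn_Ioo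
      fun a ha b hb hab => MpE_mono hf hp0 ha.1.le hab hb.2) (aemeasurable_of_monotoneOn_Ioo
      fun a ha b hb hab => BlochNormE_dilateF_mono g ha.1 hab)) ?_).const_mul _
    exact (aemeasurable_id.mul (aemeasurable_weight hω)).ennreal_ofReal
  have hbint : ∫⁻ s, bnd s ∂μ ≤
      ENNReal.ofReal C * (LpqNormE ω p q f * XqNormE BlochNormE ω q' g) := by
    simp only [hbnd]
    rw [lintegral_const_mul' _ _ ENNReal.ofReal_ne_top]
    gcongr
    exact lintegral_MpE_mul_BlochNormE_le hω hp0 hqq hf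
  have hbfin : ∫⁻ s, bnd s ∂μ ≠ ⊤ := ne_top_of_le_ne_top
    (ENNReal.mul_ne_top ENNReal.ofReal_ne_top (ENNReal.mul_ne_top hfn.ne hgn.ne)) hbint
  have hIb : ∀ r ∈ Icc (0 : ℝ) 1, ∀ s ∈ Ioo (0 : ℝ) 1,
      ‖I s r * ((s * ω s : ℝ) : ℂ)‖ₑ ≤ bnd s := by
    intro r hr s hs
    have h1 : ‖((s * ω s : ℝ) : ℂ)‖ₑ = ENNReal.ofReal (s * ω s) := by
      rw [← ofReal_norm, Complex.norm_real, Real.norm_of_nonneg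
        (mul_nonneg hs.1.le (hω.1 s ⟨hs.1.le, hs.2⟩))]
    rw [enorm_mul, h1, hbnd]
    simp only
    rw [← mul_assoc]
    gcongr
    exact hA f g hf hg s hs r hr
  have hS : ∀ r ∈ Ico (0 : ℝ) 1, HasSum (fun k : ℕ =>
      taylorCoeff f k * (starRingEnd ℂ) (taylorCoeff g k) *
        ((momentCoeff ω k * momentCoeff (nuWeight α) k : ℝ) : ℂ) * ((r : ℂ)) ^ k)
      (∫ s, I s r * ((s * ω s : ℝ) : ℂ) ∂μ) := by
    intro r hr
    have hterm : ∀ k, ∀ s, t s r k * ((s * ω s : ℝ) : ℂ) = (taylorCoeff f k *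
        (starRingEnd ℂ) (taylorCoeff g k) * (r : ℂ) ^ k * (momentCoeff (nuWeight α) k : ℂ)) *
        ((s ^ (2 * k + 1) * ω s : ℝ) : ℂ) := by
      intro k s
      simp only [ht]
      push_cast
      ring
    have hi : ∀ k, Integrable (fun s => t s r k * ((s * ω s : ℝ) : ℂ)) μ := by
      intro k
      simp only [hterm]
      exact (Integrable.ofReal (integrableOn_pow_mul_weight hω _)).const_mul _
    have h1 := hasSum_integral_of_summable_integral_norm (μ := μ) hi (by
      refine Summable.of_nonneg_of_le (fun k => integral_nonneg fun ρ => norm_nonneg _)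
        (fun k => ?_) ((summable_norm_taylorCoeff_mul_pow hf hg hr.1 hr.2).mul_right
          (momentCoeff ω 0))
      simp only [hterm, norm_mul]
      rw [integral_const_mul]
      have h2 : ∫ s, ‖((s ^ (2 * k + 1) * ω s : ℝ) : ℂ)‖ ∂μ = momentCoeff ω k := by
        rw [momentCoeff_eq]
        refine setIntegral_congr_fun measurableSet_Ioo fun s hs => ?_
        rw [Complex.norm_real, Real.norm_of_nonneg
          (mul_nonneg (pow_nonneg hs.1.le _) (hω.1 s ⟨hs.1.le, hs.2⟩))]
      rw [h2, RCLike.norm_conj, norm_pow, Complex.norm_real, Real.norm_of_nonneg hr.1]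
      refine mul_le_mul ?_ (momentCoeff_le_of_le hω (Nat.zero_le k)) (momentCoeff_nonneg hω k)
        (mul_nonneg (by positivity) (pow_nonneg hr.1 _))
      exact mul_le_of_le_one_right (mul_nonneg (by positivity) (pow_nonneg hr.1 _)) (hν k))
    convert! h1 using 1
    · funext k
      simp only [hterm]
      rw [integral_const_mul, integral_complex_ofReal, ← momentCoeff_eq]
      push_cast
      ring
    · simp only [hI, tsum_mul_right]
  refine ⟨∫ s, I s 1 * ((s * ω s : ℝ) : ℂ) ∂μ, ⟨fun r hr => (hS r hr).summable, ?_⟩, ?_⟩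
  · have hmem : Ioo (0 : ℝ) 1 ∈ nhdsWithin (1 : ℝ) (Iio 1) := Ioo_mem_nhdsLT zero_lt_one
    have hlim : Tendsto (fun r => ∫ s, I s r * ((s * ω s : ℝ) : ℂ) ∂μ) (nhdsWithin 1 (Iio 1))
        (nhds (∫ s, I s 1 * ((s * ω s : ℝ) : ℂ) ∂μ)) := by
      refine tendsto_integral_filter_of_dominated_convergence (fun s => (bnd s).toReal)
        ?_ ?_ (integrable_toReal_of_lintegral_ne_top hbmeas hbfin) ?_
      · filter_upwards [hmem] with r hr
        exact hImeas r ⟨hr.1.le, hr.2.le⟩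
      · filter_upwards [hmem] with r hr
        filter_upwards [ae_restrict_mem measurableSet_Ioo, ae_lt_top' hbmeas hbfin] with s hs hlt
        rw [← ENNReal.toReal_ofReal (norm_nonneg (I s r * ((s * ω s : ℝ) : ℂ))), ofReal_norm]
        exact ENNReal.toReal_mono hlt.ne (hIb r ⟨hr.1.le, hr.2.le⟩ s hs)
      · filter_upwards [ae_restrict_mem measurableSet_Ioo] with s hs
        refine Tendsto.mul_const _ ?_
        refine tendsto_tsum_of_dominated_convergence
          (summable_norm_taylorCoeff_mul hf hg hs.1.le hs.2) (fun k => ?_) ?_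
        · have : Continuous fun r : ℝ => t s r k := by simp only [ht]; fun_prop
          exact (this.tendsto 1).mono_left nhdsWithin_le_nhds
        · filter_upwards [hmem] with r hr k
          exact htn s hs r ⟨hr.1.le, hr.2.le⟩ k
    refine hlim.congr' ?_
    filter_upwards [hmem] with r hr
    exact (hS r ⟨hr.1.le, hr.2⟩).tsum_eq.symm
  · have h1 : ‖∫ s, I s 1 * ((s * ω s : ℝ) : ℂ) ∂μ‖ₑ ≤
        ENNReal.ofReal C * (LpqNormE ω p q f * XqNormE BlochNormE ω q' g) := by
      refine (enorm_integral_le_lintegral_enorm _).trans (le_trans ?_ hbint)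
      exact setLIntegral_mono' measurableSet_Ioo (hIb 1 ⟨zero_le_one, le_rfl⟩)
    have h2 := ENNReal.toReal_mono
      (ENNReal.mul_ne_top ENNReal.ofReal_ne_top (ENNReal.mul_ne_top hfn.ne hgn.ne)) h1
    rw [toReal_enorm, ENNReal.toReal_mul, ENNReal.toReal_mul, ENNReal.toReal_ofReal hC.le] at h2
    linarith

lemma omegaHat_eq {ω : ℝ → ℝ} {r : ℝ} (hr : r ≤ 1) : omegaHat ω r = ∫ s in Ioo r 1, ω s := by
  rw [omegaHat, intervalIntegral.integral_of_le hr, integral_Ioc_eq_integral_Ioo]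

lemma IsRadialWeight.intervalIntegrable {ω : ℝ → ℝ} (hω : IsRadialWeight ω) :
    IntervalIntegrable ω volume 0 1 :=
  (intervalIntegrable_iff_integrableOn_Ico_of_le zero_le_one).2 hω.2

lemma omegaHat_one (ω : ℝ → ℝ) : omegaHat ω 1 = 0 := by simp [omegaHat]

lemma continuousOn_omegaHat {ω : ℝ → ℝ} (hω : IsRadialWeight ω) :
    ContinuousOn (omegaHat ω) (Icc 0 1) := by
  have h := intervalIntegral.continuousOn_primitive_interval_left (μ := volume) (f := ω)
    (a := 0) (b := 1) (by
      rw [uIcc_of_le zero_le_one, integrableOn_Icc_iff_integrableOn_Ico]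
      exact hω.2)
  rwa [uIcc_of_le zero_le_one] at h

lemma lintegral_weight_Ioo {ω : ℝ → ℝ} (hω : IsRadialWeight ω) {r : ℝ} (h0 : 0 ≤ r) (h1 : r ≤ 1) :
    ∫⁻ s in Ioo r 1, ENNReal.ofReal (ω s) = ENNReal.ofReal (omegaHat ω r) := by
  rw [omegaHat_eq h1, ofReal_integral_eq_lintegral_ofReal
    (hω.2.mono_set fun s hs => ⟨h0.trans hs.1.le, hs.2⟩)]
  exact (ae_restrict_iff' measurableSet_Ioo).2 (Eventually.of_forall fun s hs =>
    hω.1 s ⟨h0.trans hs.1.le, hs.2⟩)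

lemma omegaHat_anti {ω : ℝ → ℝ} (hω : IsRadialWeight ω) {r s : ℝ} (h0 : 0 ≤ r) (hrs : r ≤ s)
    (h1 : s ≤ 1) : omegaHat ω s ≤ omegaHat ω r := by
  rw [omegaHat_eq h1, omegaHat_eq (hrs.trans h1)]
  refine setIntegral_mono_set (hω.2.mono_set fun x hx => ⟨h0.trans hx.1.le, hx.2⟩) ?_
    (Eventually.of_forall fun x hx => ⟨hrs.trans_lt hx.1, hx.2⟩)
  exact (ae_restrict_iff' measurableSet_Ioo).2 (Eventually.of_forall fun x hx =>
    hω.1 x ⟨h0.trans hx.1.le, hx.2⟩)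

lemma aemeasurable_omegaHat {ω : ℝ → ℝ} (hω : IsRadialWeight ω) :
    AEMeasurable (omegaHat ω) (volume.restrict (Ioo 0 1)) :=
  ((continuousOn_omegaHat hω).mono Ioo_subset_Icc_self).aemeasurable measurableSet_Ioo

/-- The sublevel sets of the tail integral. -/
lemma lintegral_weight_sublevel {ω : ℝ → ℝ} (hω : IsRadialWeight ω)
    (hpos : ∀ r ∈ Ico (0 : ℝ) 1, 0 < omegaHat ω r) (c : ℝ) :
    ∫⁻ s in omegaHat ω ⁻¹' Iic c ∩ Ioo 0 1, ENNReal.ofReal (ω s) =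
      ENNReal.ofReal (min c (omegaHat ω 0)) := by
  have hW0 := hpos 0 (by simp)
  rcases le_or_gt c 0 with hc | hc
  · have : omegaHat ω ⁻¹' Iic c ∩ Ioo 0 1 = ∅ := by
      ext s
      simp only [mem_inter_iff, mem_preimage, mem_Iic, mem_empty_iff_false, iff_false, not_and]
      intro h1 h2
      exact absurd (hpos s ⟨h2.1.le, h2.2⟩) (by linarith)
    rw [this, ENNReal.ofReal_of_nonpos ((min_le_left _ _).trans hc)]
    simp
  rcases le_or_gt (omegaHat ω 0) c with hc0 | hc0
  · have : omegaHat ω ⁻¹' Iic c ∩ Ioo 0 1 = Ioo 0 1 := by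
      refine inter_eq_right.2 fun s hs => ?_
      exact (omegaHat_anti hω le_rfl hs.1.le hs.2.le).trans hc0
    rw [this, lintegral_weight_Ioo hω le_rfl zero_le_one, min_eq_right hc0]
  · set A : Set ℝ := {s | s ∈ Icc (0 : ℝ) 1 ∧ omegaHat ω s = c} with hA
    have hAne : A.Nonempty := by
      have := intermediate_value_Icc' zero_le_one (continuousOn_omegaHat hω)
      rw [omegaHat_one] at this
      obtain ⟨s, hs, h⟩ := this ⟨hc.le, hc0.le⟩
      exact ⟨s, hs, h⟩
    have hAcl : IsClosed A := (continuousOn_omegaHat hω).preimage_isClosed_of_isClosed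
      isClosed_Icc isClosed_singleton
    have hAb : BddBelow A := ⟨0, fun s hs => hs.1.1⟩
    set r := sInf A
    have hr : r ∈ A := hAcl.csInf_mem hAne hAb
    have hr0 : 0 < r := lt_of_le_of_ne hr.1.1 fun h => by
      have := hr.2
      rw [← h] at this
      linarith
    have hset : omegaHat ω ⁻¹' Iic c ∩ Ioo 0 1 = Ico r 1 := by
      ext s
      simp only [mem_inter_iff, mem_preimage, mem_Iic, mem_Ioo, mem_Ico]
      constructor
      · rintro ⟨h1, h2, h3⟩
        refine ⟨?_, h3⟩
        by_contra! h
        have h4 := omegaHat_anti hω h2.le h.le hr.1.2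
        rw [hr.2] at h4
        exact absurd (csInf_le hAb ⟨⟨h2.le, h3.le⟩, le_antisymm h1 h4⟩) (not_le.2 h)
      · rintro ⟨h1, h2⟩
        exact ⟨(omegaHat_anti hω hr0.le h1 h2.le).trans hr.2.le, hr0.trans_le h1, h2⟩
    rw [hset, ← setLIntegral_congr Ioo_ae_eq_Ico, lintegral_weight_Ioo hω hr0.le hr.1.2, hr.2,
      min_eq_left hc0.le]

/-- Change of variables by the tail integral of a weight. -/
lemma lintegral_comp_omegaHat {ω : ℝ → ℝ} (hω : IsRadialWeight ω)
    (hpos : ∀ r ∈ Ico (0 : ℝ) 1, 0 < omegaHat ω r) {f : ℝ → ℝ≥0∞} (hf : Measurable f) :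
    ∫⁻ s in Ioo (0 : ℝ) 1, f (omegaHat ω s) * ENNReal.ofReal (ω s) =
      ∫⁻ x in Ioo 0 (omegaHat ω 0), f x := by
  have hd : AEMeasurable (fun s => ENNReal.ofReal (ω s)) (volume.restrict (Ioo 0 1)) :=
    (aemeasurable_weight hω).ennreal_ofReal
  set μ := (volume.restrict (Ioo (0 : ℝ) 1)).withDensity (fun s => ENNReal.ofReal (ω s)) with hμ
  have hW : AEMeasurable (omegaHat ω) μ :=
    (aemeasurable_omegaHat hω).mono_ac (withDensity_absolutelyContinuous _ _)
  have hfin : IsFiniteMeasure μ := by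
    refine isFiniteMeasure_withDensity ?_
    rw [lintegral_weight_Ioo hω le_rfl zero_le_one]
    exact ENNReal.ofReal_ne_top
  have hmap : μ.map (omegaHat ω) = volume.restrict (Ioo 0 (omegaHat ω 0)) := by
    have : IsFiniteMeasure (μ.map (omegaHat ω)) := inferInstance
    refine Measure.ext_of_Iic _ _ fun c => ?_
    rw [Measure.map_apply_of_aemeasurable hW measurableSet_Iic, hμ, withDensity_apply',
      Measure.restrict_restrict' measurableSet_Ioo, lintegral_weight_sublevel hω hpos,
      Measure.restrict_apply measurableSet_Iic]
    rcases lt_or_ge c (omegaHat ω 0) with h | h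
    · have : Iic c ∩ Ioo 0 (omegaHat ω 0) = Ioc 0 c := by
        ext x; simp only [mem_inter_iff, mem_Iic, mem_Ioo, mem_Ioc]
        exact ⟨fun hx => ⟨hx.2.1, hx.1⟩, fun hx => ⟨hx.2, hx.1, hx.2.trans_lt h⟩⟩
      rw [this, Real.volume_Ioc, min_eq_left h.le, sub_zero]
    · have : Iic c ∩ Ioo 0 (omegaHat ω 0) = Ioo 0 (omegaHat ω 0) :=
        inter_eq_right.2 fun x hx => hx.2.le.trans h
      rw [this, Real.volume_Ioo, min_eq_right h, sub_zero]
  rw [← hmap, lintegral_map' hf.aemeasurable hW, hμ,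
    lintegral_withDensity_eq_lintegral_mul_non_measurable₀ _ hd
      (Eventually.of_forall fun s => ENNReal.ofReal_lt_top)]
  refine lintegral_congr fun s => ?_
  simp only [Pi.mul_apply, mul_comm]

/-- A doubling weight has a tail of at least polynomial size. -/
lemma InDhat.exists_pow {ω : ℝ → ℝ} (hω : IsRadialWeight ω) (hD : InDhat ω)
    (hpos : ∀ r ∈ Ico (0 : ℝ) 1, 0 < omegaHat ω r) :
    ∃ m : ℕ, 1 ≤ m ∧ ∀ s r : ℝ, 0 ≤ s → s ≤ r → r < 1 →
      omegaHat ω s ≤ 2 ^ m * ((1 - s) / (1 - r)) ^ m * omegaHat ω r := by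
  obtain ⟨C, hC, h⟩ := hD
  obtain ⟨m, hm⟩ := pow_unbounded_of_one_lt C (one_lt_two (α := ℝ))
  have hm1 : C ≤ (2 : ℝ) ^ (m + 1) := hm.le.trans (pow_le_pow_right₀ one_le_two (by omega))
  refine ⟨m + 1, by omega, fun s r hs hsr hr => ?_⟩
  have hiter : ∀ n : ℕ, omegaHat ω s ≤ ((2 : ℝ) ^ (m + 1)) ^ n *
      omegaHat ω (1 - (1 - s) / 2 ^ n) := by
    intro n
    induction n with
    | zero => simp
    | succ n ih =>
      have hp : (0 : ℝ) < 2 ^ n := by positivity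
      have hq : 0 < (1 - s) / 2 ^ n := div_pos (by linarith) hp
      have hq1 : (1 - s) / 2 ^ n ≤ 1 := by
        rw [div_le_one hp]
        have : (1 : ℝ) ≤ 2 ^ n := one_le_pow₀ one_le_two
        linarith
      have h1 := h (1 - (1 - s) / 2 ^ n) ⟨by linarith, by linarith⟩
      have e : (1 + (1 - (1 - s) / 2 ^ n)) / 2 = 1 - (1 - s) / 2 ^ (n + 1) := by
        rw [pow_succ]; field_simp; ring
      rw [e] at h1
      have hq2 : (1 - s) / 2 ^ (n + 1) = (1 - s) / 2 ^ n / 2 := by rw [pow_succ]; field_simp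
      have h0 := hpos (1 - (1 - s) / 2 ^ (n + 1)) ⟨by linarith, by linarith⟩
      calc omegaHat ω s ≤ _ := ih
        _ ≤ ((2 : ℝ) ^ (m + 1)) ^ n * ((2 : ℝ) ^ (m + 1) *
            omegaHat ω (1 - (1 - s) / 2 ^ (n + 1))) := by
            gcongr
            exact h1.trans (by gcongr)
        _ = _ := by rw [pow_succ _ n]; ring
  have hr1 : 0 < 1 - r := by linarith
  obtain ⟨n, hn1, hn2⟩ := exists_nat_pow_near (x := (1 - s) / (1 - r)) (y := (2 : ℝ))
    ((one_le_div hr1).2 (by linarith)) one_lt_two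
  have hlt : (1 - s) / 2 ^ (n + 1) ≤ 1 - r := by
    rw [div_lt_iff₀ hr1] at hn2
    rw [div_le_iff₀ (by positivity)]
    linarith
  have hle0 : 0 < (1 - s) / 2 ^ (n + 1) := div_pos (by linarith) (by positivity)
  have h2 : omegaHat ω (1 - (1 - s) / 2 ^ (n + 1)) ≤ omegaHat ω r :=
    omegaHat_anti hω (hs.trans hsr) (by linarith) (by linarith)
  calc omegaHat ω s ≤ _ := hiter (n + 1)
    _ ≤ ((2 : ℝ) ^ (m + 1)) ^ (n + 1) * omegaHat ω r := by gcongr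
    _ = 2 ^ (m + 1) * (2 ^ n) ^ (m + 1) * omegaHat ω r := by
        congr 1
        rw [pow_succ _ n, ← pow_mul, ← pow_mul, mul_comm ((2 : ℝ) ^ _), mul_comm (m + 1) n]
    _ ≤ _ := by
        have := (hpos r ⟨hs.trans hsr, hr⟩).le
        gcongr

/-- A kernel comparing two levels of the tail integral of a weight. -/
def levelKernel (t x : ℝ) : ℝ :=
  if x ≤ t then t ^ (1 / 2 : ℝ) * x ^ (-(1 / 2) : ℝ) else t ^ (2 : ℝ) * x ^ (-2 : ℝ)

lemma measurable_levelKernel (t : ℝ) : Measurable (levelKernel t) :=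
  Measurable.ite measurableSet_Iic (by fun_prop) (by fun_prop)

lemma lintegral_levelKernel {t : ℝ} (ht : 0 < t) :
    ∫⁻ x in Ioi (0 : ℝ), ENNReal.ofReal (levelKernel t x) = ENNReal.ofReal (3 * t) := by
  have hU : Ioi (0 : ℝ) = Ioc 0 t ∪ Ioi t := by rw [Ioc_union_Ioi_eq_Ioi ht.le]
  rw [hU, lintegral_union measurableSet_Ioi (Ioc_disjoint_Ioi le_rfl)]
  have h1 : ∫⁻ x in Ioc 0 t, ENNReal.ofReal (levelKernel t x) = ENNReal.ofReal (2 * t) := by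
    calc _ = ∫⁻ x in Ioc 0 t, ENNReal.ofReal (t ^ (1 / 2 : ℝ)) *
          ENNReal.ofReal (x ^ (-(1 / 2) : ℝ)) := by
          refine setLIntegral_congr_fun measurableSet_Ioc fun x hx => ?_
          rw [levelKernel, if_pos hx.2, ENNReal.ofReal_mul (by positivity)]
      _ = _ := by
          rw [lintegral_const_mul' _ _ ENNReal.ofReal_ne_top,
            lintegral_Ioc_ofReal_rpow (by norm_num) ht.le, ← ENNReal.ofReal_mul (by positivity)]
          congr 1
          have : t ^ (1 / 2 : ℝ) * t ^ (1 / 2 : ℝ) = t := by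
            rw [← Real.rpow_add ht]; norm_num
          norm_num at this ⊢
          linarith
  have h2 : ∫⁻ x in Ioi t, ENNReal.ofReal (levelKernel t x) = ENNReal.ofReal t := by
    calc _ = ∫⁻ x in Ioi t, ENNReal.ofReal (t ^ (2 : ℝ)) *
          ENNReal.ofReal (x ^ (-2 : ℝ)) := by
          refine setLIntegral_congr_fun measurableSet_Ioi fun x hx => ?_
          rw [levelKernel, if_neg (not_le.2 hx), ENNReal.ofReal_mul (by positivity)]
      _ = _ := by
          rw [lintegral_const_mul' _ _ ENNReal.ofReal_ne_top,
            lintegral_Ioi_ofReal_rpow (by norm_num) ht, ← ENNReal.ofReal_mul (by positivity)]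
          congr 1
          have : t ^ (2 : ℝ) * t ^ (-1 : ℝ) = t := by
            rw [← Real.rpow_add ht]; norm_num
          norm_num at this ⊢
          linarith
  rw [h1, h2, ← ENNReal.ofReal_add (by positivity) ht.le]
  congr 1
  ring

lemma lintegral_levelKernel_omegaHat {ω : ℝ → ℝ} (hω : IsRadialWeight ω)
    (hpos : ∀ r ∈ Ico (0 : ℝ) 1, 0 < omegaHat ω r) {t : ℝ} (ht : 0 < t) :
    ∫⁻ s in Ioo (0 : ℝ) 1, ENNReal.ofReal (levelKernel t (omegaHat ω s)) * ENNReal.ofReal (ω s) ≤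
      ENNReal.ofReal (3 * t) := by
  rw [lintegral_comp_omegaHat hω hpos (f := fun x => ENNReal.ofReal (levelKernel t x))
    (measurable_levelKernel t).ennreal_ofReal, ← lintegral_levelKernel ht]
  exact lintegral_mono_set fun x hx => hx.1

lemma one_le_levelKernel {t x : ℝ} (hx : 0 < x) (hxt : x ≤ t) : 1 ≤ levelKernel t x := by
  rw [levelKernel, if_pos hxt, Real.rpow_neg hx.le, ← div_eq_mul_inv,
    ← Real.div_rpow (hx.le.trans hxt) hx.le]
  exact Real.one_le_rpow ((one_le_div hx).2 hxt) (by norm_num)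

lemma sq_div_le_levelKernel {t x : ℝ} (ht : 0 < t) (htx : t ≤ x) :
    (t / x) ^ 2 ≤ levelKernel t x := by
  have hx : 0 < x := ht.trans_le htx
  rcases htx.eq_or_lt with rfl | h
  · rw [div_self ht.ne', one_pow]; exact one_le_levelKernel ht le_rfl
  · rw [levelKernel, if_neg (not_le.2 h), Real.rpow_neg hx.le, ← div_eq_mul_inv,
      ← Real.div_rpow ht.le hx.le, Real.rpow_two]

lemma lintegral_min_pow_le {ω : ℝ → ℝ} (hω : IsRadialWeight ω)
    (hpos : ∀ r ∈ Ico (0 : ℝ) 1, 0 < omegaHat ω r) {m : ℕ}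
    (hm : ∀ s r : ℝ, 0 ≤ s → s ≤ r → r < 1 →
      omegaHat ω s ≤ 2 ^ m * ((1 - s) / (1 - r)) ^ m * omegaHat ω r) {r : ℝ}
    (hr : r ∈ Ico (0 : ℝ) 1) :
    ∫⁻ s in Ioo (0 : ℝ) 1, ENNReal.ofReal (min 1 (((1 - r) / (1 - s)) ^ (2 * m))) *
      ENNReal.ofReal (ω s) ≤ ENNReal.ofReal (3 * 4 ^ m * omegaHat ω r) := by
  have ht := hpos r hr
  calc _ ≤ ∫⁻ s in Ioo (0 : ℝ) 1, ENNReal.ofReal (4 ^ m) *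
        (ENNReal.ofReal (levelKernel (omegaHat ω r) (omegaHat ω s)) * ENNReal.ofReal (ω s)) := by
        refine setLIntegral_mono' measurableSet_Ioo fun s hs => ?_
        rw [← mul_assoc, ← ENNReal.ofReal_mul (by positivity : (0 : ℝ) ≤ 4 ^ m)]
        refine mul_le_mul_left (ENNReal.ofReal_le_ofReal ?_) _
        have h4 : (1 : ℝ) ≤ 4 ^ m := one_le_pow₀ (by norm_num)
        have hs' := hpos s ⟨hs.1.le, hs.2⟩
        rcases le_total r s with h | h
        · have := one_le_levelKernel hs' (omegaHat_anti hω hr.1 h hs.2.le)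
          refine (min_le_left _ _).trans ?_
          nlinarith
        · have h1 := hm s r hs.1.le h hr.2
          have h2 := sq_div_le_levelKernel ht (omegaHat_anti hω hs.1.le h hr.2.le)
          refine (min_le_right _ _).trans ?_
          refine le_trans ?_ (mul_le_mul_of_nonneg_left h2 (by positivity))
          have hs1 : 0 < 1 - s := by linarith [hs.2]
          have hr1 : 0 < 1 - r := by linarith [hr.2]
          have h3 : ((1 - r) / (1 - s)) ^ m ≤ 2 ^ m * (omegaHat ω r / omegaHat ω s) := by
            rw [← mul_div_assoc, le_div_iff₀ hs']
            calc _ ≤ ((1 - r) / (1 - s)) ^ m *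
                  (2 ^ m * ((1 - s) / (1 - r)) ^ m * omegaHat ω r) :=
                mul_le_mul_of_nonneg_left h1 (by positivity)
              _ = 2 ^ m * omegaHat ω r * (((1 - r) / (1 - s)) * ((1 - s) / (1 - r))) ^ m := by
                rw [mul_pow]; ring
              _ = _ := by
                rw [div_mul_div_cancel₀ hs1.ne', div_self hr1.ne', one_pow, mul_one]
          calc ((1 - r) / (1 - s)) ^ (2 * m) = (((1 - r) / (1 - s)) ^ m) ^ 2 := by
                rw [mul_comm, pow_mul]
            _ ≤ (2 ^ m * (omegaHat ω r / omegaHat ω s)) ^ 2 := by gcongr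
            _ = _ := by rw [mul_pow, ← pow_mul, mul_comm m 2, pow_mul]; norm_num
    _ ≤ ENNReal.ofReal (4 ^ m) * ENNReal.ofReal (3 * omegaHat ω r) := by
        rw [lintegral_const_mul' _ _ ENNReal.ofReal_ne_top]
        gcongr
        exact lintegral_levelKernel_omegaHat hω hpos ht
    _ = _ := by rw [← ENNReal.ofReal_mul (by positivity)]; congr 1; ring

lemma one_sub_inv_mem (n : ℕ) : 1 - 1 / ((n : ℝ) + 2) ∈ Ico (0 : ℝ) 1 := by
  have h : (0 : ℝ) < n + 2 := by positivity
  have h1 : 1 / ((n : ℝ) + 2) ≤ 1 := by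
    rw [div_le_one h]
    have : (0 : ℝ) ≤ n := n.cast_nonneg
    linarith
  have h2 : 0 < 1 / ((n : ℝ) + 2) := by positivity
  exact ⟨by linarith, by linarith⟩

lemma omegaHat_le_momentCoeff {ω : ℝ → ℝ} (hω : IsRadialWeight ω) (n : ℕ) :
    omegaHat ω (1 - 1 / ((n : ℝ) + 2)) ≤ Real.exp 2 * momentCoeff ω n := by
  obtain ⟨hr0, hr1⟩ := one_sub_inv_mem n
  set r := 1 - 1 / ((n : ℝ) + 2) with hr
  have hn1 : (0 : ℝ) < n + 1 := by positivity
  have hrexp : Real.exp (-(1 / ((n : ℝ) + 1))) ≤ r := by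
    rw [Real.exp_neg]
    have h1 : 1 / ((n : ℝ) + 1) + 1 ≤ Real.exp (1 / ((n : ℝ) + 1)) := Real.add_one_le_exp _
    have h2 : r = (1 / ((n : ℝ) + 1) + 1)⁻¹ := by rw [hr]; field_simp; ring
    rw [h2]
    exact inv_anti₀ (by positivity) h1
  have hpow : Real.exp (-2) ≤ r ^ (2 * n + 1) := by
    calc Real.exp (-2) ≤ Real.exp (((2 * n + 1 : ℕ) : ℝ) * -(1 / ((n : ℝ) + 1))) := by
          refine Real.exp_le_exp.2 ?_
          rw [mul_neg, neg_le_neg_iff, mul_one_div, div_le_iff₀ hn1]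
          push_cast
          linarith
      _ = Real.exp (-(1 / ((n : ℝ) + 1))) ^ (2 * n + 1) := by rw [Real.exp_nat_mul]
      _ ≤ _ := by gcongr
  have hsub : Ioo r 1 ⊆ Ioo 0 1 := fun s hs => ⟨hr0.trans_lt hs.1, hs.2⟩
  have hmain : Real.exp (-2) * omegaHat ω r ≤ momentCoeff ω n := by
    rw [omegaHat_eq hr1.le, momentCoeff_eq, ← integral_const_mul]
    have hintg := integrableOn_pow_mul_weight hω (2 * n + 1)
    calc _ ≤ ∫ s in Ioo r 1, s ^ (2 * n + 1) * ω s := by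
          refine setIntegral_mono_on ?_ (hintg.mono_set hsub) measurableSet_Ioo fun s hs => ?_
          · exact (hω.2.mono_set (hsub.trans Ioo_subset_Ico_self)).const_mul _
          · have := hω.1 s ⟨(hsub hs).1.le, hs.2⟩
            have hs1 : r ^ (2 * n + 1) ≤ s ^ (2 * n + 1) := by
              have := hs.1.le
              gcongr
            gcongr
            exact hpow.trans hs1
      _ ≤ _ := by
          refine setIntegral_mono_set hintg ?_ (Eventually.of_forall hsub)
          exact (ae_restrict_iff' measurableSet_Ioo).2 (Eventually.of_forall fun s hs =>
            mul_nonneg (pow_nonneg hs.1.le _) (hω.1 s ⟨hs.1.le, hs.2⟩))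
  calc omegaHat ω r = Real.exp 2 * (Real.exp (-2) * omegaHat ω r) := by
        rw [← mul_assoc, ← Real.exp_add]; simp
    _ ≤ _ := by gcongr

lemma momentCoeff_pos {ω : ℝ → ℝ} (hω : IsRadialWeight ω)
    (hpos : ∀ r ∈ Ico (0 : ℝ) 1, 0 < omegaHat ω r) (n : ℕ) : 0 < momentCoeff ω n := by
  have h := (hpos _ (one_sub_inv_mem n)).trans_le (omegaHat_le_momentCoeff hω n)
  exact pos_of_mul_pos_right h (Real.exp_pos 2).le

/-- Differences of the moments of a doubling weight. -/
lemma exists_momentCoeff_sub_le {ω : ℝ → ℝ} (hω : IsRadialWeight ω)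
    (hpos : ∀ r ∈ Ico (0 : ℝ) 1, 0 < omegaHat ω r) (hD : InDhat ω) :
    ∃ C > (0 : ℝ), ∀ n : ℕ,
      (n + 2) * (momentCoeff ω n - momentCoeff ω (n + 1)) ≤ C * momentCoeff ω n := by
  obtain ⟨m, -, hm⟩ := InDhat.exists_pow hω hD hpos
  set K : ℝ := 2 ^ (2 * m + 1) * (2 * m + 1).factorial with hK
  have hK0 : 0 < K := by positivity
  refine ⟨2 * K * (3 * 4 ^ m) * Real.exp 2, by positivity, fun n => ?_⟩
  have hr := one_sub_inv_mem n
  set r := 1 - 1 / ((n : ℝ) + 2) with hrdef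
  have hn2 : (0 : ℝ) < n + 2 := by positivity
  have hpt : ∀ s ∈ Ioo (0 : ℝ) 1, (n + 2) * (s ^ (2 * n + 1) * (1 - s ^ 2)) ≤
      2 * K * min 1 (((1 - r) / (1 - s)) ^ (2 * m)) := by
    intro s hs
    have hs1 : 0 < 1 - s := by linarith [hs.2]
    set y := (n + 2) * (1 - s) with hy
    have hy0 : 0 < y := by positivity
    have hexp : s ^ (2 * n + 1) ≤ Real.exp (-(y / 2)) := by
      calc s ^ (2 * n + 1) ≤ Real.exp (-(1 - s)) ^ (2 * n + 1) := by
            have := Real.add_one_le_exp (-(1 - s))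
            have h0 := hs.1.le
            gcongr
            linarith
        _ = Real.exp (((2 * n + 1 : ℕ) : ℝ) * -(1 - s)) := by rw [Real.exp_nat_mul]
        _ ≤ _ := by
            refine Real.exp_le_exp.2 ?_
            push_cast
            rw [hy]
            have : (0 : ℝ) ≤ n := n.cast_nonneg
            nlinarith
    have hyr : (1 - r) / (1 - s) = y⁻¹ := by
      rw [hrdef, hy]; field_simp; ring
    have hpoly : ∀ j : ℕ, y ^ j * Real.exp (-(y / 2)) ≤ 2 ^ j * j.factorial := by
      intro j
      have h := Real.pow_div_factorial_le_exp (x := y / 2) (by positivity) j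
      have hf : (0 : ℝ) < j.factorial := by positivity
      rw [Real.exp_neg, ← div_eq_mul_inv, div_le_iff₀ (Real.exp_pos _)]
      rw [div_pow, div_div, div_le_iff₀ (by positivity)] at h
      linarith
    have hL : (n + 2) * (s ^ (2 * n + 1) * (1 - s ^ 2)) ≤ 2 * (y * Real.exp (-(y / 2))) := by
      calc _ = (y * (1 + s)) * s ^ (2 * n + 1) := by rw [hy]; ring
        _ ≤ (y * 2) * Real.exp (-(y / 2)) := by
            have := hs.1.le
            have := hs.2.le
            gcongr
            linarith
        _ = _ := by ring
    refine hL.trans ?_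
    rw [mul_assoc 2 K]
    refine mul_le_mul_of_nonneg_left ?_ (zero_le_two (α := ℝ))
    rw [mul_min_of_nonneg _ _ hK0.le, mul_one, hyr]
    refine le_min ?_ ?_
    · have h1 := hpoly 1
      norm_num at h1
      have h2 : (2 : ℝ) ≤ K := by
        have h3 : (1 : ℝ) ≤ (2 * m + 1).factorial := by
          exact_mod_cast Nat.succ_le_of_lt (Nat.factorial_pos _)
        have h4 : (2 : ℝ) ≤ 2 ^ (2 * m + 1) := by
          rw [pow_succ]
          have : (1 : ℝ) ≤ 2 ^ (2 * m) := one_le_pow₀ one_le_two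
          linarith
        calc (2 : ℝ) = 2 * 1 := by ring
          _ ≤ K := by rw [hK]; gcongr
      linarith
    · have h1 := hpoly (2 * m + 1)
      rw [inv_pow, ← div_eq_mul_inv, le_div_iff₀ (by positivity)]
      calc _ = y ^ (2 * m + 1) * Real.exp (-(y / 2)) := by ring
        _ ≤ _ := h1
  have hi1 := integrableOn_pow_mul_weight hω (2 * n + 1)
  have hi2 := integrableOn_pow_mul_weight hω (2 * (n + 1) + 1)
  have hmain : ENNReal.ofReal ((n + 2) * (momentCoeff ω n - momentCoeff ω (n + 1))) ≤
      ENNReal.ofReal (2 * K * (3 * 4 ^ m * omegaHat ω r)) := by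
    have hi3 : IntegrableOn (fun s => ((n : ℝ) + 2) *
        (s ^ (2 * n + 1) * ω s - s ^ (2 * (n + 1) + 1) * ω s)) (Ioo 0 1) :=
      (hi1.sub hi2).const_mul _
    rw [momentCoeff_eq, momentCoeff_eq, ← integral_sub hi1 hi2, ← integral_const_mul,
      ofReal_integral_eq_lintegral_ofReal hi3]
    · rw [ENNReal.ofReal_mul (by positivity)]
      refine le_trans ?_ (mul_le_mul_right (lintegral_min_pow_le hω hpos hm hr) _)
      rw [← lintegral_const_mul' _ _ ENNReal.ofReal_ne_top]
      refine setLIntegral_mono' measurableSet_Ioo fun s hs => ?_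
      have hw := hω.1 s ⟨hs.1.le, hs.2⟩
      rw [← mul_assoc, ← ENNReal.ofReal_mul (by positivity), ← ENNReal.ofReal_mul' hw]
      refine ENNReal.ofReal_le_ofReal ?_
      calc _ = (n + 2) * (s ^ (2 * n + 1) * (1 - s ^ 2)) * ω s := by ring
        _ ≤ _ := mul_le_mul_of_nonneg_right (hpt s hs) hw
    · refine (ae_restrict_iff' measurableSet_Ioo).2 (Eventually.of_forall fun s hs => ?_)
      have hw := hω.1 s ⟨hs.1.le, hs.2⟩
      have h1 : s ^ (2 * (n + 1) + 1) ≤ s ^ (2 * n + 1) :=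
        pow_le_pow_of_le_one hs.1.le hs.2.le (by omega)
      have h2 : 0 ≤ s ^ (2 * n + 1) * ω s - s ^ (2 * (n + 1) + 1) * ω s := by
        rw [← sub_mul]; exact mul_nonneg (by linarith) hw
      exact mul_nonneg hn2.le h2
  have hW := hpos r hr
  rw [ENNReal.ofReal_le_ofReal_iff (by positivity)] at hmain
  refine hmain.trans ?_
  calc 2 * K * (3 * 4 ^ m * omegaHat ω r)
      ≤ 2 * K * (3 * 4 ^ m * (Real.exp 2 * momentCoeff ω n)) := by
        gcongr; exact omegaHat_le_momentCoeff hω n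
    _ = _ := by ring

/-- Lower bound for the moments of a doubling weight in terms of its tail. -/
lemma exists_omegaHat_le_mul_momentCoeff {ω : ℝ → ℝ} (hω : IsRadialWeight ω)
    (hpos : ∀ r ∈ Ico (0 : ℝ) 1, 0 < omegaHat ω r) (hD : InDhat ω) :
    ∃ C > (0 : ℝ), ∃ m : ℕ, ∀ ρ ∈ Ico (0 : ℝ) 1, ∀ n : ℕ,
      omegaHat ω ρ ≤ C * (1 + ((1 - ρ) * (n + 2)) ^ m) * momentCoeff ω n := by
  obtain ⟨m, -, hm⟩ := InDhat.exists_pow hω hD hpos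
  refine ⟨2 ^ m * Real.exp 2, by positivity, m, fun ρ hρ n => ?_⟩
  have hr := one_sub_inv_mem n
  have h1 := omegaHat_le_momentCoeff hω n
  set r := 1 - 1 / ((n : ℝ) + 2) with hrdef
  have ha := momentCoeff_nonneg hω n
  have h2 : (1 : ℝ) ≤ 2 ^ m := one_le_pow₀ one_le_two
  have hρ1 : 0 < 1 - ρ := by linarith [hρ.2]
  have h3 : 0 ≤ ((1 - ρ) * (n + 2)) ^ m := by positivity
  have hmain : omegaHat ω ρ ≤ 2 ^ m * (1 + ((1 - ρ) * (n + 2)) ^ m) * omegaHat ω r := by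
    have hW := (hpos r hr).le
    rcases le_total ρ r with h | h
    · have h4 := hm ρ r hρ.1 h hr.2
      have h5 : (1 - ρ) / (1 - r) = (1 - ρ) * (n + 2) := by rw [hrdef]; field_simp; ring
      rw [h5] at h4
      refine h4.trans ?_
      gcongr
      linarith
    · refine (omegaHat_anti hω hr.1 h hρ.2.le).trans ?_
      refine le_mul_of_one_le_left hW ?_
      nlinarith
  calc _ ≤ _ := hmain
    _ ≤ 2 ^ m * (1 + ((1 - ρ) * (n + 2)) ^ m) * (Real.exp 2 * momentCoeff ω n) := by gcongr
    _ = _ := by ring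

/-- The test function `z (1 - w̄ z)^{-β}`. -/
def testF (β : ℕ) (w z : ℂ) : ℂ := z * ((1 - (starRingEnd ℂ) w * z)⁻¹) ^ β

lemma one_sub_conj_mul_ne_zero {w z : ℂ} (hw : ‖w‖ < 1) (hz : ‖z‖ ≤ 1) :
    1 - (starRingEnd ℂ) w * z ≠ 0 := by
  intro h
  have h1 : ‖(starRingEnd ℂ) w * z‖ = 1 := by rw [← sub_eq_zero.1 h]; simp
  rw [norm_mul, RCLike.norm_conj] at h1
  have := mul_le_of_le_one_right (norm_nonneg w) hz
  linarith

lemma differentiableOn_testF (β : ℕ) {w : ℂ} (hw : ‖w‖ < 1) :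
    DifferentiableOn ℂ (testF β w) (Metric.ball 0 1) := by
  intro z hz
  have := one_sub_conj_mul_ne_zero hw (mem_ball_zero_iff.1 hz).le
  unfold testF
  fun_prop (disch := assumption)

lemma norm_one_sub_conj_mul_circlePt (w : ℂ) (s θ : ℝ) :
    ‖1 - (starRingEnd ℂ) w * circlePt s θ‖ = ‖circlePt 1 θ - s * w‖ := by
  have h1 : circlePt 1 θ * (starRingEnd ℂ) (circlePt 1 θ) = 1 := by
    rw [Complex.mul_conj, Complex.normSq_eq_norm_sq, norm_circlePt_one]; norm_num
  have h2 : (starRingEnd ℂ) (1 - (starRingEnd ℂ) w * circlePt s θ) * circlePt 1 θ =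
      circlePt 1 θ - s * w := by
    rw [circlePt_eq_mul s, map_sub, map_mul, map_mul, Complex.conj_conj, Complex.conj_ofReal,
      map_one]
    linear_combination -(s * w) * h1
  rw [← h2, norm_mul, norm_circlePt_one, mul_one, RCLike.norm_conj]

lemma lintegral_testF_le {p : ℝ} {β : ℕ} (hp : 0 < p) (hβ : 2 ≤ β * p) {w : ℂ} (hw : ‖w‖ < 1)
    {s : ℝ} (h0 : 0 ≤ s) (h1 : s < 1) :
    ∫⁻ θ, ENNReal.ofReal (‖testF β w (circlePt s θ)‖ ^ p) ∂circMeas ≤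
      ENNReal.ofReal ((1 - s * ‖w‖) ^ (1 - β * p)) := by
  set x := s * ‖w‖ with hx
  have hx0 : 0 ≤ x := by positivity
  have hx1 : x < 1 := (mul_le_of_le_one_left (norm_nonneg w) h1.le).trans_lt hw
  have hu : ‖(s : ℂ) * w‖ = x := by rw [norm_mul, Complex.norm_real, Real.norm_of_nonneg h0]
  have hu1 : ‖(s : ℂ) * w‖ < 1 := hu ▸ hx1
  have hpt : ∀ θ, ‖testF β w (circlePt s θ)‖ ^ p ≤
      (1 - x) ^ (1 - β * p) * poissonKernel 0 ((s : ℂ) * w) (circlePt 1 θ) := by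
    intro θ
    set y := ‖circlePt 1 θ - s * w‖ with hy
    have hyx : 1 - x ≤ y := by
      have := norm_sub_norm_le (circlePt 1 θ) (s * w)
      rwa [norm_circlePt_one, hu] at this
    have hx1' : 0 < 1 - x := by linarith
    have hy0 : 0 < y := by linarith
    have e1 : ‖testF β w (circlePt s θ)‖ ≤ (y ^ β)⁻¹ := by
      rw [testF, norm_mul, norm_pow, norm_inv, norm_one_sub_conj_mul_circlePt, norm_circlePt,
        abs_of_nonneg h0, inv_pow]
      exact mul_le_of_le_one_left (by positivity) h1.le
    calc _ ≤ ((y ^ β)⁻¹) ^ p := by gcongr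
      _ = y ^ (-2 : ℝ) * y ^ (2 - β * p) := by
          rw [← Real.rpow_add hy0, Real.inv_rpow (by positivity), ← Real.rpow_natCast,
            ← Real.rpow_mul hy0.le, ← Real.rpow_neg hy0.le]
          congr 1; ring
      _ ≤ y ^ (-2 : ℝ) * (1 - x) ^ (2 - β * p) := by
          have := Real.rpow_le_rpow_of_nonpos hx1' hyx (by linarith : 2 - β * p ≤ 0)
          gcongr
      _ = (1 - x) ^ (1 - β * p) * ((1 - x) * y ^ (-2 : ℝ)) := by
          have : (1 - x) ^ (2 - β * p) = (1 - x) ^ (1 - β * p) * (1 - x) := by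
            rw [← Real.rpow_add_one hx1'.ne']; congr 1; ring
          rw [this]; ring
      _ ≤ _ := by
          have h2 : (1 - x) * y ^ (-2 : ℝ) ≤ poissonKernel 0 ((s : ℂ) * w) (circlePt 1 θ) := by
            rw [poissonKernel_zero_apply, ← hy, hu, norm_circlePt_one, Real.rpow_neg hy0.le,
              Real.rpow_two, ← div_eq_mul_inv]
            exact div_le_div_of_nonneg_right (by nlinarith) (by positivity)
          have : 0 ≤ (1 - x) ^ (1 - β * p) := by positivity
          gcongr
  calc _ ≤ ∫⁻ θ, ENNReal.ofReal ((1 - x) ^ (1 - β * p) *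
        poissonKernel 0 ((s : ℂ) * w) (circlePt 1 θ)) ∂circMeas :=
        lintegral_mono fun θ => ENNReal.ofReal_le_ofReal (hpt θ)
    _ = _ := by
        have hx1' : 0 ≤ 1 - x := by linarith
        rw [← ofReal_integral_eq_lintegral_ofReal, integral_const_mul, integral_poissonKernel hu1,
          mul_one]
        · exact (integrable_circMeas_of_continuous
            (continuous_poissonKernel_circlePt hu1)).const_mul _
        · exact Eventually.of_forall fun θ =>
            mul_nonneg (by positivity) (poissonKernel_circlePt_nonneg hu1 θ)

/-- Weighted Jensen inequality. -/
lemma rpow_sum_mul_le {ι : Type*} (S : Finset ι) {Q : ℝ} (hQ : 1 ≤ Q) {a l : ι → ℝ}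
    (ha : ∀ i, 0 ≤ a i) (hl : ∀ i, 0 < l i) :
    (∑ i ∈ S, a i) ^ Q ≤ (∑ i ∈ S, l i) ^ (Q - 1) * ∑ i ∈ S, a i ^ Q * l i ^ (1 - Q) := by
  have hQ0 : 0 < Q := by linarith
  have h := Real.inner_le_weight_mul_Lp_of_nonneg S hQ l (fun i => a i / l i)
    (fun i => (hl i).le) (fun i => div_nonneg (ha i) (hl i).le)
  have h1 : ∀ i, l i * (a i / l i) = a i := fun i => mul_div_cancel₀ _ (hl i).ne'
  have h2 : ∀ i, l i * (a i / l i) ^ Q = a i ^ Q * l i ^ (1 - Q) := fun i => by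
    rw [Real.div_rpow (ha i) (hl i).le, Real.rpow_sub (hl i), Real.rpow_one]; ring
  simp only [h1, h2] at h
  have hs1 : 0 ≤ ∑ i ∈ S, l i := Finset.sum_nonneg fun i _ => (hl i).le
  have hs2 : 0 ≤ ∑ i ∈ S, a i ^ Q * l i ^ (1 - Q) := Finset.sum_nonneg fun i _ =>
    mul_nonneg (Real.rpow_nonneg (ha i) _) (Real.rpow_nonneg (hl i).le _)
  calc _ ≤ _ := Real.rpow_le_rpow (Finset.sum_nonneg fun i _ => ha i) h hQ0.le
    _ = _ := by
      rw [Real.mul_rpow (by positivity) (by positivity), ← Real.rpow_mul hs1, ← Real.rpow_mul hs2,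
        inv_mul_cancel₀ hQ0.ne', Real.rpow_one]
      congr 2
      field_simp

/-- The dyadic level of `y` in `(0, 1]`. -/
lemma exists_level {y : ℝ} (h0 : 0 < y) (h1 : y ≤ 1) :
    ∃ j : ℕ, (1 / 2 : ℝ) ^ (j + 1) < y ∧ y ≤ (1 / 2) ^ j :=
  exists_nat_pow_near_of_lt_one h0 h1 (by norm_num) (by norm_num)

/-- Off-diagonal decay is summable over dyadic levels. -/
lemma sum_min_rpow_le {ε : ℝ} (hε : 0 < ε) : ∃ C > (0 : ℝ), ∀ (S : Finset ℕ) (y : ℕ → ℝ) (x : ℝ),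
    (∀ k ∈ S, (1 / 2 : ℝ) ^ (k + 1) < y k ∧ y k ≤ (1 / 2) ^ k) → 0 < x → x ≤ 1 →
    ∑ k ∈ S, min (y k / x) (x / y k) ^ ε ≤ C := by
  set δ : ℝ := (1 / 2) ^ ε with hδ
  have hδ0 : 0 < δ := by positivity
  have hδ1 : δ < 1 := Real.rpow_lt_one (by norm_num) (by norm_num) hε
  have hgeo : ∀ T : Finset ℕ, ∑ i ∈ T, δ ^ i ≤ (1 - δ)⁻¹ := fun T => by
    rw [← tsum_geometric_of_lt_one hδ0.le hδ1]
    exact (summable_geometric_of_lt_one hδ0.le hδ1).sum_le_tsum T fun i _ => by positivity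
  refine ⟨2 ^ ε * (2 * (1 - δ)⁻¹), by
    have : 0 < 1 - δ := by linarith
    positivity, fun S y x hy hx0 hx1 => ?_⟩
  obtain ⟨j, hj1, hj2⟩ := exists_level hx0 hx1
  have hpow : ∀ i : ℕ, ((1 / 2 : ℝ) ^ i) ^ ε = δ ^ i := fun i => by
    rw [← Real.rpow_natCast, ← Real.rpow_mul (by norm_num), mul_comm, Real.rpow_mul (by norm_num),
      Real.rpow_natCast]
  have key : ∀ a b : ℝ, ∀ m n : ℕ, n ≤ m → 0 < a → 0 < b → a ≤ (1 / 2) ^ m →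
      (1 / 2 : ℝ) ^ (n + 1) < b → (a / b) ^ ε ≤ 2 ^ ε * δ ^ (m - n) := by
    intro a b m n hnm ha hb h1 h2
    rw [← hpow, ← Real.mul_rpow zero_le_two (by positivity)]
    refine Real.rpow_le_rpow (by positivity) ?_ hε.le
    rw [div_le_iff₀ hb]
    calc a ≤ (1 / 2) ^ m := h1
      _ = 2 * (1 / 2) ^ (m - n) * (1 / 2) ^ (n + 1) := by
        rw [pow_succ]
        have : (1 / 2 : ℝ) ^ m = (1 / 2) ^ (m - n) * (1 / 2) ^ n := by
          rw [← pow_add, Nat.sub_add_cancel hnm]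
        rw [this]; ring
      _ ≤ _ := by gcongr
  rw [← Finset.sum_filter_add_sum_filter_not S (fun k => j ≤ k)]
  have hA : ∑ k ∈ S with j ≤ k, min (y k / x) (x / y k) ^ ε ≤ 2 ^ ε * (1 - δ)⁻¹ := by
    calc _ ≤ ∑ k ∈ S with j ≤ k, 2 ^ ε * δ ^ (k - j) := by
          refine Finset.sum_le_sum fun k hk => ?_
          rw [Finset.mem_filter] at hk
          have hyk := hy k hk.1
          have hy0 : 0 < y k := lt_trans (by positivity) hyk.1
          exact (Real.rpow_le_rpow (by positivity) (min_le_left _ _) hε.le).trans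
            (key _ _ k j hk.2 hy0 hx0 hyk.2 hj1)
      _ = 2 ^ ε * ∑ i ∈ (S.filter fun k => j ≤ k).image (fun k => k - j), δ ^ i := by
          rw [← Finset.mul_sum, Finset.sum_image]
          intro a ha b hb hab
          have h1 := (Finset.mem_filter.1 ha).2
          have h2 := (Finset.mem_filter.1 hb).2
          simp only at hab
          omega
      _ ≤ _ := by gcongr; exact hgeo _
  have hB : ∑ k ∈ S with ¬ j ≤ k, min (y k / x) (x / y k) ^ ε ≤ 2 ^ ε * (1 - δ)⁻¹ := by
    calc _ ≤ ∑ k ∈ S with ¬ j ≤ k, 2 ^ ε * δ ^ (j - k) := by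
          refine Finset.sum_le_sum fun k hk => ?_
          rw [Finset.mem_filter] at hk
          have hyk := hy k hk.1
          have hy0 : 0 < y k := lt_trans (by positivity) hyk.1
          exact (Real.rpow_le_rpow (by positivity) (min_le_right _ _) hε.le).trans
            (key _ _ j k (by omega) hx0 hy0 hj2 hyk.1)
      _ = 2 ^ ε * ∑ i ∈ (S.filter fun k => ¬ j ≤ k).image (fun k => j - k), δ ^ i := by
          rw [← Finset.mul_sum, Finset.sum_image]
          intro a ha b hb hab
          have h1 := (Finset.mem_filter.1 ha).2
          have h2 := (Finset.mem_filter.1 hb).2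
          simp only at hab
          omega
      _ ≤ _ := by gcongr; exact hgeo _
  linarith

lemma norm_sum_rpow_le {ι : Type*} (S : Finset ι) {p : ℝ} (h0 : 0 < p) (h1 : p ≤ 1) (u : ι → ℂ) :
    ‖∑ i ∈ S, u i‖ ^ p ≤ ∑ i ∈ S, ‖u i‖ ^ p := by
  classical
  induction S using Finset.induction_on with
  | empty => simp [h0.ne']
  | insert a S ha ih =>
    rw [Finset.sum_insert ha, Finset.sum_insert ha]
    calc _ ≤ (‖u a‖ + ‖∑ i ∈ S, u i‖) ^ p := by gcongr; exact norm_add_le _ _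
      _ ≤ ‖u a‖ ^ p + ‖∑ i ∈ S, u i‖ ^ p :=
        Real.rpow_add_le_add_rpow (norm_nonneg _) (norm_nonneg _) h0.le h1
      _ ≤ _ := by gcongr

lemma rpow_mul_min_rpow_le_levelKernel {ω : ℝ → ℝ} (hω : IsRadialWeight ω)
    (hpos : ∀ r ∈ Ico (0 : ℝ) 1, 0 < omegaHat ω r) {m : ℕ}
    (hm : ∀ s r : ℝ, 0 ≤ s → s ≤ r → r < 1 →
      omegaHat ω s ≤ 2 ^ m * ((1 - s) / (1 - r)) ^ m * omegaHat ω r) {B : ℝ} (hB : 3 * m ≤ B)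
    {s ρ : ℝ} (hs : s ∈ Ico (0 : ℝ) 1) (hρ : ρ ∈ Ico (0 : ℝ) 1) :
    ((1 - ρ) / (1 - s * ρ)) ^ B *
      min (omegaHat ω ρ / omegaHat ω s) (omegaHat ω s / omegaHat ω ρ) ^ (-(1 / 2) : ℝ) ≤
      8 ^ m * levelKernel (omegaHat ω ρ) (omegaHat ω s) := by
  have ht := hpos ρ hρ
  have hx := hpos s hs
  have hs1 : 0 < 1 - s := by linarith [hs.2]
  have hρ1 : 0 < 1 - ρ := by linarith [hρ.2]
  have hsρ : 1 - ρ ≤ 1 - s * ρ := by nlinarith [hs.2, hρ.1]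
  have hsρ' : 1 - s ≤ 1 - s * ρ := by nlinarith [hρ.2, hs.1]
  have h10 : 0 < 1 - s * ρ := by linarith
  have hr0 : 0 < (1 - ρ) / (1 - s * ρ) := by positivity
  have hr1 : (1 - ρ) / (1 - s * ρ) ≤ 1 := (div_le_one h10).2 hsρ
  have h8 : (1 : ℝ) ≤ 8 ^ m := one_le_pow₀ (by norm_num)
  have hB0 : 0 ≤ B := le_trans (by positivity) hB
  set t := omegaHat ω ρ
  set x := omegaHat ω s
  rcases le_or_gt x t with h | h
  · have e1 : min (t / x) (x / t) = x / t :=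
      min_eq_right (((div_le_one ht).2 h).trans ((one_le_div hx).2 h))
    have e2 : (x / t) ^ (-(1 / 2) : ℝ) = levelKernel t x := by
      rw [levelKernel, if_pos h, Real.div_rpow hx.le ht.le, Real.rpow_neg ht.le, div_inv_eq_mul,
        mul_comm]
    rw [e1, e2]
    have h3 : 0 ≤ levelKernel t x := zero_le_one.trans (one_le_levelKernel hx h)
    have h4 : ((1 - ρ) / (1 - s * ρ)) ^ B ≤ 1 := Real.rpow_le_one hr0.le hr1 hB0
    gcongr
    exact h4.trans h8
  · have hsr : s ≤ ρ := by
      by_contra hc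
      exact absurd (omegaHat_anti hω hρ.1 (not_le.1 hc).le hs.2.le) (not_le.2 h)
    have hy0 : 0 < t / x := by positivity
    have hy1 : t / x ≤ 1 := (div_le_one hx).2 h.le
    have e1 : min (t / x) (x / t) = t / x := min_eq_left (hy1.trans ((one_le_div ht).2 h.le))
    have e2 : (t / x) ^ (2 : ℝ) = levelKernel t x := by
      rw [levelKernel, if_neg (not_le.2 h), Real.div_rpow ht.le hx.le, Real.rpow_neg hx.le,
        div_eq_mul_inv]
    rw [e1, ← e2]
    have h3 : ((1 - ρ) / (1 - s * ρ)) ^ m ≤ 2 ^ m * (t / x) := by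
      calc _ ≤ ((1 - ρ) / (1 - s)) ^ m := by gcongr
        _ ≤ 2 ^ m * (t / x) := by
          rw [← mul_div_assoc, le_div_iff₀ hx]
          calc _ ≤ ((1 - ρ) / (1 - s)) ^ m * (2 ^ m * ((1 - s) / (1 - ρ)) ^ m * t) :=
                mul_le_mul_of_nonneg_left (hm s ρ hs.1 hsr hρ.2) (by positivity)
            _ = 2 ^ m * t * (((1 - ρ) / (1 - s)) * ((1 - s) / (1 - ρ))) ^ m := by
              rw [mul_pow]; ring
            _ = _ := by rw [div_mul_div_cancel₀ hs1.ne', div_self hρ1.ne', one_pow, mul_one]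
    have h4 : ((1 - ρ) / (1 - s * ρ)) ^ B ≤ 8 ^ m * (t / x) ^ (3 : ℝ) := by
      calc _ ≤ ((1 - ρ) / (1 - s * ρ)) ^ (3 * m : ℝ) :=
            Real.rpow_le_rpow_of_exponent_ge hr0 hr1 hB
        _ = (((1 - ρ) / (1 - s * ρ)) ^ m) ^ 3 := by
            rw [← pow_mul, ← Real.rpow_natCast]; congr 1; push_cast; ring
        _ ≤ (2 ^ m * (t / x)) ^ 3 := by gcongr
        _ = _ := by
            rw [mul_pow, ← pow_mul, mul_comm m 3, pow_mul, ← Real.rpow_natCast (t / x)]; norm_num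
    calc _ ≤ 8 ^ m * (t / x) ^ (3 : ℝ) * (t / x) ^ (-(1 / 2) : ℝ) := by gcongr
      _ = 8 ^ m * (t / x) ^ (3 + -(1 / 2) : ℝ) := by rw [mul_assoc, Real.rpow_add hy0]
      _ ≤ _ := by
        gcongr 8 ^ m * ?_
        exact Real.rpow_le_rpow_of_exponent_ge hy0 hy1 (by norm_num)

/-- The norm of a combination of test functions located at different levels. -/
lemma exists_LpqNormE_sum_testF_le {ω : ℝ → ℝ} (hω : IsRadialWeight ω)
    (hpos : ∀ r ∈ Ico (0 : ℝ) 1, 0 < omegaHat ω r) {m : ℕ}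
    (hm : ∀ s r : ℝ, 0 ≤ s → s ≤ r → r < 1 →
      omegaHat ω s ≤ 2 ^ m * ((1 - s) / (1 - r)) ^ m * omegaHat ω r) {p q b : ℝ} {β : ℕ}
    (hp0 : 0 < p) (hp1 : p < 1) (hq : 1 < q) (hβ : 2 ≤ β * p) (hb : b = β - 1 / p)
    (hbm : 3 * m ≤ b) :
    ∃ C > (0 : ℝ), ∀ (S : Finset ℕ) (w c : ℕ → ℂ), (∀ k, ‖w k‖ < 1) →
      (∀ k ∈ S, (1 / 2 : ℝ) ^ (k + 1) < omegaHat ω ‖w k‖ / omegaHat ω 0 ∧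
        omegaHat ω ‖w k‖ / omegaHat ω 0 ≤ (1 / 2) ^ k) →
      LpqNormE ω p q (fun z => ∑ k ∈ S, c k * (((1 - ‖w k‖) ^ b : ℝ) : ℂ) * testF β (w k) z) ^ q ≤
        ENNReal.ofReal (C * ∑ k ∈ S, omegaHat ω ‖w k‖ * ‖c k‖ ^ q) := by
  set Q := q / p with hQ
  have hq0 : 0 < q := by linarith
  have hQ1 : 1 < Q := by rw [hQ, lt_div_iff₀ hp0]; linarith
  have hQ0 : 0 < Q := by linarith
  set ε := 1 / (2 * (Q - 1)) with hε
  have hε0 : 0 < ε := by have : 0 < Q - 1 := by linarith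
                         positivity
  obtain ⟨C, hC0, hC⟩ := sum_min_rpow_le hε0
  have hW0 := hpos 0 ⟨le_rfl, one_pos⟩
  have hb0 : 0 ≤ b := le_trans (by positivity) hbm
  have hbq : 3 * m ≤ b * q := by nlinarith
  refine ⟨C ^ (Q - 1) * 8 ^ m * 3, by positivity, fun S w c hw hlev => ?_⟩
  set f : ℂ → ℂ := fun z => ∑ k ∈ S, c k * (((1 - ‖w k‖) ^ b : ℝ) : ℂ) * testF β (w k) z with hf
  have hwk : ∀ k, ‖w k‖ ∈ Ico (0 : ℝ) 1 := fun k => ⟨norm_nonneg _, hw k⟩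
  have ht : ∀ k, 0 < omegaHat ω ‖w k‖ := fun k => hpos _ (hwk k)
  have hw1 : ∀ k, 0 < 1 - ‖w k‖ := fun k => by linarith [hw k]
  have hpt : ∀ s ∈ Ioo (0 : ℝ) 1, MpE p s f ^ q ≤ ENNReal.ofReal (∑ k ∈ S,
      (C ^ (Q - 1) * 8 ^ m * ‖c k‖ ^ q) * levelKernel (omegaHat ω ‖w k‖) (omegaHat ω s)) := by
    intro s hs
    have hs' : s ∈ Ico (0 : ℝ) 1 := ⟨hs.1.le, hs.2⟩
    have hx := hpos s hs'
    set a : ℕ → ℝ := fun k =>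
      (‖c k‖ * (1 - ‖w k‖) ^ b) ^ p * (1 - s * ‖w k‖) ^ (1 - β * p) with ha
    have h1s : ∀ k, 0 < 1 - s * ‖w k‖ := fun k => by
      have := mul_le_of_le_one_left (norm_nonneg (w k)) hs.2.le
      linarith [hw k]
    have ha0 : ∀ k, 0 ≤ a k := fun k => by
      have := (hw1 k).le; have := (h1s k).le
      positivity
    have hI : ∫⁻ θ, ENNReal.ofReal (‖f (circlePt s θ)‖ ^ p) ∂circMeas ≤
        ENNReal.ofReal (∑ k ∈ S, a k) := by
      have hmeas : ∀ k, Measurable fun θ =>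
          ENNReal.ofReal (‖testF β (w k) (circlePt s θ)‖ ^ p) := fun k =>
        (((continuous_circle_dilate (differentiableOn_testF β (hw k)) hs.1.le
          hs.2).norm.measurable).pow_const p).ennreal_ofReal
      calc _ ≤ ∫⁻ θ, ∑ k ∈ S, ENNReal.ofReal ((‖c k‖ * (1 - ‖w k‖) ^ b) ^ p) *
            ENNReal.ofReal (‖testF β (w k) (circlePt s θ)‖ ^ p) ∂circMeas := by
            refine lintegral_mono fun θ => ?_
            refine (ENNReal.ofReal_le_ofReal (norm_sum_rpow_le S hp0 hp1.le _)).trans (le_of_eq ?_)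
            rw [ENNReal.ofReal_sum_of_nonneg fun k _ => by positivity]
            refine Finset.sum_congr rfl fun k _ => ?_
            have := (hw1 k).le
            rw [norm_mul, norm_mul, Complex.norm_real, Real.norm_of_nonneg (by positivity),
              Real.mul_rpow (by positivity) (by positivity), ENNReal.ofReal_mul (by positivity)]
        _ = ∑ k ∈ S, ENNReal.ofReal ((‖c k‖ * (1 - ‖w k‖) ^ b) ^ p) *
            ∫⁻ θ, ENNReal.ofReal (‖testF β (w k) (circlePt s θ)‖ ^ p) ∂circMeas := by
            rw [lintegral_finsetSum S fun k _ => (hmeas k).const_mul _]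
            refine Finset.sum_congr rfl fun k _ => ?_
            rw [lintegral_const_mul' _ _ ENNReal.ofReal_ne_top]
        _ ≤ ∑ k ∈ S, ENNReal.ofReal ((‖c k‖ * (1 - ‖w k‖) ^ b) ^ p) *
            ENNReal.ofReal ((1 - s * ‖w k‖) ^ (1 - β * p)) := by
            gcongr with k _
            exact lintegral_testF_le hp0 hβ (hw k) hs.1.le hs.2
        _ = _ := by
            rw [ENNReal.ofReal_sum_of_nonneg fun k _ => ha0 k]
            refine Finset.sum_congr rfl fun k _ => ?_
            have := (hw1 k).le
            rw [← ENNReal.ofReal_mul (by positivity)]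
    set l : ℕ → ℝ := fun k => min (omegaHat ω ‖w k‖ / omegaHat ω s)
      (omegaHat ω s / omegaHat ω ‖w k‖) ^ ε with hl
    have hmin0 : ∀ k, 0 < min (omegaHat ω ‖w k‖ / omegaHat ω s)
        (omegaHat ω s / omegaHat ω ‖w k‖) := fun k => by
      have := ht k
      positivity
    have hl0 : ∀ k, 0 < l k := fun k => Real.rpow_pos_of_pos (hmin0 k) _
    have hlC : ∑ k ∈ S, l k ≤ C := by
      have := hC S (fun k => omegaHat ω ‖w k‖ / omegaHat ω 0) (omegaHat ω s / omegaHat ω 0) hlev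
        (by positivity) ((div_le_one hW0).2 (omegaHat_anti hω le_rfl hs.1.le hs.2.le))
      simpa only [div_div_div_cancel_right₀ hW0.ne'] using this
    have hterm : ∀ k, a k ^ Q * l k ^ (1 - Q) ≤
        8 ^ m * ‖c k‖ ^ q * levelKernel (omegaHat ω ‖w k‖) (omegaHat ω s) := by
      intro k
      have h0 := (hw1 k).le
      have h0' := (h1s k).le
      have e1 : l k ^ (1 - Q) = min (omegaHat ω ‖w k‖ / omegaHat ω s)
          (omegaHat ω s / omegaHat ω ‖w k‖) ^ (-(1 / 2) : ℝ) := by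
        rw [hl, ← Real.rpow_mul (hmin0 k).le]
        congr 1
        rw [hε]
        have : Q - 1 ≠ 0 := by linarith
        field_simp
        ring
      have e2 : a k ^ Q = ‖c k‖ ^ q * ((1 - ‖w k‖) / (1 - s * ‖w k‖)) ^ (b * q) := by
        rw [ha]
        simp only
        rw [Real.mul_rpow (by positivity) (by positivity), ← Real.rpow_mul (by positivity),
          ← Real.rpow_mul h0', Real.mul_rpow (by positivity) (by positivity),
          ← Real.rpow_mul h0, Real.div_rpow h0 h0', div_eq_mul_inv, ← Real.rpow_neg h0']
        have e3 : p * Q = q := by rw [hQ]; field_simp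
        have e4 : (1 - β * p) * Q = -(b * q) := by rw [hQ, hb]; field_simp; ring
        rw [e3, e4]
        ring
      rw [e1, e2, mul_assoc, mul_comm (8 ^ m), mul_assoc]
      refine mul_le_mul_of_nonneg_left ?_ (by positivity)
      exact rpow_mul_min_rpow_le_levelKernel hω hpos hm hbq hs' (hwk k)
    calc MpE p s f ^ q = (∫⁻ θ, ENNReal.ofReal (‖f (circlePt s θ)‖ ^ p) ∂circMeas) ^ Q := by
          rw [MpE_eq, ← ENNReal.rpow_mul, hQ]; congr 1; ring
      _ ≤ (ENNReal.ofReal (∑ k ∈ S, a k)) ^ Q := by gcongr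
      _ = ENNReal.ofReal ((∑ k ∈ S, a k) ^ Q) :=
          ENNReal.ofReal_rpow_of_nonneg (Finset.sum_nonneg fun k _ => ha0 k) hQ0.le
      _ ≤ _ := by
          refine ENNReal.ofReal_le_ofReal ?_
          calc _ ≤ _ := rpow_sum_mul_le S hQ1.le ha0 hl0
            _ ≤ C ^ (Q - 1) * ∑ k ∈ S, 8 ^ m * ‖c k‖ ^ q *
                levelKernel (omegaHat ω ‖w k‖) (omegaHat ω s) := by
                have h1 : (∑ k ∈ S, l k) ^ (Q - 1) ≤ C ^ (Q - 1) :=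
                  Real.rpow_le_rpow (Finset.sum_nonneg fun k _ => (hl0 k).le) hlC (by linarith)
                have h2 : 0 ≤ ∑ k ∈ S, a k ^ Q * l k ^ (1 - Q) :=
                  Finset.sum_nonneg fun k _ => mul_nonneg (Real.rpow_nonneg (ha0 k) _)
                    (Real.rpow_nonneg (hl0 k).le _)
                exact mul_le_mul h1 (Finset.sum_le_sum fun k _ => hterm k) h2 (by positivity)
            _ = _ := by
                rw [Finset.mul_sum]
                refine Finset.sum_congr rfl fun k _ => ?_
                ring
  have hker0 : ∀ k s, 0 ≤ omegaHat ω s → 0 ≤ levelKernel (omegaHat ω ‖w k‖) (omegaHat ω s) := by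
    intro k s hs
    have := (ht k).le
    unfold levelKernel
    split_ifs <;> positivity
  rw [LpqNormE, ← ENNReal.rpow_mul, one_div_mul_cancel hq0.ne', ENNReal.rpow_one]
  calc _ ≤ ∫⁻ s in Ioo (0 : ℝ) 1, ∑ k ∈ S, ENNReal.ofReal (C ^ (Q - 1) * 8 ^ m * ‖c k‖ ^ q) *
        (ENNReal.ofReal (levelKernel (omegaHat ω ‖w k‖) (omegaHat ω s)) *
          ENNReal.ofReal (ω s)) := by
        refine setLIntegral_mono' measurableSet_Ioo fun s hs => ?_
        have hw' := hω.1 s ⟨hs.1.le, hs.2⟩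
        have h1 : s * ω s ≤ ω s := mul_le_of_le_one_left hw' hs.2.le
        refine (mul_le_mul' (hpt s hs) (ENNReal.ofReal_le_ofReal h1)).trans (le_of_eq ?_)
        have hx := (hpos s ⟨hs.1.le, hs.2⟩).le
        rw [ENNReal.ofReal_sum_of_nonneg fun k _ =>
          mul_nonneg (by positivity) (hker0 k s hx), Finset.sum_mul]
        refine Finset.sum_congr rfl fun k _ => ?_
        rw [ENNReal.ofReal_mul (by positivity), mul_assoc]
    _ = ∑ k ∈ S, ENNReal.ofReal (C ^ (Q - 1) * 8 ^ m * ‖c k‖ ^ q) *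
        ∫⁻ s in Ioo (0 : ℝ) 1, ENNReal.ofReal (levelKernel (omegaHat ω ‖w k‖) (omegaHat ω s)) *
          ENNReal.ofReal (ω s) := by
        rw [lintegral_finsetSum']
        · refine Finset.sum_congr rfl fun k _ => ?_
          rw [lintegral_const_mul' _ _ ENNReal.ofReal_ne_top]
        · intro k _
          refine AEMeasurable.const_mul
            (AEMeasurable.mul ?_ (aemeasurable_weight hω).ennreal_ofReal) _
          exact ((measurable_levelKernel _).comp_aemeasurable
            (aemeasurable_omegaHat hω)).ennreal_ofReal
    _ ≤ ∑ k ∈ S, ENNReal.ofReal (C ^ (Q - 1) * 8 ^ m * ‖c k‖ ^ q) *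
        ENNReal.ofReal (3 * omegaHat ω ‖w k‖) := by
        gcongr with k _
        exact lintegral_levelKernel_omegaHat hω hpos (ht k)
    _ = _ := by
        rw [Finset.mul_sum, ENNReal.ofReal_sum_of_nonneg]
        · refine Finset.sum_congr rfl fun k _ => ?_
          rw [← ENNReal.ofReal_mul (by positivity)]
          congr 1; ring
        · intro k _
          have := (ht k).le
          positivity

lemma MpE_le_of_norm_le {p r B : ℝ} (hp : 0 < p) (hB : 0 ≤ B) {f : ℂ → ℂ}
    (h : ∀ θ, ‖f (circlePt r θ)‖ ≤ B) : MpE p r f ≤ ENNReal.ofReal B := by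
  rw [MpE_eq]
  calc _ ≤ (∫⁻ _, ENNReal.ofReal (B ^ p) ∂circMeas) ^ (1 / p) := by
        gcongr with θ
        exact h θ
    _ = _ := by
        rw [lintegral_const, measure_univ, mul_one,
          ENNReal.ofReal_rpow_of_nonneg (by positivity) (by positivity), ← Real.rpow_mul hB,
          mul_one_div_cancel hp.ne', Real.rpow_one]

lemma LpqNormE_le_of_norm_le {ω : ℝ → ℝ} (hω : IsRadialWeight ω)
    {p q B : ℝ} (hp : 0 < p) (hq : 0 < q) (hB : 0 ≤ B) {f : ℂ → ℂ}
    (h : ∀ z, ‖z‖ < 1 → ‖f z‖ ≤ B) :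
    LpqNormE ω p q f ≤ ENNReal.ofReal (B * omegaHat ω 0 ^ (1 / q)) := by
  have hW : 0 ≤ omegaHat ω 0 := by
    rw [omegaHat_eq zero_le_one]
    exact setIntegral_nonneg measurableSet_Ioo fun s hs => hω.1 s ⟨hs.1.le, hs.2⟩
  rw [LpqNormE]
  calc _ ≤ (∫⁻ s in Ioo (0 : ℝ) 1, ENNReal.ofReal (B ^ q) * ENNReal.ofReal (ω s)) ^ (1 / q) := by
        refine ENNReal.rpow_le_rpow ?_ (by positivity)
        refine setLIntegral_mono' measurableSet_Ioo fun s hs => ?_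
        have hw := hω.1 s ⟨hs.1.le, hs.2⟩
        rw [← ENNReal.ofReal_rpow_of_nonneg hB hq.le]
        refine mul_le_mul' (ENNReal.rpow_le_rpow ?_ hq.le)
          (ENNReal.ofReal_le_ofReal (mul_le_of_le_one_left hw hs.2.le))
        exact MpE_le_of_norm_le hp hB fun θ => h _ (norm_circlePt_lt_one hs.1.le hs.2 θ)
    _ = _ := by
        rw [lintegral_const_mul' _ _ ENNReal.ofReal_ne_top,
          lintegral_weight_Ioo hω le_rfl zero_le_one, ← ENNReal.ofReal_mul (by positivity),
          ENNReal.ofReal_rpow_of_nonneg (by positivity) (by positivity),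
          Real.mul_rpow (by positivity) hW, ← Real.rpow_mul hB, mul_one_div_cancel hq.ne',
          Real.rpow_one]

/-- Bounded analytic functions on the disc. -/
def IsBddAnalytic (f : ℂ → ℂ) : Prop :=
  DifferentiableOn ℂ f (Metric.ball 0 1) ∧ ∃ B, 0 ≤ B ∧ ∀ z, ‖z‖ < 1 → ‖f z‖ ≤ B

lemma IsBddAnalytic.inApq {ω : ℝ → ℝ} (hω : IsRadialWeight ω) {p q : ℝ} (hp : 0 < p) (hq : 0 < q)
    {f : ℂ → ℂ} (hf : IsBddAnalytic f) : InApq ω p q f := by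
  obtain ⟨h1, B, hB, h2⟩ := hf
  exact ⟨h1, (LpqNormE_le_of_norm_le hω hp hq hB h2).trans_lt ENNReal.ofReal_lt_top⟩

lemma IsBddAnalytic.sum {ι : Type*} (S : Finset ι) (c : ι → ℂ) {u : ι → ℂ → ℂ}
    (hu : ∀ i, IsBddAnalytic (u i)) : IsBddAnalytic fun z => ∑ i ∈ S, c i * u i z := by
  choose h1 B hB h2 using hu
  refine ⟨?_, ∑ i ∈ S, ‖c i‖ * B i, Finset.sum_nonneg fun i _ =>
    mul_nonneg (norm_nonneg _) (hB i), fun z hz => ?_⟩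
  · exact DifferentiableOn.fun_sum fun i _ => (h1 i).const_mul _
  · refine (norm_sum_le _ _).trans (Finset.sum_le_sum fun i _ => ?_)
    rw [norm_mul]
    exact mul_le_mul_of_nonneg_left (h2 i z hz) (norm_nonneg _)

lemma isBddAnalytic_testF (β : ℕ) {w : ℂ} (hw : ‖w‖ < 1) : IsBddAnalytic (testF β w) := by
  have hw1 : 0 < 1 - ‖w‖ := by linarith
  refine ⟨differentiableOn_testF β hw, ((1 - ‖w‖) ^ β)⁻¹, by positivity, fun z hz => ?_⟩
  have h1 : 1 - ‖w‖ ≤ ‖1 - (starRingEnd ℂ) w * z‖ := by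
    have := norm_sub_norm_le 1 ((starRingEnd ℂ) w * z)
    rw [norm_one, norm_mul, RCLike.norm_conj] at this
    have := mul_le_of_le_one_right (norm_nonneg w) hz.le
    linarith
  rw [testF, norm_mul, norm_pow, norm_inv, inv_pow]
  calc _ ≤ 1 * ((1 - ‖w‖) ^ β)⁻¹ := by gcongr
    _ = _ := one_mul _

lemma isBddAnalytic_pow (n : ℕ) : IsBddAnalytic fun z => z ^ n :=
  ⟨by fun_prop, 1, zero_le_one, fun z hz => by
    rw [norm_pow]; exact pow_le_one₀ (norm_nonneg z) hz.le⟩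

lemma IsLinearOn.map_sum {ω : ℝ → ℝ} (hω : IsRadialWeight ω) {p q : ℝ} (hp : 0 < p) (hq : 0 < q)
    {L : (ℂ → ℂ) → ℂ} (hL : IsLinearOn (InApq ω p q) L) {ι : Type*} (S : Finset ι) (c : ι → ℂ)
    {u : ι → ℂ → ℂ} (hu : ∀ i, IsBddAnalytic (u i)) :
    L (fun z => ∑ i ∈ S, c i * u i z) = ∑ i ∈ S, c i * L (u i) := by
  classical
  induction S using Finset.induction_on with
  | empty =>
    have h0 : InApq ω p q (fun _ => (0 : ℂ)) :=
      IsBddAnalytic.inApq hω hp hq ⟨by fun_prop, 0, le_rfl, fun z _ => by simp⟩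
    have := hL.2 0 _ h0
    rw [zero_mul] at this
    have e : ((0 : ℂ) • fun _ : ℂ => (0 : ℂ)) = fun _ => 0 := by ext; simp
    rw [e] at this
    simpa only [Finset.sum_empty] using this
  | insert a S ha ih =>
    have e : (fun z => ∑ i ∈ insert a S, c i * u i z) =
        c a • u a + fun z => ∑ i ∈ S, c i * u i z := by
      ext z
      simp [Finset.sum_insert ha]
    have h1 := (hu a).inApq hω hp hq
    have h2 : InApq ω p q (c a • u a) := by
      have := (IsBddAnalytic.sum {a} c hu).inApq hω hp hq
      convert! this using 1
      ext z
      simp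
    rw [e, hL.1 _ _ h2 ((IsBddAnalytic.sum S c hu).inApq hω hp hq), hL.2 _ _ h1, ih,
      Finset.sum_insert ha]

/-- Testing a bounded functional at points of different levels. -/
lemma exists_sum_functional_testF_le {ω : ℝ → ℝ} (hω : IsRadialWeight ω)
    (hpos : ∀ r ∈ Ico (0 : ℝ) 1, 0 < omegaHat ω r) {m : ℕ}
    (hm : ∀ s r : ℝ, 0 ≤ s → s ≤ r → r < 1 →
      omegaHat ω s ≤ 2 ^ m * ((1 - s) / (1 - r)) ^ m * omegaHat ω r) {p q q' b : ℝ} {β : ℕ}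
    (hp0 : 0 < p) (hp1 : p < 1) (hq : 1 < q) (hq' : q' = q / (q - 1)) (hβ : 2 ≤ β * p)
    (hb : b = β - 1 / p) (hbm : 3 * m ≤ b) :
    ∃ C > (0 : ℝ), ∀ (L : (ℂ → ℂ) → ℂ) (M : ℝ), IsLinearOn (InApq ω p q) L → 0 ≤ M →
      (∀ f, InApq ω p q f → ‖L f‖ ≤ M * (LpqNormE ω p q f).toReal) →
      ∀ (S : Finset ℕ) (w : ℕ → ℂ), (∀ k, ‖w k‖ < 1) →
      (∀ k ∈ S, (1 / 2 : ℝ) ^ (k + 1) < omegaHat ω ‖w k‖ / omegaHat ω 0 ∧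
        omegaHat ω ‖w k‖ / omegaHat ω 0 ≤ (1 / 2) ^ k) →
      ∑ k ∈ S, omegaHat ω ‖w k‖ *
        ((1 - ‖w k‖) ^ b * ‖L (testF β (w k))‖ / omegaHat ω ‖w k‖) ^ q' ≤ C * M ^ q' := by
  obtain ⟨C, hC0, hC⟩ := exists_LpqNormE_sum_testF_le hω hpos hm hp0 hp1 hq hβ hb hbm
  have hq0 : 0 < q := by linarith
  have hq1 : 0 < q - 1 := by linarith
  have hq'1 : 0 < q' - 1 := by
    have : q' - 1 = 1 / (q - 1) := by rw [hq']; field_simp; ring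
    rw [this]; positivity
  have hq'q : (q' - 1) * q = q' := by rw [hq']; field_simp; ring
  refine ⟨C ^ (q' - 1), by positivity, fun L M hL hM hLM S w hw hlev => ?_⟩
  have hF : ∀ k, IsBddAnalytic (testF β (w k)) := fun k => isBddAnalytic_testF β (hw k)
  have ht : ∀ k, 0 < omegaHat ω ‖w k‖ := fun k => hpos _ ⟨norm_nonneg _, hw k⟩
  have hw1 : ∀ k, 0 < 1 - ‖w k‖ := fun k => by linarith [hw k]
  set X : ℕ → ℝ := fun k => (1 - ‖w k‖) ^ b * ‖L (testF β (w k))‖ with hX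
  have hX0 : ∀ k, 0 ≤ X k := fun k => by have := (hw1 k).le; positivity
  set A := ∑ k ∈ S, omegaHat ω ‖w k‖ * (X k / omegaHat ω ‖w k‖) ^ q' with hA
  have hXt : ∀ k, 0 ≤ X k / omegaHat ω ‖w k‖ := fun k => div_nonneg (hX0 k) (ht k).le
  have hA0 : 0 ≤ A := Finset.sum_nonneg fun k _ =>
    mul_nonneg (ht k).le (Real.rpow_nonneg (hXt k) _)
  set e : ℕ → ℂ := fun k =>
    (starRingEnd ℂ) (L (testF β (w k))) / (‖L (testF β (w k))‖ : ℂ) with he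
  have he1 : ∀ k, ‖e k‖ ≤ 1 := fun k => by
    rw [he]
    simp only [norm_div, RCLike.norm_conj, Complex.norm_real, norm_norm]
    exact div_self_le_one _
  have he2 : ∀ k, e k * L (testF β (w k)) = ‖L (testF β (w k))‖ := fun k => by
    rw [he]
    simp only
    rw [div_mul_eq_mul_div, mul_comm, Complex.mul_conj, Complex.normSq_eq_norm_sq]
    rcases eq_or_ne ‖L (testF β (w k))‖ 0 with h | h
    · simp [h]
    · have : (‖L (testF β (w k))‖ : ℂ) ≠ 0 := by exact_mod_cast h
      push_cast
      field_simp
  set α : ℕ → ℝ := fun k => (X k / omegaHat ω ‖w k‖) ^ (q' - 1) with hα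
  have hα0 : ∀ k, 0 ≤ α k := fun k => Real.rpow_nonneg (hXt k) _
  set c : ℕ → ℂ := fun k => α k * e k with hc
  have hcn : ∀ k, ‖c k‖ ≤ α k := fun k => by
    rw [hc]
    simp only [norm_mul, Complex.norm_real, Real.norm_of_nonneg (hα0 k)]
    exact mul_le_of_le_one_right (hα0 k) (he1 k)
  set f : ℂ → ℂ := fun z => ∑ k ∈ S, c k * (((1 - ‖w k‖) ^ b : ℝ) : ℂ) * testF β (w k) z with hf
  have hfin : InApq ω p q f := (IsBddAnalytic.sum S _ hF).inApq hω hp0 hq0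
  have hLf : L f = (A : ℂ) := by
    rw [hf, hL.map_sum hω hp0 hq0 S _ hF, hA]
    push_cast
    refine Finset.sum_congr rfl fun k _ => ?_
    have e1 : omegaHat ω ‖w k‖ * (X k / omegaHat ω ‖w k‖) ^ q' = α k * X k := by
      have : (X k / omegaHat ω ‖w k‖) ^ q' = α k * (X k / omegaHat ω ‖w k‖) := by
        rw [hα]
        simp only
        rw [← Real.rpow_add_one' (hXt k) (by linarith), sub_add_cancel]
      rw [this]
      have := (ht k).ne'
      field_simp
    have e2 : ((omegaHat ω ‖w k‖ : ℝ) : ℂ) * (((X k / omegaHat ω ‖w k‖) ^ q' : ℝ) : ℂ) =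
        α k * X k := by exact_mod_cast e1
    have e3 : (X k : ℂ) = (((1 - ‖w k‖) ^ b : ℝ) : ℂ) * ‖L (testF β (w k))‖ := by
      rw [hX]; push_cast; ring
    rw [e2, e3, hc, ← he2]
    ring
  have hnorm : (LpqNormE ω p q f).toReal ^ q ≤ C * A := by
    have h1 := hC S w c hw hlev
    have h2 : ∑ k ∈ S, omegaHat ω ‖w k‖ * ‖c k‖ ^ q ≤ A := by
      refine Finset.sum_le_sum fun k _ => mul_le_mul_of_nonneg_left ?_ (ht k).le
      calc ‖c k‖ ^ q ≤ α k ^ q := by gcongr; exact hcn k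
        _ = _ := by rw [hα]; simp only; rw [← Real.rpow_mul (hXt k), hq'q]
    rw [ENNReal.toReal_rpow]
    refine ENNReal.toReal_le_of_le_ofReal (by positivity) (h1.trans ?_)
    gcongr
  have hmain : A ≤ M * (LpqNormE ω p q f).toReal := by
    have := hLM f hfin
    rwa [hLf, Complex.norm_real, Real.norm_of_nonneg hA0] at this
  rcases hA0.eq_or_lt with h0 | hA1
  · rw [← h0]; positivity
  · have h1 : A ^ q' ≤ M ^ q' * (C ^ (q' - 1) * A ^ (q' - 1)) := by
      calc A ^ q' ≤ (M * (LpqNormE ω p q f).toReal) ^ q' := by gcongr; linarith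
        _ = M ^ q' * ((LpqNormE ω p q f).toReal ^ q) ^ (q' - 1) := by
          rw [Real.mul_rpow hM ENNReal.toReal_nonneg, ← Real.rpow_mul ENNReal.toReal_nonneg,
            mul_comm q, hq'q]
        _ ≤ M ^ q' * (C * A) ^ (q' - 1) := by gcongr
        _ = _ := by rw [Real.mul_rpow hC0.le hA0]
    have h2 : A ^ q' = A * A ^ (q' - 1) := by
      rw [← Real.rpow_one_add' hA0 (by linarith)]; congr 1; ring
    rw [h2] at h1
    have h3 : 0 < A ^ (q' - 1) := by positivity
    refine le_of_mul_le_mul_right ?_ h3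
    linarith

/-- From discrete estimates over levels to an integral estimate for the nontangential supremum. -/
lemma lintegral_iSup_rpow_le {ω : ℝ → ℝ} (hω : IsRadialWeight ω)
    (hpos : ∀ r ∈ Ico (0 : ℝ) 1, 0 < omegaHat ω r) {D q' A : ℝ} (hD0 : 0 < D)
    (hD : ∀ r ∈ Ico (0 : ℝ) 1, omegaHat ω r ≤ D * omegaHat ω ((1 + r) / 2)) (hq' : 0 < q')
    {X : ℂ → ℝ} (hX : ∀ w, ‖w‖ < 1 → 0 ≤ X w)
    (H : ∀ (S : Finset ℕ) (w : ℕ → ℂ), (∀ k, ‖w k‖ < 1) →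
      (∀ k ∈ S, (1 / 2 : ℝ) ^ (k + 1) < omegaHat ω ‖w k‖ / omegaHat ω 0 ∧
        omegaHat ω ‖w k‖ / omegaHat ω 0 ≤ (1 / 2) ^ k) →
      ∑ k ∈ S, omegaHat ω ‖w k‖ * (X (w k) / omegaHat ω ‖w k‖) ^ q' ≤ A) :
    ∫⁻ s in Ioo (0 : ℝ) 1, (⨆ (w : ℂ) (_ : ‖w‖ < (1 + s) / 2),
        ENNReal.ofReal (X w / omegaHat ω ‖w‖)) ^ q' * ENNReal.ofReal (ω s) ≤
      ENNReal.ofReal (2 * D * 2 ^ q' * A) := by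
  have hW0 := hpos 0 ⟨le_rfl, one_pos⟩
  have ht : ∀ w : ℂ, ‖w‖ < 1 → 0 < omegaHat ω ‖w‖ := fun w hw => hpos _ ⟨norm_nonneg _, hw⟩
  set lev : ℕ → ℂ → Prop := fun k w => ‖w‖ < 1 ∧
    (1 / 2 : ℝ) ^ (k + 1) < omegaHat ω ‖w‖ / omegaHat ω 0 ∧
        omegaHat ω ‖w‖ / omegaHat ω 0 ≤ (1 / 2) ^ k with hlev
  set y : ℕ → ℝ≥0∞ := fun k => ⨆ (w : ℂ) (_ : lev k w), ENNReal.ofReal (X w / omegaHat ω ‖w‖)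
    with hy
  have hyfin : ∀ k, y k ≠ ⊤ := by
    intro k
    set τ := (1 / 2 : ℝ) ^ (k + 1) * omegaHat ω 0
    have hτ : 0 < τ := by positivity
    refine ne_top_of_le_ne_top (b := ENNReal.ofReal ((A / τ) ^ (1 / q'))) ENNReal.ofReal_ne_top ?_
    refine iSup₂_le fun w hw => ENNReal.ofReal_le_ofReal ?_
    have h1 := H {k} (fun _ => w) (fun _ => hw.1) (by simpa using hw.2)
    rw [Finset.sum_singleton] at h1
    have htw := ht w hw.1
    have hq0 : 0 ≤ X w / omegaHat ω ‖w‖ := div_nonneg (hX w hw.1) htw.le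
    have h2 : τ ≤ omegaHat ω ‖w‖ := ((lt_div_iff₀ hW0).1 hw.2.1).le
    have h3 : (X w / omegaHat ω ‖w‖) ^ q' ≤ A / τ := by
      rw [le_div_iff₀ hτ, mul_comm]
      refine le_trans ?_ h1
      gcongr
    calc _ = ((X w / omegaHat ω ‖w‖) ^ q') ^ (1 / q') := by
          rw [← Real.rpow_mul hq0, mul_one_div_cancel hq'.ne', Real.rpow_one]
      _ ≤ _ := by gcongr
  have hchoose : ∀ k, ∃ w : ℂ, ‖w‖ < 1 ∧ (y k ≠ 0 → lev k w ∧
      y k ≤ ENNReal.ofReal (2 * (X w / omegaHat ω ‖w‖))) := by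
    intro k
    by_cases h0 : y k = 0
    · exact ⟨0, by simp, fun h => absurd h0 h⟩
    · have h1 : y k / 2 < y k := ENNReal.half_lt_self h0 (hyfin k)
      rw [hy] at h1
      obtain ⟨w, h2⟩ := lt_iSup_iff.1 h1
      obtain ⟨hw, h3⟩ := lt_iSup_iff.1 h2
      refine ⟨w, hw.1, fun _ => ⟨hw, ?_⟩⟩
      rw [ENNReal.ofReal_mul zero_le_two, ENNReal.ofReal_ofNat, mul_comm]
      exact (ENNReal.div_le_iff_le_mul (by simp) (by simp)).1 h3.le
  choose w hw1 hw2 using hchoose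
  set c : ℕ → ℝ := fun k => D * ((1 / 2) ^ k * omegaHat ω 0) with hc
  have hsum : ∑' k, y k ^ q' * ENNReal.ofReal (c k) ≤ ENNReal.ofReal (2 * D * 2 ^ q' * A) := by
    rw [ENNReal.tsum_eq_iSup_sum]
    refine iSup_le fun S => ?_
    have hS := H (S.filter fun k => y k ≠ 0) w hw1 fun k hk =>
      (hw2 k (Finset.mem_filter.1 hk).2).1.2
    calc _ = ∑ k ∈ S with y k ≠ 0, y k ^ q' * ENNReal.ofReal (c k) := by
          refine (Finset.sum_filter_of_ne (p := fun k => y k ≠ 0) fun k _ h h0 => h ?_).symm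
          rw [h0, ENNReal.zero_rpow_of_pos hq', zero_mul]
      _ ≤ ∑ k ∈ S with y k ≠ 0, ENNReal.ofReal (2 * D * 2 ^ q' *
          (omegaHat ω ‖w k‖ * (X (w k) / omegaHat ω ‖w k‖) ^ q')) := by
          refine Finset.sum_le_sum fun k hk => ?_
          obtain ⟨h1, h2⟩ := hw2 k (Finset.mem_filter.1 hk).2
          have htk := ht _ (hw1 k)
          have hq0 : 0 ≤ X (w k) / omegaHat ω ‖w k‖ := div_nonneg (hX _ (hw1 k)) htk.le
          have h3 : c k ≤ D * (2 * omegaHat ω ‖w k‖) := by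
            have := (lt_div_iff₀ hW0).1 h1.2.1
            rw [pow_succ] at this
            calc c k = D * (2 * ((1 / 2) ^ k * (1 / 2) * omegaHat ω 0)) := by simp only [hc]; ring
              _ ≤ _ := by gcongr
          calc _ ≤ ENNReal.ofReal (2 * (X (w k) / omegaHat ω ‖w k‖)) ^ q' *
                ENNReal.ofReal (D * (2 * omegaHat ω ‖w k‖)) := by gcongr
            _ = _ := by
              rw [ENNReal.ofReal_rpow_of_nonneg (by positivity) hq'.le,
                ← ENNReal.ofReal_mul (by positivity), Real.mul_rpow zero_le_two hq0]
              congr 1; ring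
      _ ≤ _ := by
          rw [← ENNReal.ofReal_sum_of_nonneg, ← Finset.mul_sum]
          · gcongr
          · intro k _
            have htk := ht _ (hw1 k)
            have hq0 : 0 ≤ X (w k) / omegaHat ω ‖w k‖ := div_nonneg (hX _ (hw1 k)) htk.le
            positivity
  set g : ℕ → ℝ → ℝ≥0∞ := fun k => (Iic (c k)).indicator fun _ => y k ^ q' with hg
  have hgm : ∀ k, Measurable (g k) := fun k => measurable_const.indicator measurableSet_Iic
  have hpt : ∀ s ∈ Ioo (0 : ℝ) 1, (⨆ (w : ℂ) (_ : ‖w‖ < (1 + s) / 2),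
      ENNReal.ofReal (X w / omegaHat ω ‖w‖)) ^ q' ≤ ∑' k, g k (omegaHat ω s) := by
    intro s hs
    rw [← ENNReal.le_rpow_inv_iff hq']
    refine iSup₂_le fun v hv => ?_
    rw [ENNReal.le_rpow_inv_iff hq']
    have hv1 : ‖v‖ < 1 := by linarith [hs.2]
    have htv := ht v hv1
    obtain ⟨k, hk1, hk2⟩ := exists_level (y := omegaHat ω ‖v‖ / omegaHat ω 0) (by positivity)
      ((div_le_one hW0).2 (omegaHat_anti hω le_rfl (norm_nonneg _) hv1.le))
    have hsk : omegaHat ω s ≤ c k := by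
      calc _ ≤ D * omegaHat ω ((1 + s) / 2) := hD s ⟨hs.1.le, hs.2⟩
        _ ≤ D * omegaHat ω ‖v‖ := by
          gcongr
          exact omegaHat_anti hω (norm_nonneg _) hv.le (by linarith [hs.2])
        _ ≤ _ := by
          simp only [hc]
          gcongr
          exact (div_le_iff₀ hW0).1 hk2
    calc _ ≤ y k ^ q' := by
          gcongr
          exact le_iSup₂_of_le v ⟨hv1, hk1, hk2⟩ le_rfl
      _ = g k (omegaHat ω s) := by rw [hg]; simp only [indicator_of_mem (mem_Iic.2 hsk)]
      _ ≤ _ := ENNReal.le_tsum k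
  calc _ ≤ ∫⁻ s in Ioo (0 : ℝ) 1, ∑' k, g k (omegaHat ω s) * ENNReal.ofReal (ω s) := by
        refine setLIntegral_mono' measurableSet_Ioo fun s hs => ?_
        rw [ENNReal.tsum_mul_right]
        gcongr
        exact hpt s hs
    _ = ∑' k, ∫⁻ s in Ioo (0 : ℝ) 1, g k (omegaHat ω s) * ENNReal.ofReal (ω s) := by
        refine lintegral_tsum fun k => AEMeasurable.mul ?_ (aemeasurable_weight hω).ennreal_ofReal
        exact (hgm k).comp_aemeasurable (aemeasurable_omegaHat hω)
    _ ≤ ∑' k, y k ^ q' * ENNReal.ofReal (c k) := by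
        refine ENNReal.tsum_le_tsum fun k => ?_
        rw [lintegral_comp_omegaHat hω hpos (hgm k)]
        calc _ ≤ ∫⁻ x in Ioi 0, g k x := lintegral_mono_set Ioo_subset_Ioi_self
          _ = _ := by
            rw [hg, lintegral_indicator measurableSet_Iic, lintegral_const,
              Measure.restrict_apply_univ, Measure.restrict_apply measurableSet_Iic, inter_comm,
              Ioi_inter_Iic, Real.volume_Ioc, sub_zero]
    _ ≤ _ := hsum

lemma add_three_pow_le_choose (k n : ℕ) :
    ((n : ℝ) + 3) ^ k ≤ 3 ^ k * k.factorial * ((n + k).choose k : ℝ) := by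
  have h1 : (n + 1) ^ k ≤ k.factorial * (n + k).choose k := by
    rw [← Nat.ascFactorial_eq_factorial_mul_choose]
    exact Nat.pow_succ_le_ascFactorial _ _
  have h2 : ((n : ℝ) + 1) ^ k ≤ k.factorial * ((n + k).choose k : ℝ) := by exact_mod_cast h1
  calc ((n : ℝ) + 3) ^ k ≤ (3 * ((n : ℝ) + 1)) ^ k := by
        gcongr
        linarith [(Nat.cast_nonneg n : (0 : ℝ) ≤ n)]
    _ = 3 ^ k * ((n : ℝ) + 1) ^ k := mul_pow _ _ _
    _ ≤ 3 ^ k * (k.factorial * ((n + k).choose k : ℝ)) := by gcongr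
    _ = _ := by ring

lemma summable_add_three_pow_mul_geometric (k : ℕ) {x : ℝ} (h0 : 0 ≤ x) (h1 : x < 1) :
    Summable fun n : ℕ => ((n : ℝ) + 3) ^ k * x ^ n := by
  have hx : ‖x‖ < 1 := by rwa [Real.norm_of_nonneg h0]
  refine Summable.of_nonneg_of_le (fun n => by positivity) (fun n => ?_)
    ((summable_choose_mul_geometric_of_norm_lt_one k hx).mul_left (3 ^ k * k.factorial : ℝ))
  rw [← mul_assoc]
  gcongr
  exact add_three_pow_le_choose k n

lemma tsum_add_three_pow_mul_geometric_le (k : ℕ) {x : ℝ} (h0 : 0 ≤ x) (h1 : x < 1) :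
    ∑' n : ℕ, ((n : ℝ) + 3) ^ k * x ^ n ≤ 3 ^ k * k.factorial / (1 - x) ^ (k + 1) := by
  have hx : ‖x‖ < 1 := by rwa [Real.norm_of_nonneg h0]
  have hs := (hasSum_choose_mul_geometric_of_norm_lt_one k hx).mul_left (3 ^ k * k.factorial : ℝ)
  rw [mul_one_div] at hs
  refine (summable_add_three_pow_mul_geometric k h0 h1).tsum_le_of_sum_le fun S => ?_
  refine le_trans (Finset.sum_le_sum fun n _ => ?_) (sum_le_hasSum S (fun n _ => by positivity) hs)
  rw [← mul_assoc]
  gcongr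
  exact add_three_pow_le_choose k n

/-- Coefficients of a power series with radius of convergence at least one. -/
def IsSubexp (a : ℕ → ℂ) : Prop :=
  ∀ ρ : ℝ, 0 ≤ ρ → ρ < 1 → Summable fun n => ‖a n‖ * ρ ^ n

lemma IsSubexp.mul {a b : ℕ → ℂ} (ha : IsSubexp a) (hb : IsSubexp b) :
    IsSubexp fun n => a n * b n := by
  intro ρ h0 h1
  have hs1 : √ρ < 1 := by rw [Real.sqrt_lt' one_pos]; simpa using h1
  have hinj : Function.Injective fun n : ℕ => (n, n) := fun a b h => (Prod.ext_iff.1 h).1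
  refine (((ha _ (Real.sqrt_nonneg ρ) hs1).mul_of_nonneg (hb _ (Real.sqrt_nonneg ρ) hs1)
    (fun n => by positivity) (fun n => by positivity)).comp_injective hinj).congr fun n => ?_
  simp only [Function.comp_apply]
  rw [norm_mul]
  nth_rw 3 [← Real.mul_self_sqrt h0]
  rw [mul_pow]
  ring

lemma IsSubexp.of_norm_le {a b : ℕ → ℂ} (hb : IsSubexp b) {C : ℝ}
    (h : ∀ n, ‖a n‖ ≤ C * ‖b n‖) : IsSubexp a := by
  intro ρ h0 h1
  refine Summable.of_nonneg_of_le (fun n => by positivity) (fun n => ?_)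
    ((hb ρ h0 h1).mul_left C)
  rw [← mul_assoc]
  gcongr
  exact h n

lemma isSubexp_add_three_pow (k : ℕ) : IsSubexp fun n => ((n : ℂ) + 3) ^ k := by
  intro ρ h0 h1
  refine (summable_add_three_pow_mul_geometric k h0 h1).congr fun n => ?_
  rw [norm_pow]
  have : ‖(n : ℂ) + 3‖ = (n : ℝ) + 3 := by
    rw [show (n : ℂ) + 3 = ((n + 3 : ℕ) : ℂ) by push_cast; rfl, Complex.norm_natCast]
    push_cast; rfl
  rw [this]

lemma isSubexp_of_norm_le {a : ℕ → ℂ} {C : ℝ} (h : ∀ n, ‖a n‖ ≤ C) : IsSubexp a :=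
  (isSubexp_add_three_pow 0).of_norm_le (C := C) fun n => by simpa using h n

lemma integral_norm_sq_circle {a : ℕ → ℂ} (ha : Summable fun n => ‖a n‖) :
    HasSum (fun n => ‖a n‖ ^ 2) (∫ θ, ‖∑' n, a n * circlePt 1 θ ^ n‖ ^ 2 ∂circMeas) := by
  have h := hasSum_parseval ha ha
  simp only [Complex.mul_conj, Complex.normSq_eq_norm_sq] at h
  rw [integral_complex_ofReal] at h
  exact_mod_cast h

/-- The coefficients `β` apart quotient `(n+β)/a_{n+1}` have differences controlled by
`1/a_{n+1}`. -/
lemma abs_sub_div_le {a : ℕ → ℝ} (ha : ∀ n, 0 < a n) (hanti : ∀ n, a (n + 1) ≤ a n)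
    {C : ℝ} (h : ∀ n : ℕ, (n + 2) * (a n - a (n + 1)) ≤ C * a n) {β : ℕ}
    (hβ : 1 ≤ β) (n : ℕ) :
    |(n + 1 + β) / a (n + 2) - (n + β) / a (n + 1)| ≤ (1 + β * C) / a (n + 2) := by
  have h1 := ha (n + 1)
  have h2 := ha (n + 2)
  have hβ' : (1 : ℝ) ≤ β := by exact_mod_cast hβ
  have hn : (0 : ℝ) ≤ n := Nat.cast_nonneg n
  have hd : 0 ≤ a (n + 1) - a (n + 2) := sub_nonneg.2 (hanti (n + 1))
  have e : (n + 1 + β) / a (n + 2) - (n + β) / a (n + 1) =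
      (1 + (n + β) * (a (n + 1) - a (n + 2)) / a (n + 1)) / a (n + 2) := by
    field_simp; ring
  rw [e, abs_of_nonneg (by positivity)]
  gcongr
  rw [div_le_iff₀ h1]
  have h3 := h (n + 1)
  push_cast at h3
  calc (n + β) * (a (n + 1) - a (n + 2)) ≤ (β * (n + 1 + 2)) * (a (n + 1) - a (n + 2)) := by
        gcongr
        nlinarith
    _ = β * ((n + 1 + 2) * (a (n + 1) - a (n + 2))) := by ring
    _ ≤ β * (C * a (n + 1)) := by gcongr
    _ = _ := by ring

/-- An `L¹` bound of a power series in terms of the differences of its coefficients. -/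
lemma integral_norm_tsum_le {k d : ℕ → ℂ} (hk : IsSubexp k) (hd : IsSubexp d) (h0 : d 0 = k 0)
    (hd' : ∀ n, d (n + 1) = k (n + 1) - k n) {x lam : ℝ} (hx0 : 0 ≤ x) (hx1 : x < 1)
    (hlam : 0 < lam) :
    ∫ θ, ‖∑' n, k n * (x : ℂ) ^ n * circlePt 1 θ ^ n‖ ∂circMeas ≤
      (lam * (1 / (1 - x)) + (∑' n, ‖d n‖ ^ 2 * x ^ n) / lam) / 2 := by
  have hnx : ∀ n, ‖(x : ℂ) ^ n‖ = x ^ n := fun n => by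
    rw [norm_pow, Complex.norm_real, Real.norm_of_nonneg hx0]
  have hsk : Summable fun n => ‖k n * (x : ℂ) ^ n‖ :=
    (hk x hx0 hx1).congr fun n => by rw [norm_mul, hnx]
  have hsd : Summable fun n => ‖d n * (x : ℂ) ^ n‖ :=
    (hd x hx0 hx1).congr fun n => by rw [norm_mul, hnx]
  have hs1 : Summable fun n : ℕ => ‖(x : ℂ) ^ n‖ :=
    (summable_geometric_of_lt_one hx0 hx1).congr fun n => (hnx n).symm
  set K : ℝ → ℂ := fun θ => ∑' n, k n * (x : ℂ) ^ n * circlePt 1 θ ^ n with hK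
  set G : ℝ → ℂ := fun θ => ∑' n, d n * (x : ℂ) ^ n * circlePt 1 θ ^ n with hG
  set P : ℝ → ℂ := fun θ => ∑' n, (x : ℂ) ^ n * circlePt 1 θ ^ n with hP
  have hsummable : ∀ {c : ℕ → ℂ}, (Summable fun n => ‖c n‖) → ∀ θ,
      Summable fun n => c n * circlePt 1 θ ^ n := fun hc θ => by
    refine Summable.of_norm (hc.congr fun n => ?_)
    rw [norm_mul, norm_pow, norm_circlePt_one, one_pow, mul_one]
  have hKG : ∀ θ, K θ = P θ * G θ := by
    intro θ
    set ζ : ℂ := x * circlePt 1 θ with hζ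
    have hζ1 : ‖ζ‖ < 1 := by
      rw [hζ, norm_mul, norm_circlePt_one, mul_one, Complex.norm_real, Real.norm_of_nonneg hx0]
      exact hx1
    have hPe : P θ = (1 - ζ)⁻¹ := by
      rw [← tsum_geometric_of_norm_lt_one hζ1]
      exact tsum_congr fun n => by rw [hζ, mul_pow]
    have hne : (1 - ζ) ≠ 0 := by
      intro h
      rw [← sub_eq_zero.1 h] at hζ1
      simp at hζ1
    have e1 := (hsummable hsk θ).tsum_eq_zero_add
    have e2 := (hsummable hsd θ).tsum_eq_zero_add
    have e3 : ∑' n, d (n + 1) * (x : ℂ) ^ (n + 1) * circlePt 1 θ ^ (n + 1) =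
        ∑' n, k (n + 1) * (x : ℂ) ^ (n + 1) * circlePt 1 θ ^ (n + 1) - ζ * K θ := by
      rw [hK]
      simp only
      rw [← tsum_mul_left, ← Summable.tsum_sub]
      · refine tsum_congr fun n => ?_
        rw [hd', hζ]; ring
      · exact (summable_nat_add_iff 1).2 (hsummable hsk θ)
      · exact (hsummable hsk θ).mul_left _
    have e4 : G θ = (1 - ζ) * K θ := by
      rw [hG]
      simp only
      rw [e2, e3, h0]
      rw [show K θ = _ from e1] at *
      ring
    rw [e4, hPe, inv_mul_cancel_left₀ hne]
  have hP2 := integral_norm_sq_circle hs1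
  have hG2 := integral_norm_sq_circle hsd
  have hcK : Continuous K := continuous_tsum_circle hsk
  have hcP : Continuous P := continuous_tsum_circle hs1
  have hcG : Continuous G := continuous_tsum_circle hsd
  have hle : ∀ n, x ^ (2 * n) ≤ x ^ n := fun n => pow_le_pow_of_le_one hx0 hx1.le (by omega)
  have hbP : ∫ θ, ‖P θ‖ ^ 2 ∂circMeas ≤ 1 / (1 - x) := by
    rw [one_div, ← tsum_geometric_of_lt_one hx0 hx1, ← hP2.tsum_eq]
    refine hP2.summable.tsum_le_tsum (fun n => ?_) (summable_geometric_of_lt_one hx0 hx1)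
    rw [hnx, ← pow_mul, mul_comm]
    exact hle n
  have hbG : ∫ θ, ‖G θ‖ ^ 2 ∂circMeas ≤ ∑' n, ‖d n‖ ^ 2 * x ^ n := by
    rw [← hG2.tsum_eq]
    refine hG2.summable.tsum_le_tsum (fun n => ?_) ?_
    · rw [norm_mul, mul_pow, hnx, ← pow_mul, mul_comm n]
      exact mul_le_mul_of_nonneg_left (hle n) (by positivity)
    · refine ((hd.mul hd) x hx0 hx1).congr fun n => ?_
      rw [norm_mul, sq]
  have hiP := integrable_circMeas_of_continuous (h := fun θ => ‖P θ‖ ^ 2) (by fun_prop)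
  have hiG := integrable_circMeas_of_continuous (h := fun θ => ‖G θ‖ ^ 2) (by fun_prop)
  calc ∫ θ, ‖K θ‖ ∂circMeas
      ≤ ∫ θ, (lam * ‖P θ‖ ^ 2 + ‖G θ‖ ^ 2 / lam) / 2 ∂circMeas := by
        refine integral_mono (integrable_circMeas_of_continuous (by fun_prop))
          (((hiP.const_mul lam).add (hiG.div_const lam)).div_const 2) fun θ => ?_
        simp only
        rw [hKG θ, norm_mul, le_div_iff₀ two_pos, ← sub_nonneg]
        have : lam * ‖P θ‖ ^ 2 + ‖G θ‖ ^ 2 / lam - ‖P θ‖ * ‖G θ‖ * 2 =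
            (lam * ‖P θ‖ - ‖G θ‖) ^ 2 / lam := by field_simp; ring
        rw [this]; positivity
    _ = (lam * ∫ θ, ‖P θ‖ ^ 2 ∂circMeas + (∫ θ, ‖G θ‖ ^ 2 ∂circMeas) / lam) / 2 := by
        rw [integral_div, integral_add (hiP.const_mul lam) (hiG.div_const lam), integral_const_mul,
          integral_div]
    _ ≤ _ := by gcongr

lemma isSubexp_inv_momentCoeff {ω : ℝ → ℝ} (hω : IsRadialWeight ω)
    (hpos : ∀ r ∈ Ico (0 : ℝ) 1, 0 < omegaHat ω r) (hD : InDhat ω) (j : ℕ) :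
    IsSubexp fun n => ((momentCoeff ω (n + j) : ℝ) : ℂ)⁻¹ := by
  obtain ⟨C, hC, m, hm⟩ := exists_omegaHat_le_mul_momentCoeff hω hpos hD
  have hW0 := hpos 0 ⟨le_rfl, one_pos⟩
  refine (isSubexp_add_three_pow m).of_norm_le
    (C := C * (2 * ((j : ℝ) + 1) ^ m) / omegaHat ω 0) fun n => ?_
  have ha := momentCoeff_pos hω hpos (n + j)
  have hn : (0 : ℝ) ≤ n := Nat.cast_nonneg n
  have hj : (0 : ℝ) ≤ j := Nat.cast_nonneg j
  have e : ‖((n : ℂ) + 3) ^ m‖ = ((n : ℝ) + 3) ^ m := by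
    rw [norm_pow, show (n : ℂ) + 3 = ((n + 3 : ℕ) : ℂ) by push_cast; rfl, Complex.norm_natCast]
    push_cast; rfl
  rw [e, norm_inv, Complex.norm_real, Real.norm_of_nonneg ha.le, inv_le_iff_one_le_mul₀ ha]
  have h := hm 0 ⟨le_rfl, one_pos⟩ (n + j)
  have h1 : 1 + ((1 - 0) * (((n + j : ℕ) : ℝ) + 2)) ^ m ≤
      2 * ((j : ℝ) + 1) ^ m * ((n : ℝ) + 3) ^ m := by
    have h2 : (1 - 0) * (((n + j : ℕ) : ℝ) + 2) ≤ ((j : ℝ) + 1) * ((n : ℝ) + 3) := by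
      push_cast
      nlinarith [mul_nonneg hj hn]
    have h3 : (1 : ℝ) ≤ (((j : ℝ) + 1) * ((n : ℝ) + 3)) ^ m :=
      one_le_pow₀ (by nlinarith [mul_nonneg hj hn])
    have h4 : ((1 - 0) * (((n + j : ℕ) : ℝ) + 2)) ^ m ≤ (((j : ℝ) + 1) * ((n : ℝ) + 3)) ^ m := by
      gcongr
    rw [mul_assoc, ← mul_pow]
    linarith
  have h5 : omegaHat ω 0 ≤
      C * (2 * ((j : ℝ) + 1) ^ m * ((n : ℝ) + 3) ^ m) * momentCoeff ω (n + j) :=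
    h.trans (by gcongr)
  rw [div_mul_eq_mul_div, div_mul_eq_mul_div, le_div_iff₀ hW0]
  linarith

lemma isSubexp_natCast_add (j : ℕ) : IsSubexp fun n => (n : ℂ) + j := by
  refine (isSubexp_add_three_pow 1).of_norm_le (C := j + 1) fun n => ?_
  have e : ‖(n : ℂ) + 3‖ = (n : ℝ) + 3 := by
    rw [show (n : ℂ) + 3 = ((n + 3 : ℕ) : ℂ) by push_cast; rfl, Complex.norm_natCast]
    push_cast; rfl
  have e' : ‖(n : ℂ) + j‖ = (n : ℝ) + j := by
    rw [show (n : ℂ) + j = ((n + j : ℕ) : ℂ) by push_cast; rfl, Complex.norm_natCast]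
    push_cast; rfl
  rw [pow_one, e, e']
  have hn : (0 : ℝ) ≤ n := Nat.cast_nonneg n
  have hj : (0 : ℝ) ≤ j := Nat.cast_nonneg j
  nlinarith [mul_nonneg hj hn]

/-- Coefficients of the kernel that turns `∑ B_n ℓ_n w^n` into a fractional derivative. -/
def kernelCoeff (ω : ℝ → ℝ) (β n : ℕ) : ℝ := (n + β) / momentCoeff ω (n + 1)

lemma isSubexp_kernelCoeff {ω : ℝ → ℝ} (hω : IsRadialWeight ω)
    (hpos : ∀ r ∈ Ico (0 : ℝ) 1, 0 < omegaHat ω r) (hD : InDhat ω) (β : ℕ) :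
    IsSubexp fun n => ((kernelCoeff ω β n : ℝ) : ℂ) := by
  refine ((isSubexp_natCast_add β).mul (isSubexp_inv_momentCoeff hω hpos hD 1)).of_norm_le (C := 1)
    fun n => ?_
  rw [kernelCoeff, one_mul]
  push_cast
  rw [div_eq_mul_inv]

/-- The `L¹` norm of the kernel on the circle of radius `x`. -/
lemma exists_integral_norm_kernel_le {ω : ℝ → ℝ} (hω : IsRadialWeight ω)
    (hpos : ∀ r ∈ Ico (0 : ℝ) 1, 0 < omegaHat ω r) (hD : InDhat ω) {β : ℕ} (hβ : 1 ≤ β) :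
    ∃ C > (0 : ℝ), ∀ x ∈ Ico (0 : ℝ) 1,
      ∫ θ, ‖∑' n, ((kernelCoeff ω β n : ℝ) : ℂ) * (x : ℂ) ^ n * circlePt 1 θ ^ n‖ ∂circMeas ≤
        C / ((1 - x) * omegaHat ω x) := by
  obtain ⟨C₀, hC₀, h₀⟩ := exists_momentCoeff_sub_le hω hpos hD
  obtain ⟨C, hC, m, hm⟩ := exists_omegaHat_le_mul_momentCoeff hω hpos hD
  have ha : ∀ n, 0 < momentCoeff ω n := momentCoeff_pos hω hpos
  set k : ℕ → ℂ := fun n => ((kernelCoeff ω β n : ℝ) : ℂ) with hk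
  set d : ℕ → ℂ := fun n => Nat.rec (k 0) (fun n _ => k (n + 1) - k n) n with hd
  set C₁ : ℝ := β + 1 + β * C₀ with hC₁
  have hC₁0 : 0 < C₁ := by positivity
  have hdn : ∀ n, ‖d n‖ ≤ C₁ * (momentCoeff ω (n + 1))⁻¹ := by
    intro n
    have hn1 := ha (n + 1)
    rw [← div_eq_mul_inv]
    cases n with
    | zero =>
      change ‖((kernelCoeff ω β 0 : ℝ) : ℂ)‖ ≤ _
      rw [kernelCoeff, Complex.norm_real, Real.norm_of_nonneg (by positivity)]
      simp only [Nat.cast_zero, zero_add]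
      gcongr
      rw [hC₁]
      nlinarith [mul_nonneg (Nat.cast_nonneg β : (0 : ℝ) ≤ β) hC₀.le]
    | succ n =>
      change ‖((kernelCoeff ω β (n + 1) : ℝ) : ℂ) - ((kernelCoeff ω β n : ℝ) : ℂ)‖ ≤ _
      simp only [kernelCoeff]
      rw [← Complex.ofReal_sub, Complex.norm_real, Real.norm_eq_abs]
      have := abs_sub_div_le ha (fun n => momentCoeff_le_of_le hω n.le_succ) h₀ hβ n
      push_cast
      refine this.trans ?_
      gcongr
      rw [hC₁]
      linarith [(Nat.cast_nonneg β : (0 : ℝ) ≤ β)]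
  have hds : IsSubexp d := (isSubexp_inv_momentCoeff hω hpos hD 1).of_norm_le (C := C₁) fun n => by
    rw [norm_inv, Complex.norm_real, Real.norm_of_nonneg (ha _).le]
    exact hdn n
  set E : ℝ := 3 ^ (2 * m) * (2 * m).factorial with hE
  set N : ℝ := C₁ ^ 2 * (2 * C ^ 2 * (1 + E)) with hN
  have hE0 : 0 < E := by positivity
  refine ⟨(1 + N) / 2, by positivity, fun x hx => ?_⟩
  have hW := hpos x hx
  have hx1 : 0 < 1 - x := sub_pos.2 hx.2
  have hpt : ∀ n, ‖d n‖ ^ 2 * x ^ n ≤ C₁ ^ 2 * (2 * C ^ 2) / omegaHat ω x ^ 2 *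
      (x ^ n + (1 - x) ^ (2 * m) * (((n : ℝ) + 3) ^ (2 * m) * x ^ n)) := by
    intro n
    have hn1 := ha (n + 1)
    have hxn : 0 ≤ x ^ n := pow_nonneg hx.1 n
    have h1 := hm x hx (n + 1)
    push_cast at h1
    have h2 : (momentCoeff ω (n + 1))⁻¹ ≤
        C * (1 + ((1 - x) * ((n : ℝ) + 3)) ^ m) / omegaHat ω x := by
      rw [le_div_iff₀ hW, inv_mul_le_iff₀ hn1]
      calc _ ≤ _ := h1
        _ = _ := by ring
    set z : ℝ := ((1 - x) * ((n : ℝ) + 3)) ^ m with hz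
    have h3 : ‖d n‖ ≤ C₁ * (C * (1 + z) / omegaHat ω x) := (hdn n).trans (by gcongr)
    have h4 : (1 + z) ^ 2 ≤ 2 * (1 + z ^ 2) := by nlinarith [sq_nonneg (1 - z)]
    have h5 : z ^ 2 = (1 - x) ^ (2 * m) * ((n : ℝ) + 3) ^ (2 * m) := by
      rw [hz, ← pow_mul, mul_pow, mul_comm m]
    calc ‖d n‖ ^ 2 * x ^ n ≤ (C₁ * (C * (1 + z) / omegaHat ω x)) ^ 2 * x ^ n := by gcongr
      _ = C₁ ^ 2 * C ^ 2 / omegaHat ω x ^ 2 * ((1 + z) ^ 2) * x ^ n := by field_simp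
      _ ≤ C₁ ^ 2 * C ^ 2 / omegaHat ω x ^ 2 * (2 * (1 + z ^ 2)) * x ^ n := by gcongr
      _ = _ := by rw [h5]; ring
  have hg := summable_geometric_of_lt_one hx.1 hx.2
  have hg2 := summable_add_three_pow_mul_geometric (2 * m) hx.1 hx.2
  have hsum : ∑' n, ‖d n‖ ^ 2 * x ^ n ≤ N / ((1 - x) * omegaHat ω x ^ 2) := by
    calc ∑' n, ‖d n‖ ^ 2 * x ^ n ≤ ∑' n : ℕ, C₁ ^ 2 * (2 * C ^ 2) / omegaHat ω x ^ 2 *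
          (x ^ n + (1 - x) ^ (2 * m) * (((n : ℝ) + 3) ^ (2 * m) * x ^ n)) := by
          refine Summable.tsum_le_tsum hpt ?_ ((hg.add (hg2.mul_left _)).mul_left _)
          refine ((hds.mul hds) x hx.1 hx.2).congr fun n => ?_
          rw [norm_mul, sq]
      _ = C₁ ^ 2 * (2 * C ^ 2) / omegaHat ω x ^ 2 * ((1 - x)⁻¹ + (1 - x) ^ (2 * m) *
          ∑' n : ℕ, ((n : ℝ) + 3) ^ (2 * m) * x ^ n) := by
          rw [tsum_mul_left, hg.tsum_add (hg2.mul_left _), tsum_mul_left,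
            tsum_geometric_of_lt_one hx.1 hx.2]
      _ ≤ C₁ ^ 2 * (2 * C ^ 2) / omegaHat ω x ^ 2 * ((1 - x)⁻¹ + (1 - x) ^ (2 * m) *
          (E / (1 - x) ^ (2 * m + 1))) := by
          gcongr
          exact tsum_add_three_pow_mul_geometric_le (2 * m) hx.1 hx.2
      _ = _ := by
          rw [hN, pow_succ (1 - x) (2 * m)]
          field_simp
  refine (integral_norm_tsum_le (isSubexp_kernelCoeff hω hpos hD β) hds rfl (fun _ => rfl) hx.1 hx.2
    (inv_pos.2 hW)).trans ?_
  calc _ ≤ ((omegaHat ω x)⁻¹ * (1 / (1 - x)) + N / ((1 - x) * omegaHat ω x ^ 2) /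
        (omegaHat ω x)⁻¹) / 2 := by gcongr
    _ = _ := by field_simp

/-- A Hadamard product is bounded by the supremum of one factor times the `L¹` norm of the
other. -/
lemma norm_tsum_mul_conj_le {a b : ℕ → ℂ} (ha : Summable fun n => ‖a n‖)
    (hb : Summable fun n => ‖b n‖) {T : ℝ} (hT : ∀ θ, ‖∑' n, a n * circlePt 1 θ ^ n‖ ≤ T) :
    ‖∑' n, a n * (starRingEnd ℂ) (b n)‖ ≤ T * ∫ θ, ‖∑' n, b n * circlePt 1 θ ^ n‖ ∂circMeas := by
  rw [(hasSum_parseval ha hb).tsum_eq, ← integral_const_mul]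
  refine norm_integral_le_of_norm_le ((integrable_circMeas_of_continuous
    (continuous_tsum_circle hb).norm).const_mul T) (Eventually.of_forall fun θ => ?_)
  rw [norm_mul, RCLike.norm_conj]
  gcongr
  exact hT θ

/-- The beta-type integrals `∫_0^1 t^{n+1/p} (1-t)^{b-1} dt`. -/
def betaMoment (s b : ℝ) (n : ℕ) : ℝ := ∫ t in (0 : ℝ)..1, t ^ n * (t ^ s * (1 - t) ^ (b - 1))

lemma continuous_betaWeight {s b : ℝ} (hs : 0 ≤ s) (hb : 1 ≤ b) :
    Continuous fun t : ℝ => t ^ s * (1 - t) ^ (b - 1) :=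
  (Real.continuous_rpow_const hs).mul
    ((continuous_const.sub continuous_id).rpow_const fun _ => Or.inr (by linarith))

lemma betaMoment_zero_pos {s b : ℝ} (hs : 0 ≤ s) (hb : 1 ≤ b) : 0 < betaMoment s b 0 := by
  refine intervalIntegral.intervalIntegral_pos_of_pos_on ?_ (fun t ht => ?_) one_pos
  · exact ((continuous_pow 0).mul (continuous_betaWeight hs hb)).intervalIntegrable _ _
  · have h1 : 0 < 1 - t := sub_pos.2 ht.2
    have h0 := ht.1
    positivity

lemma betaMoment_le {s b : ℝ} (hs : 0 ≤ s) (hb : 1 ≤ b) (n : ℕ) :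
    betaMoment s b n ≤ betaMoment s b 0 := by
  refine intervalIntegral.integral_mono_on zero_le_one
    (((continuous_pow n).mul (continuous_betaWeight hs hb)).intervalIntegrable _ _)
    (((continuous_pow 0).mul (continuous_betaWeight hs hb)).intervalIntegrable _ _) fun t ht => ?_
  have h1 : 0 ≤ 1 - t := sub_nonneg.2 ht.2
  have h0 := ht.1
  rw [pow_zero]
  gcongr
  exact pow_le_one₀ h0 ht.2

lemma betaMoment_nonneg (s b : ℝ) (n : ℕ) : 0 ≤ betaMoment s b n := by
  refine intervalIntegral.integral_nonneg zero_le_one fun t ht => ?_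
  have h1 : 0 ≤ 1 - t := sub_nonneg.2 ht.2
  have h0 := ht.1
  positivity

lemma betaMoment_rec {s b : ℝ} (hs : 0 ≤ s) (hb : 1 ≤ b) (n : ℕ) :
    (n + 1 + s + b) * betaMoment s b (n + 1) = (n + 1 + s) * betaMoment s b n := by
  have hc := continuous_betaWeight hs hb
  have hi : ∀ n : ℕ, IntervalIntegrable (fun t : ℝ => t ^ n * (t ^ s * (1 - t) ^ (b - 1)))
      volume 0 1 := fun n => ((continuous_pow n).mul hc).intervalIntegrable _ _
  have hn : (0 : ℝ) ≤ n := Nat.cast_nonneg n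
  have hF : ContinuousOn (fun t : ℝ => t ^ (n + 1 + s) * (1 - t) ^ b) (Icc 0 1) := by
    refine Continuous.continuousOn ((Real.continuous_rpow_const (by positivity)).mul
      ((continuous_const.sub continuous_id).rpow_const fun _ => Or.inr (by linarith)))
  have hderiv : ∀ t ∈ Ioo (0 : ℝ) 1, HasDerivAt (fun t : ℝ => t ^ (n + 1 + s) * (1 - t) ^ b)
      ((n + 1 + s) * (t ^ n * (t ^ s * (1 - t) ^ (b - 1))) -
        (n + 1 + s + b) * (t ^ (n + 1) * (t ^ s * (1 - t) ^ (b - 1)))) t := by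
    intro t ht
    have h0 := ht.1
    have h1 : 0 < 1 - t := sub_pos.2 ht.2
    have d1 := Real.hasDerivAt_rpow_const (x := t) (p := n + 1 + s) (Or.inl h0.ne')
    have d2 : HasDerivAt (fun t : ℝ => (1 - t) ^ b) (-1 * b * (1 - t) ^ (b - 1)) t :=
      ((hasDerivAt_id t).const_sub 1).rpow_const (Or.inl h1.ne')
    refine (d1.mul d2).congr_deriv ?_
    have e1 : t ^ ((n : ℝ) + 1 + s - 1) = t ^ n * t ^ s := by
      rw [← Real.rpow_natCast, ← Real.rpow_add h0]; congr 1; ring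
    have e2 : t ^ ((n : ℝ) + 1 + s) = t ^ (n + 1) * t ^ s := by
      rw [← Real.rpow_natCast, ← Real.rpow_add h0]; congr 1; push_cast; ring
    have e3 : (1 - t) ^ b = (1 - t) * (1 - t) ^ (b - 1) := by
      rw [Real.rpow_sub_one h1.ne']; field_simp
    rw [e1, e2, e3, pow_succ]
    ring
  have key := intervalIntegral.integral_eq_sub_of_hasDerivAt_of_le zero_le_one hF hderiv
    (((hi n).const_mul _).sub ((hi (n + 1)).const_mul _))
  rw [intervalIntegral.integral_sub ((hi n).const_mul _) ((hi (n + 1)).const_mul _),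
    intervalIntegral.integral_const_mul, intervalIntegral.integral_const_mul, sub_self,
    Real.zero_rpow (by positivity), Real.zero_rpow (by positivity)] at key
  simp only [betaMoment]
  linarith

/-- The integral of a Poisson-type kernel against the beta weight. -/
lemma hasDerivAt_div_rpow {ρ b t : ℝ} (hρ0 : 0 ≤ ρ) (hρ1 : ρ < 1) (hb : 0 < b)
    (ht : t ∈ Ioo (0 : ℝ) 1) :
    HasDerivAt (fun t : ℝ => -((1 - t) / (1 - t * ρ)) ^ b / (b * (1 - ρ)))
      ((1 - t) ^ (b - 1) * (1 - t * ρ) ^ (-b - 1)) t := by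
  have h1 : 0 < 1 - t := sub_pos.2 ht.2
  have h2 : 0 < 1 - t * ρ := by nlinarith [ht.1, ht.2]
  have h3 : 0 < 1 - ρ := sub_pos.2 hρ1
  have d1 : HasDerivAt (fun t : ℝ => (1 - t) / (1 - t * ρ))
      ((-1 * (1 - t * ρ) - (1 - t) * -(1 * ρ)) / (1 - t * ρ) ^ 2) t :=
    ((hasDerivAt_id t).const_sub 1).div (((hasDerivAt_id t).mul_const ρ).const_sub 1) h2.ne'
  have d2 := ((d1.rpow_const (p := b) (Or.inl (by positivity))).neg).div_const (b * (1 - ρ))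
  refine d2.congr_deriv ?_
  have e : (1 - t * ρ) ^ (-b - 1) = ((1 - t * ρ) ^ (b - 1))⁻¹ / (1 - t * ρ) ^ 2 := by
    rw [show -b - 1 = -(b - 1) - 2 by ring, Real.rpow_sub h2, Real.rpow_neg h2.le, Real.rpow_two]
  rw [Real.div_rpow h1.le h2.le, e]
  have h4 : 0 < (1 - t * ρ) ^ (b - 1) := by positivity
  field_simp
  ring

lemma integral_one_sub_rpow_mul {ρ b : ℝ} (hρ0 : 0 ≤ ρ) (hρ1 : ρ < 1) (hb : 1 ≤ b) :
    IntervalIntegrable (fun t : ℝ => (1 - t) ^ (b - 1) * (1 - t * ρ) ^ (-b - 1)) volume 0 1 ∧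
      ∫ t in (0 : ℝ)..1, (1 - t) ^ (b - 1) * (1 - t * ρ) ^ (-b - 1) = 1 / (b * (1 - ρ)) := by
  have hpos : ∀ t ∈ Icc (0 : ℝ) 1, 0 < 1 - t * ρ := fun t ht => by nlinarith [ht.1, ht.2]
  have hc : ContinuousOn (fun t : ℝ => (1 - t) ^ (b - 1) * (1 - t * ρ) ^ (-b - 1)) (Icc 0 1) := by
    refine ContinuousOn.mul (ContinuousOn.rpow_const (by fun_prop) fun _ _ =>
      Or.inr (by linarith)) (ContinuousOn.rpow_const (by fun_prop) fun t ht =>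
      Or.inl (hpos t ht).ne')
  have hi : IntervalIntegrable (fun t : ℝ => (1 - t) ^ (b - 1) * (1 - t * ρ) ^ (-b - 1))
      volume 0 1 := ContinuousOn.intervalIntegrable (by rwa [uIcc_of_le zero_le_one])
  refine ⟨hi, ?_⟩
  have hF : ContinuousOn (fun t : ℝ => -((1 - t) / (1 - t * ρ)) ^ b / (b * (1 - ρ)))
      (Icc 0 1) := by
    refine ContinuousOn.div_const (ContinuousOn.neg (ContinuousOn.rpow_const
      (ContinuousOn.div (by fun_prop) (by fun_prop) fun t ht => (hpos t ht).ne')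
      fun _ _ => Or.inr (by linarith))) _
  rw [intervalIntegral.integral_eq_sub_of_hasDerivAt_of_le zero_le_one hF
    (fun t ht => hasDerivAt_div_rpow hρ0 hρ1 (by linarith) ht) hi]
  simp only [sub_self, zero_div, zero_mul, sub_zero, div_one, Real.one_rpow]
  rw [Real.zero_rpow (by linarith)]
  ring

/-- The Taylor coefficients of `(1 - z)^{-β}`. -/
def binCoeff (β n : ℕ) : ℝ := ((n + (β - 1)).choose (β - 1) : ℕ)

lemma binCoeff_pos (β n : ℕ) : 0 < binCoeff β n :=
  Nat.cast_pos.2 (Nat.choose_pos (Nat.le_add_left _ _))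

lemma binCoeff_rec {β : ℕ} (hβ : 1 ≤ β) (n : ℕ) :
    binCoeff β (n + 1) * (n + 1) = binCoeff β n * (n + β) := by
  obtain ⟨j, rfl⟩ := Nat.exists_eq_add_of_le' hβ
  have h := Nat.choose_mul_succ_eq (n + j) j
  rw [show n + j + 1 - j = n + 1 by omega, show n + j + 1 = n + 1 + j by ring] at h
  simp only [binCoeff, Nat.add_sub_cancel]
  have h' : (((n + 1 + j).choose j : ℕ) : ℝ) * ((n + 1 : ℕ) : ℝ) =
      ((n + j).choose j : ℕ) * ((n + 1 + j : ℕ) : ℝ) := by exact_mod_cast h.symm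
  push_cast at h' ⊢
  rw [h']; ring

lemma isSubexp_binCoeff (β : ℕ) : IsSubexp fun n => ((binCoeff β n : ℝ) : ℂ) := by
  intro ρ h0 h1
  have hx : ‖ρ‖ < 1 := by rwa [Real.norm_of_nonneg h0]
  refine (summable_choose_mul_geometric_of_norm_lt_one (β - 1) hx).congr fun n => ?_
  rw [Complex.norm_real, Real.norm_of_nonneg (binCoeff_pos β n).le, binCoeff]

lemma hasSum_binCoeff {β : ℕ} (hβ : 1 ≤ β) {z : ℂ} (hz : ‖z‖ < 1) :
    HasSum (fun n => ((binCoeff β n : ℝ) : ℂ) * z ^ n) (((1 - z)⁻¹) ^ β) := by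
  have h := hasSum_choose_mul_geometric_of_norm_lt_one (β - 1) hz
  rw [Nat.sub_add_cancel hβ, one_div, ← inv_pow] at h
  refine h.congr_fun fun n => ?_
  simp only [binCoeff]
  push_cast; rfl

/-- The multiplier identity linking `kernelCoeff`, `binCoeff` and `betaMoment`. -/
lemma exists_binCoeff_mul_betaMoment_eq {p b : ℝ} {β : ℕ} (hp0 : 0 < p) (hp1 : p < 1)
    (hβ : 1 ≤ β) (hb : b = β - 1 / p) (hb1 : 1 ≤ b) :
    ∃ κ > (0 : ℝ), ∀ n : ℕ, binCoeff β n * (n + β) *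
      momentCoeff (nuWeight (1 / p - 2)) (n + 1) * betaMoment (1 / p) b n = κ * (n + 1) := by
  have hp : 1 < 1 / p := (one_lt_div hp0).2 hp1
  have hα : -1 < 1 / p - 2 := by linarith
  have hβ0 : (0 : ℝ) < β := by exact_mod_cast hβ
  refine ⟨binCoeff β 0 * β * momentCoeff (nuWeight (1 / p - 2)) 1 * betaMoment (1 / p) b 0,
    ?_, fun n => ?_⟩
  · have h1 := binCoeff_pos β 0
    have h2 := momentCoeff_nuWeight_pos hα 1
    have h3 := betaMoment_zero_pos (by positivity : 0 ≤ 1 / p) hb1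
    positivity
  · induction n with
    | zero => simp
    | succ n ih =>
      set κ := binCoeff β 0 * β * momentCoeff (nuWeight (1 / p - 2)) 1 * betaMoment (1 / p) b 0
      have r1 := binCoeff_rec hβ n
      have r2 := momentCoeff_nuWeight_rec hα (n + 1)
      have r3 := betaMoment_rec (by positivity : 0 ≤ 1 / p) hb1 n
      have hn : (0 : ℝ) ≤ n := Nat.cast_nonneg n
      push_cast at r2 ⊢
      set s := 1 / p
      have e1 : binCoeff β (n + 1) = binCoeff β n * (n + β) / (n + 1) := by
        rw [eq_div_iff (by positivity)]; exact r1
      have e2 : momentCoeff (nuWeight (s - 2)) (n + 1 + 1) =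
          (n + 2) * momentCoeff (nuWeight (s - 2)) (n + 1) / (n + 1 + s) := by
        rw [eq_div_iff (by positivity)]; linarith
      have e3 : betaMoment s b (n + 1) = (n + 1 + s) * betaMoment s b n / (n + 1 + β) := by
        rw [eq_div_iff (by positivity)]
        rw [show (n : ℝ) + 1 + s + b = n + 1 + β by rw [hb]; ring] at r3
        linarith
      rw [e1, e2, e3]
      have hs : (0 : ℝ) < n + 1 + s := by positivity
      have hβn : (0 : ℝ) < n + 1 + β := by positivity
      have hn1 : (0 : ℝ) < n + 1 := by positivity
      calc _ = (binCoeff β n * (n + β) * momentCoeff (nuWeight (s - 2)) (n + 1) *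
            betaMoment s b n) * (n + 2) / (n + 1) := by field_simp
        _ = κ * (n + 1) * (n + 2) / (n + 1) := by rw [ih]
        _ = _ := by field_simp; ring

/-- Pointwise bound for the kernel transform of `∑ φ_n w^n`. -/
lemma exists_norm_tsum_kernelCoeff_le {ω : ℝ → ℝ} (hω : IsRadialWeight ω)
    (hpos : ∀ r ∈ Ico (0 : ℝ) 1, 0 < omegaHat ω r) (hD : InDhat ω) {β : ℕ} (hβ : 1 ≤ β) (b : ℝ) :
    ∃ C > (0 : ℝ), ∀ φ : ℕ → ℂ, IsSubexp φ → ∀ v : ℂ, ‖v‖ < 1 → ∀ T : ℝ, 0 ≤ T →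
      (∀ w : ℂ, ‖w‖ ≤ (1 + ‖v‖) / 2 →
        (1 - ‖w‖) ^ b * ‖∑' n, φ n * w ^ n‖ ≤ T * omegaHat ω ‖w‖) →
      ‖∑' n, ((kernelCoeff ω β n : ℝ) : ℂ) * φ n * v ^ n‖ ≤ C * T * (1 - ‖v‖) ^ (-b - 1) := by
  obtain ⟨C, hC, hK⟩ := exists_integral_norm_kernel_le hω hpos hD hβ
  refine ⟨2 ^ (b + 1) * C, by positivity, fun φ hφ v hv T hT H => ?_⟩
  set ρ := ‖v‖ with hρ
  have hρ0 : 0 ≤ ρ := norm_nonneg v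
  set ρ' := (1 + ρ) / 2 with hρ'
  have hρ'0 : 0 < ρ' := by positivity
  have hρ'1 : ρ' < 1 := by rw [hρ']; linarith
  set x := ρ / ρ' with hx
  have hx0 : 0 ≤ x := by positivity
  have hxρ' : x ≤ ρ' := by
    rw [hx, div_le_iff₀ hρ'0, hρ']
    nlinarith [sq_nonneg (1 - ρ)]
  have hx1 : x < 1 := hxρ'.trans_lt hρ'1
  have h1x : (1 - ρ) / 2 ≤ 1 - x := by
    have : 1 - ρ' = (1 - ρ) / 2 := by rw [hρ']; ring
    linarith
  obtain ⟨u, hu, huv⟩ : ∃ u : ℂ, ‖u‖ = 1 ∧ v = ρ * u := by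
    by_cases hv0 : v = 0
    · exact ⟨1, norm_one, by rw [hρ, hv0]; simp⟩
    · have hρne : (ρ : ℂ) ≠ 0 := by
        rw [hρ]; exact_mod_cast norm_ne_zero_iff.2 hv0
      refine ⟨v / ρ, ?_, by field_simp⟩
      rw [norm_div, Complex.norm_real, Real.norm_of_nonneg hρ0, ← hρ]
      exact div_self (by exact_mod_cast hρne)
  have hnu : ‖(ρ' : ℂ) * u‖ = ρ' := by
    rw [norm_mul, hu, mul_one, Complex.norm_real, Real.norm_of_nonneg hρ'0.le]
  have hsa : Summable fun n => ‖φ n * ((ρ' : ℂ) * u) ^ n‖ :=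
    (hφ ρ' hρ'0.le hρ'1).congr fun n => by rw [norm_mul, norm_pow, hnu]
  have hsb : Summable fun n => ‖((kernelCoeff ω β n : ℝ) : ℂ) * (x : ℂ) ^ n‖ :=
    (isSubexp_kernelCoeff hω hpos hD β x hx0 hx1).congr fun n => by
      rw [norm_mul, norm_pow, Complex.norm_real x, Real.norm_of_nonneg hx0]
  have h1ρ' : 0 < 1 - ρ' := sub_pos.2 hρ'1
  have hW' := hpos ρ' ⟨hρ'0.le, hρ'1⟩
  have hsup : ∀ θ, ‖∑' n, φ n * ((ρ' : ℂ) * u) ^ n * circlePt 1 θ ^ n‖ ≤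
      T * omegaHat ω ρ' / (1 - ρ') ^ b := by
    intro θ
    have hnw : ‖(ρ' : ℂ) * u * circlePt 1 θ‖ = ρ' := by
      rw [norm_mul, hnu, norm_circlePt_one, mul_one]
    have h := H ((ρ' : ℂ) * u * circlePt 1 θ) (by rw [hnw])
    rw [hnw] at h
    rw [le_div_iff₀ (by positivity), mul_comm]
    refine le_trans (le_of_eq ?_) h
    congr 2
    exact tsum_congr fun n => by rw [mul_pow _ (circlePt 1 θ), mul_assoc]
  have hmain := norm_tsum_mul_conj_le hsa hsb hsup
  have hre : ∑' n, φ n * ((ρ' : ℂ) * u) ^ n *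
      (starRingEnd ℂ) (((kernelCoeff ω β n : ℝ) : ℂ) * (x : ℂ) ^ n) =
      ∑' n, ((kernelCoeff ω β n : ℝ) : ℂ) * φ n * v ^ n := by
    refine tsum_congr fun n => ?_
    have hne : (ρ' : ℂ) ≠ 0 := by exact_mod_cast hρ'0.ne'
    rw [map_mul, map_pow, Complex.conj_ofReal, Complex.conj_ofReal, huv,
      show (ρ : ℂ) = ρ' * x by rw [hx]; push_cast; field_simp]
    ring
  rw [hre] at hmain
  have hWx := hpos x ⟨hx0, hx1⟩
  have hWle : omegaHat ω ρ' ≤ omegaHat ω x := omegaHat_anti hω hx0 hxρ' hρ'1.le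
  have h1ρ : 0 < 1 - ρ := sub_pos.2 hv
  have h1x0 : 0 < 1 - x := sub_pos.2 hx1
  have e : 1 - ρ' = (1 - ρ) / 2 := by rw [hρ']; ring
  calc _ ≤ T * omegaHat ω ρ' / (1 - ρ') ^ b * (C / ((1 - x) * omegaHat ω x)) :=
        hmain.trans (by gcongr; exact hK x ⟨hx0, hx1⟩)
    _ ≤ T * omegaHat ω x / (1 - ρ') ^ b * (C / ((1 - ρ) / 2 * omegaHat ω x)) := by gcongr
    _ = _ := by
        rw [e, Real.div_rpow h1ρ.le zero_le_two, Real.rpow_sub_one h1ρ.ne',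
          Real.rpow_neg h1ρ.le, Real.rpow_add_one two_ne_zero]
        have : 0 < (1 - ρ) ^ b := by positivity
        field_simp

lemma betaWeight_le_one {s b t : ℝ} (hs : 0 ≤ s) (hb : 1 ≤ b) (h0 : 0 ≤ t) (h1 : t ≤ 1) :
    t ^ s * (1 - t) ^ (b - 1) ≤ 1 :=
  mul_le_one₀ (Real.rpow_le_one h0 h1 hs) (by have := sub_nonneg.2 h1; positivity)
    (Real.rpow_le_one (sub_nonneg.2 h1) (by linarith) (by linarith))

lemma norm_ofReal_mul_le {t : ℝ} (h0 : 0 ≤ t) (h1 : t ≤ 1) (v : ℂ) : ‖(t : ℂ) * v‖ ≤ ‖v‖ := by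
  rw [norm_mul, Complex.norm_real, Real.norm_of_nonneg h0]
  exact mul_le_of_le_one_left (norm_nonneg v) h1

/-- Multiplying the coefficients by beta moments is integration over radii. -/
lemma hasSum_betaMoment_mul {s b : ℝ} (hs : 0 ≤ s) (hb : 1 ≤ b) {c : ℕ → ℂ} (hc : IsSubexp c)
    {v : ℂ} (hv : ‖v‖ < 1) :
    HasSum (fun n => c n * v ^ n * ((betaMoment s b n : ℝ) : ℂ))
      (∫ t in (0 : ℝ)..1, ((t ^ s * (1 - t) ^ (b - 1) : ℝ) : ℂ) *
        ∑' n, c n * ((t : ℂ) * v) ^ n) := by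
  have hw := continuous_betaWeight hs hb
  have hIoc : ∀ t ∈ uIoc (0 : ℝ) 1, 0 ≤ t ∧ t ≤ 1 := fun t ht => by
    rw [uIoc_of_le zero_le_one] at ht; exact ⟨ht.1.le, ht.2⟩
  have h := intervalIntegral.hasSum_integral_of_dominated_convergence (μ := volume) (a := 0)
    (b := 1) (F := fun n t => ((t ^ s * (1 - t) ^ (b - 1) : ℝ) : ℂ) * (c n * ((t : ℂ) * v) ^ n))
    (f := fun t => ((t ^ s * (1 - t) ^ (b - 1) : ℝ) : ℂ) * ∑' n, c n * ((t : ℂ) * v) ^ n)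
    (fun n _ => ‖c n‖ * ‖v‖ ^ n) (fun n => ?_) (fun n => ?_) ?_ ?_ ?_
  · refine h.congr_fun fun n => ?_
    have e : ∀ t : ℝ, ((t ^ s * (1 - t) ^ (b - 1) : ℝ) : ℂ) * (c n * ((t : ℂ) * v) ^ n) =
        c n * v ^ n * ((t ^ n * (t ^ s * (1 - t) ^ (b - 1)) : ℝ) : ℂ) := fun t => by
      rw [mul_pow]; push_cast; ring
    simp only [e]
    rw [intervalIntegral.integral_const_mul, intervalIntegral.integral_ofReal, betaMoment]
  · refine Continuous.aestronglyMeasurable ?_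
    exact (Complex.continuous_ofReal.comp hw).mul (by fun_prop)
  · refine Eventually.of_forall fun t ht => ?_
    obtain ⟨h0, h1⟩ := hIoc t ht
    have hw0 : 0 ≤ t ^ s * (1 - t) ^ (b - 1) := by have := sub_nonneg.2 h1; positivity
    rw [norm_mul, Complex.norm_real, Real.norm_of_nonneg hw0, norm_mul, norm_pow]
    calc _ ≤ 1 * (‖c n‖ * ‖v‖ ^ n) := by
          gcongr
          · exact betaWeight_le_one hs hb h0 h1
          · exact norm_ofReal_mul_le h0 h1 v
      _ = _ := one_mul _
  · exact Eventually.of_forall fun t _ => hc _ (norm_nonneg v) hv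
  · exact intervalIntegrable_const
  · refine Eventually.of_forall fun t ht => ?_
    obtain ⟨h0, h1⟩ := hIoc t ht
    refine HasSum.mul_left _ (Summable.hasSum (Summable.of_norm ?_))
    refine (hc ‖(t : ℂ) * v‖ (norm_nonneg _)
      ((norm_ofReal_mul_le h0 h1 v).trans_lt hv)).congr fun n => ?_
    rw [norm_mul (c n), norm_pow]

/-- Coefficients of the derivative of the symbol representing a functional. -/
def symbolCoeff (ω : ℝ → ℝ) (p : ℝ) (n : ℕ) : ℝ :=
  (n + 1) / (momentCoeff ω (n + 1) * momentCoeff (nuWeight (1 / p - 2)) (n + 1))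

/-- The derivative of the symbol is bounded in terms of the values of the functional on test
functions. -/
lemma exists_norm_tsum_symbolCoeff_le {ω : ℝ → ℝ} (hω : IsRadialWeight ω)
    (hpos : ∀ r ∈ Ico (0 : ℝ) 1, 0 < omegaHat ω r) (hD : InDhat ω) {p b : ℝ} {β : ℕ}
    (hp0 : 0 < p) (hp1 : p < 1) (hβ : 1 ≤ β) (hb : b = β - 1 / p) (hb1 : 1 ≤ b) :
    (IsSubexp fun n => ((symbolCoeff ω p n : ℝ) : ℂ)) ∧
    ∃ C > (0 : ℝ), ∀ ℓ : ℕ → ℂ, IsSubexp ℓ → ∀ v : ℂ, ‖v‖ < 1 → ∀ T : ℝ, 0 ≤ T →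
      (∀ w : ℂ, ‖w‖ ≤ (1 + ‖v‖) / 2 →
        (1 - ‖w‖) ^ b * ‖∑' n, ((binCoeff β n : ℝ) : ℂ) * ℓ n * w ^ n‖ ≤ T * omegaHat ω ‖w‖) →
      (1 - ‖v‖) * ‖∑' n, ((symbolCoeff ω p n : ℝ) : ℂ) * ℓ n * v ^ n‖ ≤ C * T := by
  have hα : -1 < 1 / p - 2 := by linarith [(one_lt_div hp0).2 hp1]
  have hs : 0 ≤ 1 / p := by positivity
  have hβ0 : (0 : ℝ) < β := by exact_mod_cast hβ
  obtain ⟨κ, hκ, hκn⟩ := exists_binCoeff_mul_betaMoment_eq hp0 hp1 hβ hb hb1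
  obtain ⟨C, hC, hΨ⟩ := exists_norm_tsum_kernelCoeff_le hω hpos hD hβ b
  have hid : ∀ n, symbolCoeff ω p n =
      κ⁻¹ * (kernelCoeff ω β n * binCoeff β n * betaMoment (1 / p) b n) := by
    intro n
    have h1 := momentCoeff_pos hω hpos (n + 1)
    have h2 := momentCoeff_nuWeight_pos hα (n + 1)
    have h3 := hκn n
    rw [symbolCoeff, kernelCoeff, eq_inv_mul_iff_mul_eq₀ hκ.ne', ← mul_div_assoc, ← h3]
    generalize momentCoeff (nuWeight (1 / p - 2)) (n + 1) = ν at h2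
    field_simp
  have hKB := (isSubexp_kernelCoeff hω hpos hD β).mul (isSubexp_binCoeff β)
  refine ⟨hKB.of_norm_le (C := κ⁻¹ * betaMoment (1 / p) b 0) fun n => ?_, C / (κ * b),
    by positivity, fun ℓ hℓ v hv T hT H => ?_⟩
  · have h4 := betaMoment_nonneg (1 / p) b n
    rw [hid, Complex.ofReal_mul, Complex.ofReal_mul, Complex.ofReal_mul, norm_mul, norm_mul,
      Complex.norm_real κ⁻¹, Complex.norm_real (betaMoment _ _ _),
      Real.norm_of_nonneg (inv_nonneg.2 hκ.le), Real.norm_of_nonneg h4]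
    calc _ = κ⁻¹ * betaMoment (1 / p) b n *
          ‖((kernelCoeff ω β n : ℝ) : ℂ) * ((binCoeff β n : ℝ) : ℂ)‖ := by ring
      _ ≤ _ := by
          gcongr
          exact betaMoment_le hs hb1 n
  · set c : ℕ → ℂ := fun n =>
      ((kernelCoeff ω β n : ℝ) : ℂ) * (((binCoeff β n : ℝ) : ℂ) * ℓ n) with hc
    have hBℓ := (isSubexp_binCoeff β).mul hℓ
    have hcs : IsSubexp c := (isSubexp_kernelCoeff hω hpos hD β).mul hBℓ
    have hsum := hasSum_betaMoment_mul hs hb1 hcs hv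
    have he : ∑' n, ((symbolCoeff ω p n : ℝ) : ℂ) * ℓ n * v ^ n =
        (κ : ℂ)⁻¹ * ∫ t in (0 : ℝ)..1, ((t ^ (1 / p) * (1 - t) ^ (b - 1) : ℝ) : ℂ) *
          ∑' n, c n * ((t : ℂ) * v) ^ n := by
      rw [← hsum.tsum_eq, ← tsum_mul_left]
      refine tsum_congr fun n => ?_
      rw [hid, hc]
      push_cast
      ring
    obtain ⟨hintg, hval⟩ := integral_one_sub_rpow_mul (norm_nonneg v) hv hb1
    have h1v : 0 < 1 - ‖v‖ := sub_pos.2 hv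
    have hb0 : 0 < b := by linarith
    have hbound : ‖∫ t in (0 : ℝ)..1, ((t ^ (1 / p) * (1 - t) ^ (b - 1) : ℝ) : ℂ) *
        ∑' n, c n * ((t : ℂ) * v) ^ n‖ ≤ C * T * (1 / (b * (1 - ‖v‖))) := by
      rw [← hval, ← intervalIntegral.integral_const_mul]
      refine intervalIntegral.norm_integral_le_of_norm_le zero_le_one
        (Eventually.of_forall fun t ht => ?_) (hintg.const_mul _)
      have h0 := ht.1.le
      have h1 : 0 ≤ 1 - t := sub_nonneg.2 ht.2
      have htv := norm_ofReal_mul_le h0 ht.2 v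
      have htn : ‖(t : ℂ) * v‖ = t * ‖v‖ := by
        rw [norm_mul, Complex.norm_real, Real.norm_of_nonneg h0]
      have h := hΨ _ hBℓ ((t : ℂ) * v) (htv.trans_lt hv) T hT fun w hw => H w (by linarith)
      rw [norm_mul, Complex.norm_real, Real.norm_of_nonneg (by positivity)]
      have hle : t ^ (1 / p) ≤ 1 := Real.rpow_le_one h0 ht.2 hs
      calc _ ≤ (1 * (1 - t) ^ (b - 1)) * (C * T * (1 - t * ‖v‖) ^ (-b - 1)) := by
            rw [← htn]
            gcongr
        _ = _ := by ring
    rw [he, norm_mul, norm_inv, Complex.norm_real, Real.norm_of_nonneg hκ.le]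
    calc _ ≤ (1 - ‖v‖) * (κ⁻¹ * (C * T * (1 / (b * (1 - ‖v‖))))) := by gcongr
      _ = _ := by field_simp

lemma IsLinearOn.map_sub {ω : ℝ → ℝ} {p q : ℝ} {L : (ℂ → ℂ) → ℂ}
    (hL : IsLinearOn (InApq ω p q) L) {f g : ℂ → ℂ} (hf : InApq ω p q f) (hg : InApq ω p q g)
    (hg' : InApq ω p q ((-1 : ℂ) • g)) : L (f - g) = L f - L g := by
  have h : f - g = f + (-1 : ℂ) • g := by rw [neg_one_smul, sub_eq_add_neg]
  rw [h, hL.1 f _ hf hg', hL.2 _ g hg]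
  ring

lemma IsBddAnalytic.smul (c : ℂ) {f : ℂ → ℂ} (hf : IsBddAnalytic f) : IsBddAnalytic (c • f) := by
  obtain ⟨h1, B, hB, h2⟩ := hf
  refine ⟨h1.const_smul c, ‖c‖ * B, by positivity, fun z hz => ?_⟩
  rw [Pi.smul_apply, norm_smul]
  gcongr
  exact h2 z hz

lemma IsBddAnalytic.sub {f g : ℂ → ℂ} (hf : IsBddAnalytic f) (hg : IsBddAnalytic g) :
    IsBddAnalytic (f - g) := by
  obtain ⟨h1, B, hB, h2⟩ := hf
  obtain ⟨h1', B', hB', h2'⟩ := hg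
  refine ⟨h1.sub h1', B + B', by positivity, fun z hz => ?_⟩
  exact (norm_sub_le _ _).trans (add_le_add (h2 z hz) (h2' z hz))

lemma norm_functional_le_of_norm_le {ω : ℝ → ℝ} (hω : IsRadialWeight ω) {p q : ℝ} (hp : 0 < p)
    (hq : 0 < q) {L : (ℂ → ℂ) → ℂ} {M : ℝ} (hM : 0 ≤ M)
    (hb : ∀ f, InApq ω p q f → ‖L f‖ ≤ M * (LpqNormE ω p q f).toReal) {f : ℂ → ℂ}
    (hf : IsBddAnalytic f) {B : ℝ} (hB : 0 ≤ B) (h : ∀ z, ‖z‖ < 1 → ‖f z‖ ≤ B) :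
    ‖L f‖ ≤ M * (B * omegaHat ω 0 ^ (1 / q)) := by
  refine (hb f (hf.inApq hω hp hq)).trans ?_
  have hW0 : 0 ≤ omegaHat ω 0 := by
    have := omegaHat_anti hω le_rfl zero_le_one le_rfl
    rwa [omegaHat_one] at this
  gcongr
  exact ENNReal.toReal_le_of_le_ofReal (by positivity) (LpqNormE_le_of_norm_le hω hp hq hB h)

/-- A bounded functional may be applied termwise to an absolutely convergent power series. -/
lemma IsLinearOn.hasSum {ω : ℝ → ℝ} (hω : IsRadialWeight ω) {p q : ℝ} (hp : 0 < p) (hq : 0 < q)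
    {L : (ℂ → ℂ) → ℂ} (hL : IsLinearOn (InApq ω p q) L) {M : ℝ} (hM : 0 ≤ M)
    (hbd : ∀ f, InApq ω p q f → ‖L f‖ ≤ M * (LpqNormE ω p q f).toReal) (j : ℕ) {b : ℕ → ℂ}
    (hb : Summable fun n => ‖b n‖) {F : ℂ → ℂ} (hFd : DifferentiableOn ℂ F (Metric.ball 0 1))
    (hF : ∀ z : ℂ, ‖z‖ < 1 → HasSum (fun n => b n * z ^ (n + j)) (F z)) :
    HasSum (fun n => b n * L (fun z => z ^ (n + j))) (L F) := by
  have hz : ∀ z : ℂ, ‖z‖ < 1 → ∀ n, ‖b n * z ^ (n + j)‖ ≤ ‖b n‖ := fun z hz n => by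
    rw [norm_mul, norm_pow]
    exact mul_le_of_le_one_right (norm_nonneg _) (pow_le_one₀ (norm_nonneg z) hz.le)
  have hFb : IsBddAnalytic F := ⟨hFd, ∑' n, ‖b n‖, tsum_nonneg fun n => norm_nonneg _,
    fun z hz1 => by
      rw [← (hF z hz1).tsum_eq]
      exact tsum_of_norm_bounded hb.hasSum (hz z hz1)⟩
  have hpow : ∀ n, IsBddAnalytic fun z : ℂ => z ^ (n + j) := fun n => isBddAnalytic_pow _
  rw [HasSum, tendsto_iff_norm_sub_tendsto_zero]
  have hlim : Tendsto (fun S : Finset ℕ => M * ((∑' n : { n // n ∉ S }, ‖b n‖) *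
      omegaHat ω 0 ^ (1 / q))) atTop (nhds 0) := by
    have := ((tendsto_tsum_compl_atTop_zero fun n => ‖b n‖).mul_const
      (omegaHat ω 0 ^ (1 / q))).const_mul M
    simpa using this
  refine squeeze_zero (fun _ => norm_nonneg _) (fun S => ?_) hlim
  have hSb := IsBddAnalytic.sum S b hpow
  rw [norm_sub_rev, ← hL.map_sum hω hp hq S b hpow, ← hL.map_sub (hFb.inApq hω hp hq)
    (hSb.inApq hω hp hq) ((hSb.smul _).inApq hω hp hq)]
  refine norm_functional_le_of_norm_le hω hp hq hM hbd (hFb.sub hSb)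
    (tsum_nonneg fun n => norm_nonneg _) fun z hz1 => ?_
  have hs := (hF z hz1)
  have e : (F - fun z => ∑ i ∈ S, b i * z ^ (i + j)) z =
      ∑' n : { n // n ∉ S }, b n * z ^ ((n : ℕ) + j) := by
    rw [Pi.sub_apply, ← hs.tsum_eq, ← hs.summable.sum_add_tsum_subtype_compl S]
    ring
  rw [e]
  exact tsum_of_norm_bounded ((hb.subtype _).hasSum) fun n => hz z hz1 n

lemma tsum_binCoeff_mul_conj_eq {ω : ℝ → ℝ} (hω : IsRadialWeight ω) {p q : ℝ} (hp : 0 < p)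
    (hq : 0 < q) {L : (ℂ → ℂ) → ℂ} (hL : IsLinearOn (InApq ω p q) L) {M : ℝ} (hM : 0 ≤ M)
    (hbd : ∀ f, InApq ω p q f → ‖L f‖ ≤ M * (LpqNormE ω p q f).toReal) {β : ℕ} (hβ : 1 ≤ β)
    {w : ℂ} (hw : ‖w‖ < 1) :
    ∑' n, ((binCoeff β n : ℝ) : ℂ) * (starRingEnd ℂ) (L fun z => z ^ (n + 1)) * w ^ n =
      (starRingEnd ℂ) (L (testF β w)) := by
  have hcw : ‖(starRingEnd ℂ) w‖ < 1 := by rwa [RCLike.norm_conj]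
  have hs : Summable fun n => ‖((binCoeff β n : ℝ) : ℂ) * (starRingEnd ℂ) w ^ n‖ :=
    (isSubexp_binCoeff β _ (norm_nonneg _) hcw).congr fun n => by rw [norm_mul, norm_pow]
  have h := hL.hasSum hω hp hq hM hbd 1 hs (differentiableOn_testF β hw) fun z hz => by
    have hz1 : ‖(starRingEnd ℂ) w * z‖ < 1 := by
      rw [norm_mul]
      exact mul_lt_one_of_nonneg_of_lt_one_left (norm_nonneg _) hcw hz.le
    refine ((hasSum_binCoeff hβ hz1).mul_left z).congr_fun fun n => ?_
    rw [mul_pow, pow_succ]; ring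
  rw [← h.tsum_eq, Complex.conj_tsum]
  refine tsum_congr fun n => ?_
  simp only [map_mul, map_pow, Complex.conj_conj, Complex.conj_ofReal]
  ring

lemma IsSubexp.of_succ {a : ℕ → ℂ} (h : IsSubexp fun n => a (n + 1)) : IsSubexp a := by
  intro ρ h0 h1
  refine (summable_nat_add_iff 1).1 (((h ρ h0 h1).mul_left ρ).congr fun n => ?_)
  rw [pow_succ]; ring

/-- Taylor coefficients of the symbol representing `L`. -/
def symbolTaylor (ω : ℝ → ℝ) (p : ℝ) (L : (ℂ → ℂ) → ℂ) (n : ℕ) : ℂ :=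
  (starRingEnd ℂ) (L fun z => z ^ n) /
    ((momentCoeff ω n * momentCoeff (nuWeight (1 / p - 2)) n : ℝ) : ℂ)

/-- The analytic symbol representing `L`. -/
def symbolF (ω : ℝ → ℝ) (p : ℝ) (L : (ℂ → ℂ) → ℂ) (z : ℂ) : ℂ :=
  ∑' n, symbolTaylor ω p L n * z ^ n

lemma symbolTaylor_succ (ω : ℝ → ℝ) (p : ℝ) (L : (ℂ → ℂ) → ℂ) (n : ℕ) :
    ((n : ℂ) + 1) * symbolTaylor ω p L (n + 1) =
      ((symbolCoeff ω p n : ℝ) : ℂ) * (starRingEnd ℂ) (L fun z => z ^ (n + 1)) := by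
  rw [symbolTaylor, symbolCoeff]
  push_cast
  ring

lemma isSubexp_functional_pow {ω : ℝ → ℝ} (hω : IsRadialWeight ω) {p q : ℝ} (hp : 0 < p)
    (hq : 0 < q) {L : (ℂ → ℂ) → ℂ} {M : ℝ} (hM : 0 ≤ M)
    (hbd : ∀ f, InApq ω p q f → ‖L f‖ ≤ M * (LpqNormE ω p q f).toReal) :
    IsSubexp fun n => (starRingEnd ℂ) (L fun z => z ^ (n + 1)) :=
  isSubexp_of_norm_le (C := M * (1 * omegaHat ω 0 ^ (1 / q))) fun n => by
    rw [RCLike.norm_conj]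
    refine norm_functional_le_of_norm_le hω hp hq hM hbd (isBddAnalytic_pow _) zero_le_one
      fun z hz => ?_
    rw [norm_pow]
    exact pow_le_one₀ (norm_nonneg z) hz.le

lemma isSubexp_symbolTaylor {ω : ℝ → ℝ} {p : ℝ} {L : (ℂ → ℂ) → ℂ}
    (hs : IsSubexp fun n => ((symbolCoeff ω p n : ℝ) : ℂ))
    (hl : IsSubexp fun n => (starRingEnd ℂ) (L fun z => z ^ (n + 1))) :
    IsSubexp (symbolTaylor ω p L) := by
  refine IsSubexp.of_succ ((hs.mul hl).of_norm_le (C := 1) fun n => ?_)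
  rw [← symbolTaylor_succ, one_mul, norm_mul]
  have e : ‖(n : ℂ) + 1‖ = (n : ℝ) + 1 := by
    rw [show (n : ℂ) + 1 = ((n + 1 : ℕ) : ℂ) by push_cast; rfl, Complex.norm_natCast]
    push_cast; rfl
  rw [e]
  exact le_mul_of_one_le_left (norm_nonneg _) (by linarith [(Nat.cast_nonneg n : (0 : ℝ) ≤ n)])

lemma hasSum_symbolF {ω : ℝ → ℝ} {p : ℝ} {L : (ℂ → ℂ) → ℂ} (h : IsSubexp (symbolTaylor ω p L))
    {z : ℂ} (hz : ‖z‖ < 1) : HasSum (fun n => symbolTaylor ω p L n * z ^ n) (symbolF ω p L z) := by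
  refine Summable.hasSum (Summable.of_norm ((h ‖z‖ (norm_nonneg z) hz).congr fun n => ?_))
  rw [norm_mul, norm_pow]

lemma differentiableOn_symbolF {ω : ℝ → ℝ} {p : ℝ} {L : (ℂ → ℂ) → ℂ}
    (h : IsSubexp (symbolTaylor ω p L)) : DifferentiableOn ℂ (symbolF ω p L) (Metric.ball 0 1) :=
  differentiableOn_of_hasSum h fun _ hz => hasSum_symbolF h hz

lemma taylorCoeff_symbolF {ω : ℝ → ℝ} {p : ℝ} {L : (ℂ → ℂ) → ℂ}
    (h : IsSubexp (symbolTaylor ω p L)) (n : ℕ) :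
    taylorCoeff (symbolF ω p L) n = symbolTaylor ω p L n :=
  taylorCoeff_of_hasSum h (fun _ hz => hasSum_symbolF h hz) n

lemma deriv_symbolF {ω : ℝ → ℝ} {p : ℝ} {L : (ℂ → ℂ) → ℂ} (h : IsSubexp (symbolTaylor ω p L))
    {v : ℂ} (hv : ‖v‖ < 1) :
    deriv (symbolF ω p L) v = ∑' n, ((symbolCoeff ω p n : ℝ) : ℂ) *
      (starRingEnd ℂ) (L fun z => z ^ (n + 1)) * v ^ n := by
  rw [← (hasSum_taylorCoeff (differentiableOn_deriv_ball (differentiableOn_symbolF h)) hv).tsum_eq]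
  refine tsum_congr fun n => ?_
  rw [taylorCoeff_deriv, taylorCoeff_symbolF h, symbolTaylor_succ]

/-- A pointwise bound for the derivative of `f` on the disc of radius `r` controls the Bloch norm
of the dilation `f_r`. -/
lemma BlochNormE_dilateF_le {f : ℂ → ℂ} {r K : ℝ} {Y : ℝ≥0∞} (hr : r ∈ Ioo (0 : ℝ) 1) (hK : 0 < K)
    (h : Y ≠ ⊤ → ∀ v : ℂ, ‖v‖ < r → (1 - ‖v‖) * ‖deriv f v‖ ≤ K * Y.toReal) :
    BlochNormE (dilateF f r) ≤ ENNReal.ofReal ‖f 0‖ + ENNReal.ofReal (2 * K) * Y := by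
  rw [BlochNormE]
  refine add_le_add (by rw [dilateF, mul_zero]) (iSup₂_le fun z hz => ?_)
  rw [mem_ball_zero_iff] at hz
  rcases eq_or_ne Y ⊤ with hY | hY
  · rw [hY, ENNReal.mul_top (by simpa using hK)]
    exact le_top
  · have hrz : ‖(r : ℂ) * z‖ = r * ‖z‖ := by
      rw [norm_mul, Complex.norm_real, Real.norm_of_nonneg hr.1.le]
    have h1 := h hY ((r : ℂ) * z) (by rw [hrz]; exact mul_lt_of_lt_one_right hr.1 hz)
    rw [hrz] at h1
    rw [← ENNReal.ofReal_toReal hY, ← ENNReal.ofReal_mul (by positivity)]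
    refine ENNReal.ofReal_le_ofReal ?_
    rw [deriv_dilateF, norm_mul, Complex.norm_real, Real.norm_of_nonneg hr.1.le]
    have h2 : (1 - ‖z‖ ^ 2) * r ≤ 2 * (1 - r * ‖z‖) := by
      have hz0 := norm_nonneg z
      nlinarith [hr.1, hr.2, mul_nonneg hr.1.le (sq_nonneg (1 - ‖z‖))]
    calc (1 - ‖z‖ ^ 2) * (r * ‖deriv f (r * z)‖)
        = (1 - ‖z‖ ^ 2) * r * ‖deriv f (r * z)‖ := by ring
      _ ≤ 2 * (1 - r * ‖z‖) * ‖deriv f (r * z)‖ := by gcongr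
      _ ≤ 2 * K * Y.toReal := by linarith

lemma XqNormE_le_of_le {ω : ℝ → ℝ} (hω : IsRadialWeight ω) {q a k A : ℝ} (hq : 1 ≤ q)
    (ha : 0 ≤ a) (hk : 0 ≤ k) (hA : 0 ≤ A) {N : (ℂ → ℂ) → ℝ≥0∞} {f : ℂ → ℂ} {Y : ℝ → ℝ≥0∞}
    (h : ∀ r ∈ Ioo (0 : ℝ) 1, N (dilateF f r) ≤ ENNReal.ofReal a + ENNReal.ofReal k * Y r)
    (hY : ∫⁻ r in Ioo (0 : ℝ) 1, Y r ^ q * ENNReal.ofReal (ω r) ≤ ENNReal.ofReal A) :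
    XqNormE N ω q f ≤
      ENNReal.ofReal ((2 ^ (q - 1) * (a ^ q * omegaHat ω 0 + k ^ q * A)) ^ (1 / q)) := by
  have hq0 : 0 < q := by linarith
  have hW0 : 0 ≤ omegaHat ω 0 := by
    have := omegaHat_anti hω le_rfl zero_le_one le_rfl
    rwa [omegaHat_one] at this
  rw [XqNormE, ← ENNReal.ofReal_rpow_of_nonneg (by positivity) (by positivity)]
  refine ENNReal.rpow_le_rpow ?_ (by positivity)
  have e2 : ENNReal.ofReal (2 ^ (q - 1)) = 2 ^ (q - 1) := by
    rw [← ENNReal.ofReal_rpow_of_pos two_pos, ENNReal.ofReal_ofNat]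
  calc ∫⁻ r in Ioo (0 : ℝ) 1, N (dilateF f r) ^ q * ENNReal.ofReal (ω r)
      ≤ ∫⁻ r in Ioo (0 : ℝ) 1, ENNReal.ofReal (2 ^ (q - 1)) *
          (ENNReal.ofReal (a ^ q) * ENNReal.ofReal (ω r) +
          ENNReal.ofReal (k ^ q) * (Y r ^ q * ENNReal.ofReal (ω r))) := by
        refine setLIntegral_mono' measurableSet_Ioo fun r hr => ?_
        rw [← ENNReal.ofReal_rpow_of_nonneg ha hq0.le, ← ENNReal.ofReal_rpow_of_nonneg hk hq0.le,
          ← mul_assoc (ENNReal.ofReal k ^ q), ← ENNReal.mul_rpow_of_nonneg _ _ hq0.le, ← add_mul,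
          ← mul_assoc, e2]
        gcongr
        exact (ENNReal.rpow_le_rpow (h r hr) hq0.le).trans
          (ENNReal.rpow_add_le_mul_rpow_add_rpow _ _ hq)
    _ = ENNReal.ofReal (2 ^ (q - 1)) * (ENNReal.ofReal (a ^ q) * ENNReal.ofReal (omegaHat ω 0) +
          ENNReal.ofReal (k ^ q) * ∫⁻ r in Ioo (0 : ℝ) 1, Y r ^ q * ENNReal.ofReal (ω r)) := by
        rw [lintegral_const_mul' _ _ ENNReal.ofReal_ne_top,
          lintegral_add_left' ((aemeasurable_weight hω).ennreal_ofReal.const_mul _),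
          lintegral_const_mul' _ _ ENNReal.ofReal_ne_top,
          lintegral_const_mul' _ _ ENNReal.ofReal_ne_top,
          lintegral_weight_Ioo hω le_rfl zero_le_one]
    _ ≤ ENNReal.ofReal (2 ^ (q - 1)) * (ENNReal.ofReal (a ^ q) * ENNReal.ofReal (omegaHat ω 0) +
          ENNReal.ofReal (k ^ q) * ENNReal.ofReal A) := by gcongr
    _ = ENNReal.ofReal (2 ^ (q - 1) * (a ^ q * omegaHat ω 0 + k ^ q * A)) := by
        rw [← ENNReal.ofReal_mul (by positivity), ← ENNReal.ofReal_mul (by positivity),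
          ← ENNReal.ofReal_add (by positivity) (by positivity),
          ← ENNReal.ofReal_mul (by positivity)]

/-- The symbol of a bounded functional lies in `B(q',ω)`, with norm control. -/
lemma exists_XqNormE_symbolF_le {ω : ℝ → ℝ} (hω : IsRadialWeight ω)
    (hpos : ∀ r ∈ Ico (0 : ℝ) 1, 0 < omegaHat ω r) (hD : InDhat ω) {p q q' : ℝ}
    (hp0 : 0 < p) (hp1 : p < 1) (hq : 1 < q) (hq' : q' = q / (q - 1)) :
    ∃ C > (0 : ℝ), ∀ (L : (ℂ → ℂ) → ℂ) (M : ℝ), IsLinearOn (InApq ω p q) L → 0 ≤ M →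
      (∀ f, InApq ω p q f → ‖L f‖ ≤ M * (LpqNormE ω p q f).toReal) →
      IsSubexp (symbolTaylor ω p L) ∧
        XqNormE BlochNormE ω q' (symbolF ω p L) ≤ ENNReal.ofReal (C * M) := by
  have hq0 : 0 < q := by linarith
  have hq'1 : 1 ≤ q' := by
    rw [hq', le_div_iff₀ (by linarith)]; linarith
  have hq'0 : 0 < q' := by linarith
  have hip : 1 < 1 / p := by rw [lt_div_iff₀ hp0]; linarith
  obtain ⟨m, hm1, hm⟩ := hD.exists_pow hω hpos
  obtain ⟨D, hD0, hDb⟩ := id hD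
  obtain ⟨β, hβ⟩ := exists_nat_ge (2 / p + 3 * m + 1)
  have h2p : 2 / p = 2 * (1 / p) := by ring
  have hm0 : (0 : ℝ) ≤ m := Nat.cast_nonneg m
  have hβ2 : 2 ≤ β * p := by
    rw [← div_le_iff₀ hp0]; linarith
  have hβ1 : 1 ≤ β := by
    have : (1 : ℝ) ≤ β := by linarith
    exact_mod_cast this
  set b : ℝ := β - 1 / p with hb
  obtain ⟨C1, hC1, hsum⟩ := exists_sum_functional_testF_le hω hpos hm hp0 hp1 hq hq' hβ2 hb
    (by rw [hb]; linarith)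
  obtain ⟨hsub, C2, hC2, hder⟩ := exists_norm_tsum_symbolCoeff_le hω hpos hD hp0 hp1 hβ1 hb
    (by rw [hb]; linarith)
  have hW : 0 < omegaHat ω 0 := hpos 0 (by simp)
  have hν : 0 < momentCoeff ω 0 * momentCoeff (nuWeight (1 / p - 2)) 0 :=
    mul_pos (momentCoeff_pos hω hpos 0) (momentCoeff_nuWeight_pos (by linarith) 0)
  set κ : ℝ := momentCoeff ω 0 * momentCoeff (nuWeight (1 / p - 2)) 0 with hκ
  set c0 : ℝ := omegaHat ω 0 ^ (1 / q) / κ with hc0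
  set N : ℝ := 2 ^ (q' - 1) * (c0 ^ q' * omegaHat ω 0 +
    (2 * C2) ^ q' * (2 * D * 2 ^ q' * C1)) with hN
  have hN0 : 0 < N := by positivity
  refine ⟨N ^ (1 / q'), by positivity, fun L M hL hM hbd => ?_⟩
  have hℓ := isSubexp_functional_pow hω hp0 hq0 hM hbd
  have hsT := isSubexp_symbolTaylor (ω := ω) (p := p) hsub hℓ
  refine ⟨hsT, ?_⟩
  have hg0 : ‖symbolF ω p L 0‖ ≤ M * c0 := by
    have h1 := taylorCoeff_symbolF hsT 0
    rw [taylorCoeff_zero] at h1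
    rw [h1, symbolTaylor, norm_div, RCLike.norm_conj, Complex.norm_real,
      Real.norm_of_nonneg hν.le, hc0, ← mul_div_assoc]
    refine div_le_div_of_nonneg_right ?_ hν.le
    have := norm_functional_le_of_norm_le hω hp0 hq0 hM hbd (isBddAnalytic_pow 0) zero_le_one
      fun z _ => by simp
    rwa [one_mul] at this
  set X : ℂ → ℝ := fun w => (1 - ‖w‖) ^ b * ‖L (testF β w)‖ with hX
  have hYint := lintegral_iSup_rpow_le hω hpos hD0 hDb hq'0 (X := X)
    (fun w hw => mul_nonneg (Real.rpow_nonneg (by linarith) _) (norm_nonneg _))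
    (hsum L M hL hM hbd)
  have hpt : ∀ r ∈ Ioo (0 : ℝ) 1, BlochNormE (dilateF (symbolF ω p L) r) ≤
      ENNReal.ofReal (M * c0) + ENNReal.ofReal (2 * C2) *
        ⨆ (w : ℂ) (_ : ‖w‖ < (1 + r) / 2), ENNReal.ofReal (X w / omegaHat ω ‖w‖) := by
    intro r hr
    refine (BlochNormE_dilateF_le hr hC2 fun hY v hv => ?_).trans
      (add_le_add_left (ENNReal.ofReal_le_ofReal hg0) _)
    have hv1 : ‖v‖ < 1 := hv.trans hr.2
    rw [deriv_symbolF hsT hv1]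
    refine hder _ hℓ v hv1 _ ENNReal.toReal_nonneg fun w hw => ?_
    have hw2 : ‖w‖ < (1 + r) / 2 := by linarith
    have hw1 : ‖w‖ < 1 := by linarith [hr.2]
    rw [tsum_binCoeff_mul_conj_eq hω hp0 hq0 hL hM hbd hβ1 hw1, RCLike.norm_conj,
      ← div_le_iff₀ (hpos _ ⟨norm_nonneg w, hw1⟩)]
    rw [← ENNReal.ofReal_le_iff_le_toReal hY]
    exact le_iSup₂_of_le (f := fun (w : ℂ) (_ : ‖w‖ < (1 + r) / 2) =>
      ENNReal.ofReal (X w / omegaHat ω ‖w‖)) w hw2 le_rfl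
  refine (XqNormE_le_of_le hω hq'1 (by positivity) (by positivity) (by positivity) hpt
    hYint).trans_eq ?_
  congr 1
  have e : 2 ^ (q' - 1) * ((M * c0) ^ q' * omegaHat ω 0 +
      (2 * C2) ^ q' * (2 * D * 2 ^ q' * (C1 * M ^ q'))) = N * M ^ q' := by
    rw [Real.mul_rpow hM (by positivity), hN]; ring
  rw [e, Real.mul_rpow hN0.le (by positivity), ← Real.rpow_mul hM, mul_one_div_cancel hq'0.ne',
    Real.rpow_one]

lemma mapsTo_real_mul_ball {r : ℝ} (h0 : 0 ≤ r) (h1 : r ≤ 1) :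
    MapsTo (fun z : ℂ => (r : ℂ) * z) (Metric.ball 0 1) (Metric.ball 0 1) := fun z hz => by
  rw [mem_ball_zero_iff] at hz ⊢
  rw [norm_mul, Complex.norm_real, Real.norm_of_nonneg h0]
  exact (mul_le_of_le_one_left (norm_nonneg z) h1).trans_lt hz

lemma differentiableOn_dilateF {f : ℂ → ℂ} (hf : DifferentiableOn ℂ f (Metric.ball 0 1)) {r : ℝ}
    (h0 : 0 ≤ r) (h1 : r ≤ 1) : DifferentiableOn ℂ (dilateF f r) (Metric.ball 0 1) :=
  hf.comp (by fun_prop) (mapsTo_real_mul_ball h0 h1)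

lemma MpE_dilateF_sub_le {f : ℂ → ℂ} (hf : DifferentiableOn ℂ f (Metric.ball 0 1)) {p r s : ℝ}
    (hp0 : 0 < p) (hp1 : p ≤ 1) (hr0 : 0 ≤ r) (hr1 : r ≤ 1) (hs0 : 0 ≤ s) (hs1 : s < 1) :
    MpE p s (dilateF f r - f) ≤ 2 ^ (1 / p) * MpE p s f := by
  have hrs : r * s ≤ s := mul_le_of_le_one_left hs0 hr1
  have hm := ENNReal.rpow_le_rpow ((MpE_dilateF p s r f).trans_le
    (MpE_mono hf hp0 (mul_nonneg hr0 hs0) hrs hs1)) hp0.le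
  simp only [MpE_eq, ← ENNReal.rpow_mul, one_div_mul_cancel hp0.ne', ENNReal.rpow_one] at hm
  rw [MpE_eq, MpE_eq, ← ENNReal.mul_rpow_of_nonneg _ _ (by positivity)]
  refine ENNReal.rpow_le_rpow ?_ (by positivity)
  have hc : Continuous fun θ => f (circlePt s θ) := continuous_circle_dilate hf hs0 hs1
  calc ∫⁻ θ, ENNReal.ofReal (‖(dilateF f r - f) (circlePt s θ)‖ ^ p) ∂circMeas
      ≤ ∫⁻ θ, (ENNReal.ofReal (‖dilateF f r (circlePt s θ)‖ ^ p) +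
          ENNReal.ofReal (‖f (circlePt s θ)‖ ^ p)) ∂circMeas := by
        refine lintegral_mono fun θ => ?_
        rw [← ENNReal.ofReal_add (by positivity) (by positivity)]
        refine ENNReal.ofReal_le_ofReal ?_
        exact (Real.rpow_le_rpow (norm_nonneg _) (norm_sub_le _ _) hp0.le).trans
          (Real.rpow_add_le_add_rpow (norm_nonneg _) (norm_nonneg _) hp0.le hp1)
    _ = (∫⁻ θ, ENNReal.ofReal (‖dilateF f r (circlePt s θ)‖ ^ p) ∂circMeas) +
          ∫⁻ θ, ENNReal.ofReal (‖f (circlePt s θ)‖ ^ p) ∂circMeas :=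
        lintegral_add_right _ (hc.norm.rpow_const fun _ => Or.inr hp0.le).measurable.ennreal_ofReal
    _ ≤ _ := by rw [two_mul]; gcongr

lemma tendsto_MpE_dilateF_sub {f : ℂ → ℂ} (hf : DifferentiableOn ℂ f (Metric.ball 0 1)) {p s : ℝ}
    (hp : 0 < p) (hs0 : 0 ≤ s) (hs1 : s < 1) :
    Tendsto (fun r => MpE p s (dilateF f r - f)) (nhdsWithin 1 (Iio 1)) (nhds 0) := by
  have huc : UniformContinuousOn f (Metric.closedBall 0 s) :=
    (isCompact_closedBall 0 s).uniformContinuousOn_of_continuous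
      (hf.continuousOn.mono (Metric.closedBall_subset_ball hs1))
  refine ENNReal.tendsto_nhds_zero.2 fun ε hε => ?_
  rcases eq_or_ne ε ⊤ with rfl | hε'
  · simp
  have hεr : 0 < ε.toReal := ENNReal.toReal_pos hε.ne' hε'
  obtain ⟨δ, hδ, h⟩ := Metric.uniformContinuousOn_iff.1 huc _ hεr
  have hmem : Ioo (max 0 (1 - δ)) 1 ∈ nhdsWithin (1 : ℝ) (Iio 1) :=
    Ioo_mem_nhdsLT (max_lt one_pos (by linarith))
  filter_upwards [hmem] with r hr
  have hr0 : 0 < r := (le_max_left _ _).trans_lt hr.1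
  have hrδ : 1 - δ < r := (le_max_right _ _).trans_lt hr.1
  rw [← ENNReal.ofReal_toReal hε']
  refine MpE_le_of_norm_le hp hεr.le fun θ => ?_
  have hn : ‖circlePt s θ‖ = s := by rw [norm_circlePt, abs_of_nonneg hs0]
  rw [Pi.sub_apply, dilateF, ← dist_eq_norm]
  refine (h _ ?_ _ ?_ ?_).le
  · rw [mem_closedBall_zero_iff, norm_mul, Complex.norm_real, Real.norm_of_nonneg hr0.le, hn]
    exact mul_le_of_le_one_left hs0 hr.2.le
  · rw [mem_closedBall_zero_iff, hn]
  · have e : (r : ℂ) * circlePt s θ - circlePt s θ = ((r - 1 : ℝ) : ℂ) * circlePt s θ := by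
      push_cast; ring
    rw [dist_eq_norm, e, norm_mul, hn, Complex.norm_real, Real.norm_eq_abs,
      abs_of_neg (by linarith [hr.2])]
    nlinarith [hr.2]

/-- Dilations of a function of `A^{p,q}_ω` converge to it in norm. -/
lemma tendsto_LpqNormE_dilateF_sub {ω : ℝ → ℝ} (hω : IsRadialWeight ω) {p q : ℝ}
    (hp0 : 0 < p) (hp1 : p ≤ 1) (hq : 0 < q) {f : ℂ → ℂ} (hf : InApq ω p q f) :
    (∀ r, 0 ≤ r → r ≤ 1 → InApq ω p q (dilateF f r - f)) ∧
      Tendsto (fun r => LpqNormE ω p q (dilateF f r - f)) (nhdsWithin 1 (Iio 1)) (nhds 0) := by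
  obtain ⟨hfd, hfn⟩ := hf
  rw [LpqNormE, ENNReal.rpow_lt_top_iff_of_pos (by positivity)] at hfn
  have hfin : ∫⁻ s in Ioo (0 : ℝ) 1, (2 ^ (1 / p)) ^ q *
      (MpE p s f ^ q * ENNReal.ofReal (s * ω s)) < ⊤ := by
    rw [lintegral_const_mul' _ _ (by finiteness)]
    exact ENNReal.mul_lt_top (by finiteness) hfn
  have hle : ∀ r, 0 ≤ r → r ≤ 1 → ∀ s ∈ Ioo (0 : ℝ) 1,
      MpE p s (dilateF f r - f) ^ q * ENNReal.ofReal (s * ω s) ≤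
        (2 ^ (1 / p)) ^ q * (MpE p s f ^ q * ENNReal.ofReal (s * ω s)) := by
    intro r h0 h1 s hs
    rw [← mul_assoc, ← ENNReal.mul_rpow_of_nonneg _ _ hq.le]
    gcongr
    exact MpE_dilateF_sub_le hfd hp0 hp1 h0 h1 hs.1.le hs.2
  have hd : ∀ r, 0 ≤ r → r ≤ 1 → DifferentiableOn ℂ (dilateF f r - f) (Metric.ball 0 1) :=
    fun r h0 h1 => (differentiableOn_dilateF hfd h0 h1).sub hfd
  refine ⟨fun r h0 h1 => ⟨hd r h0 h1, ?_⟩, ?_⟩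
  · rw [LpqNormE, ENNReal.rpow_lt_top_iff_of_pos (by positivity)]
    exact (setLIntegral_mono' measurableSet_Ioo (hle r h0 h1)).trans_lt hfin
  · have hmem : Ioo (0 : ℝ) 1 ∈ nhdsWithin (1 : ℝ) (Iio 1) := Ioo_mem_nhdsLT one_pos
    have hlim := tendsto_lintegral_filter_of_dominated_convergence'
      (μ := volume.restrict (Ioo (0 : ℝ) 1)) (l := nhdsWithin (1 : ℝ) (Iio 1))
      (F := fun r s => MpE p s (dilateF f r - f) ^ q * ENNReal.ofReal (s * ω s))
      (f := fun _ => 0) _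
      (by
        filter_upwards [hmem] with r hr
        exact ((aemeasurable_of_monotoneOn_Ioo fun a ha b hb hab =>
          MpE_mono (hd r hr.1.le hr.2.le) hp0 ha.1.le hab hb.2).pow_const q).mul
          (aemeasurable_id'.mul (aemeasurable_weight hω)).ennreal_ofReal)
      (by
        filter_upwards [hmem] with r hr
        exact (ae_restrict_iff' measurableSet_Ioo).2 (.of_forall (hle r hr.1.le hr.2.le)))
      hfin.ne
      ((ae_restrict_iff' measurableSet_Ioo).2 (.of_forall fun s hs => by
        have h1 := (tendsto_MpE_dilateF_sub hfd hp0 hs.1.le hs.2).ennrpow_const q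
        rw [ENNReal.zero_rpow_of_pos hq] at h1
        have h2 := ENNReal.Tendsto.mul_const h1 (b := ENNReal.ofReal (s * ω s))
          (Or.inr ENNReal.ofReal_ne_top)
        rwa [zero_mul] at h2))
    have h3 := hlim.ennrpow_const (1 / q)
    rw [lintegral_zero, ENNReal.zero_rpow_of_pos (by positivity)] at h3
    exact h3

lemma InApq.neg {ω : ℝ → ℝ} {p q : ℝ} {f : ℂ → ℂ} (hf : InApq ω p q f) :
    InApq ω p q ((-1 : ℂ) • f) := by
  refine ⟨hf.1.const_smul _, ?_⟩
  have e : LpqNormE ω p q ((-1 : ℂ) • f) = LpqNormE ω p q f := by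
    simp [LpqNormE, MpE]
  rw [e]
  exact hf.2

lemma isBddAnalytic_dilateF {f : ℂ → ℂ} (hf : DifferentiableOn ℂ f (Metric.ball 0 1)) {r : ℝ}
    (h0 : 0 ≤ r) (h1 : r < 1) : IsBddAnalytic (dilateF f r) := by
  obtain ⟨B, hB⟩ := (isCompact_closedBall (0 : ℂ) r).exists_bound_of_continuousOn
    (hf.continuousOn.mono (Metric.closedBall_subset_ball h1))
  refine ⟨differentiableOn_dilateF hf h0 h1.le, max B 0, le_max_right _ _, fun z hz =>
    (hB _ ?_).trans (le_max_left _ _)⟩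
  rw [mem_closedBall_zero_iff, norm_mul, Complex.norm_real, Real.norm_of_nonneg h0]
  exact mul_le_of_le_one_right h0 hz.le

/-- A bounded functional is represented by its symbol. -/
lemma hasPairingC_symbolF {ω : ℝ → ℝ} (hω : IsRadialWeight ω)
    (hpos : ∀ r ∈ Ico (0 : ℝ) 1, 0 < omegaHat ω r) {p q : ℝ} (hp0 : 0 < p) (hp1 : p < 1)
    (hq : 0 < q) {L : (ℂ → ℂ) → ℂ} {M : ℝ} (hL : IsLinearOn (InApq ω p q) L) (hM : 0 ≤ M)
    (hbd : ∀ f, InApq ω p q f → ‖L f‖ ≤ M * (LpqNormE ω p q f).toReal)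
    (hs : IsSubexp (symbolTaylor ω p L)) {f : ℂ → ℂ} (hf : InApq ω p q f) :
    HasPairingC (fun k => momentCoeff ω k * momentCoeff (nuWeight (1 / p - 2)) k) f
      (symbolF ω p L) (L f) := by
  have hip : 1 < 1 / p := by rw [lt_div_iff₀ hp0]; linarith
  have hsum : ∀ r ∈ Ico (0 : ℝ) 1, HasSum (fun k : ℕ =>
      taylorCoeff f k * (starRingEnd ℂ) (taylorCoeff (symbolF ω p L) k) *
        ((momentCoeff ω k * momentCoeff (nuWeight (1 / p - 2)) k : ℝ) : ℂ) * (r : ℂ) ^ k)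
      (L (dilateF f r)) := by
    intro r hr
    have h1 : Summable fun n => ‖taylorCoeff f n * (r : ℂ) ^ n‖ :=
      (summable_norm_taylorCoeff hf.1 hr.1 hr.2).congr fun n => by
        rw [norm_mul, norm_pow, Complex.norm_real, Real.norm_of_nonneg hr.1]
    refine (hL.hasSum hω hp0 hq hM hbd 0 h1 (differentiableOn_dilateF hf.1 hr.1 hr.2.le)
      fun z hz => ?_).congr_fun fun n => ?_
    · have h2 := mapsTo_real_mul_ball hr.1 hr.2.le (mem_ball_zero_iff.2 hz)
      refine (hasSum_taylorCoeff hf.1 (mem_ball_zero_iff.1 h2)).congr_fun fun n => ?_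
      rw [mul_pow, add_zero, mul_assoc]
    · have hc : ((momentCoeff ω n * momentCoeff (nuWeight (1 / p - 2)) n : ℝ) : ℂ) ≠ 0 :=
        Complex.ofReal_ne_zero.2 (mul_pos (momentCoeff_pos hω hpos n)
          (momentCoeff_nuWeight_pos (by linarith) n)).ne'
      rw [taylorCoeff_symbolF hs, symbolTaylor, map_div₀, Complex.conj_conj, Complex.conj_ofReal,
        mul_assoc _ (_ / _), div_mul_cancel₀ _ hc, add_zero]
      ring
  refine ⟨fun r hr => (hsum r hr).summable, ?_⟩
  obtain ⟨hin, hlim⟩ := tendsto_LpqNormE_dilateF_sub hω hp0 hp1.le hq hf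
  have hmem : Ioo (0 : ℝ) 1 ∈ nhdsWithin (1 : ℝ) (Iio 1) := Ioo_mem_nhdsLT one_pos
  have hLlim : Tendsto (fun r => L (dilateF f r)) (nhdsWithin 1 (Iio 1)) (nhds (L f)) := by
    rw [tendsto_iff_norm_sub_tendsto_zero]
    have h3 := ((ENNReal.tendsto_toReal ENNReal.zero_ne_top).comp hlim).const_mul M
    rw [ENNReal.toReal_zero, mul_zero] at h3
    refine squeeze_zero' (.of_forall fun _ => norm_nonneg _) ?_ h3
    filter_upwards [hmem] with r hr
    rw [← hL.map_sub ((isBddAnalytic_dilateF hf.1 hr.1.le hr.2).inApq hω hp0 hq) hf hf.neg]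
    exact hbd _ (hin r hr.1.le hr.2.le)
  refine hLlim.congr' ?_
  filter_upwards [hmem] with r hr
  exact (hsum r ⟨hr.1.le, hr.2⟩).tsum_eq.symm

lemma LpqNormE_one_pos {ω : ℝ → ℝ} (hω : IsRadialWeight ω)
    (hpos : ∀ r ∈ Ico (0 : ℝ) 1, 0 < omegaHat ω r) {p q : ℝ} (hp : 0 < p) (hq : 0 < q) :
    0 < LpqNormE ω p q fun z => z ^ 0 := by
  have hmeas : AEMeasurable (fun s : ℝ => ENNReal.ofReal (s * ω s))
      (volume.restrict (Ioo (0 : ℝ) 1)) :=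
    (aemeasurable_id'.mul (aemeasurable_weight hω)).ennreal_ofReal
  have h1 : ∫⁻ s in Ioo (0 : ℝ) 1, ENNReal.ofReal (s * ω s) ≠ 0 := by
    intro h
    rw [lintegral_eq_zero_iff' hmeas] at h
    have h0 := momentCoeff_pos hω hpos 0
    rw [momentCoeff_eq] at h0
    refine h0.ne' (integral_eq_zero_of_ae ?_)
    filter_upwards [h, ae_restrict_mem measurableSet_Ioo] with s hs hs1
    have h2 : s * ω s ≤ 0 := ENNReal.ofReal_eq_zero.1 hs
    have h3 : 0 ≤ s * ω s := mul_nonneg hs1.1.le (hω.1 s ⟨hs1.1.le, hs1.2⟩)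
    simpa using le_antisymm h2 h3
  refine ENNReal.rpow_pos_of_nonneg (pos_iff_ne_zero.2 ?_) (by positivity)
  refine ne_of_gt ((pos_iff_ne_zero.2 h1).trans_le
    (setLIntegral_mono' measurableSet_Ioo fun s hs => ?_))
  refine le_mul_of_one_le_left' (ENNReal.one_le_rpow ?_ hq)
  have h := norm_zero_le_MpE (f := fun z : ℂ => z ^ 0) (by fun_prop) hp hs.1.le hs.2
  simpa using h

/-- For `ω ∈ D̂`, `0<p<1` and `1<q<∞`, `(A^{p,q}_ω)* ≃ B(q',ω)` under the
pairing with coefficients `ω_{2n+1} (ν_{1/p-2})_{2n+1}`, with equivalence of norms. -/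
theorem duality_Apq_psmall_qlarge
    (ω : ℝ → ℝ) (hω : IsRadialWeight ω)
    (hpos : ∀ r ∈ Set.Ico (0:ℝ) 1, 0 < omegaHat ω r)
    (hD : InDhat ω)
    (p q q' : ℝ) (hp0 : 0 < p) (hp1 : p < 1) (hq : 1 < q) (hq' : q' = q / (q - 1)) :
    ∃ C₁ > (0:ℝ), ∃ C₂ > (0:ℝ),
      (∀ g : ℂ → ℂ, DifferentiableOn ℂ g (Metric.ball 0 1) →
        XqNormE BlochNormE ω q' g < ⊤ →
        ∀ f : ℂ → ℂ, InApq ω p q f →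
          ∃ l : ℂ, HasPairingC
              (fun k => momentCoeff ω k * momentCoeff (nuWeight (1 / p - 2)) k) f g l ∧
            ‖l‖ ≤ C₂ * (XqNormE BlochNormE ω q' g).toReal * (LpqNormE ω p q f).toReal) ∧
      (∀ L : (ℂ → ℂ) → ℂ, IsLinearOn (InApq ω p q) L →
        (∃ M : ℝ, ∀ f : ℂ → ℂ, InApq ω p q f → ‖L f‖ ≤ M * (LpqNormE ω p q f).toReal) →
        ∃ g : ℂ → ℂ, DifferentiableOn ℂ g (Metric.ball 0 1) ∧
          XqNormE BlochNormE ω q' g < ⊤ ∧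
          (∀ f : ℂ → ℂ, InApq ω p q f → HasPairingC
              (fun k => momentCoeff ω k * momentCoeff (nuWeight (1 / p - 2)) k) f g (L f)) ∧
          (∀ M : ℝ, (∀ f : ℂ → ℂ, InApq ω p q f → ‖L f‖ ≤ M * (LpqNormE ω p q f).toReal) →
            (XqNormE BlochNormE ω q' g).toReal ≤ C₁ * M)) := by
  have hq0 : 0 < q := by linarith
  have hqq : q.HolderConjugate q' := by
    rw [hq']
    exact Real.HolderConjugate.conjExponent hq
  obtain ⟨C₁, hC₁, h1⟩ := exists_XqNormE_symbolF_le hω hpos hD hp0 hp1 hq hq'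
  obtain ⟨C₂, hC₂, h2⟩ := exists_hasPairingC hω hp0 hp1 hqq
  refine ⟨C₁, hC₁, C₂, hC₂, fun g hg hgn f hf => h2 f g hg hgn hf, fun L hL ⟨M, hM⟩ => ?_⟩
  have hnn : ∀ M : ℝ, (∀ f : ℂ → ℂ, InApq ω p q f → ‖L f‖ ≤ M * (LpqNormE ω p q f).toReal) →
      0 ≤ M := by
    intro M hM
    have hone := (isBddAnalytic_pow 0).inApq hω hp0 hq0
    exact nonneg_of_mul_nonneg_left ((norm_nonneg _).trans (hM _ hone))
      (ENNReal.toReal_pos (LpqNormE_one_pos hω hpos hp0 hq0).ne' hone.2.ne)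
  obtain ⟨hs, hX⟩ := h1 L M hL (hnn M hM) hM
  refine ⟨symbolF ω p L, differentiableOn_symbolF hs, hX.trans_lt ENNReal.ofReal_lt_top,
    fun f hf => hasPairingC_symbolF hω hpos hp0 hp1 hq0 hL (hnn M hM) hM hs hf, fun K hK => ?_⟩
  exact ENNReal.toReal_le_of_le_ofReal (mul_nonneg hC₁.le (hnn K hK)) (h1 L K hL (hnn K hK) hK).2
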